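/- arXiv:2310.14080 — 2 statements merged into one kernel-verified Lean document; each statement's English description precedes it below -/
import Mathlib

section
/- There exist three pairwise inequivalent extremal Type II Z4-codes of length 64 and type 4³¹2², i.e., three extremal Type II Z4-codes C ⊆ (ZMod 4)^64 whose residue codes C^(1) have dimension 31 over F₂ (and hence whose 2-torsion parameter is k₂ = 2), no two of which are monomially equivalent. -/
open Finset

def z4Inner {n : ℕ} (x y : Fin n → ZMod 4) : ZMod 4 := ∑ i, x i * y i

def z4Dual {n : ℕ} (C : Set (Fin n → ZMod 4)) : Set (Fin n → ZMod 4) :=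
  {x | ∀ c ∈ C, z4Inner x c = 0}

def IsSelfDualZ4 {n : ℕ} (C : Set (Fin n → ZMod 4)) : Prop := C = z4Dual C

def euclWt {n : ℕ} (x : Fin n → ZMod 4) : ℕ :=
  ∑ i, (if x i = 0 then 0 else if x i = 2 then 4 else 1)

def IsTypeIIZ4 {n : ℕ} (C : Set (Fin n → ZMod 4)) : Prop :=
  IsSelfDualZ4 C ∧ ∀ c ∈ C, 8 ∣ euclWt c

def IsExtremalTypeIIZ4 (n : ℕ) (C : Set (Fin n → ZMod 4)) : Prop :=
  IsTypeIIZ4 C ∧ sInf (euclWt '' (C \ {0})) = 8 * (n / 24) + 8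

def IsEvenVec {n : ℕ} (x : Fin n → ZMod 4) : Prop := ∀ i, x i = 0 ∨ x i = 2

def Sset {n : ℕ} (w : Fin n → ZMod 4) (a : ZMod 4) : Finset (Fin n) :=
  Finset.univ.filter (fun j => w j = a)

def doubled {n : ℕ} (C : Set (Fin n → ZMod 4)) (tu : Fin n → ZMod 4) :
    Set (Fin n → ZMod 4) :=
  {w | ∃ v ∈ C, z4Inner tu v = 0 ∧ ∃ a : ZMod 4, w = v + a • tu}

def bInner {n : ℕ} (x y : Fin n → ZMod 2) : ZMod 2 := ∑ i, x i * y i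

def bDual {n : ℕ} (D : Set (Fin n → ZMod 2)) : Set (Fin n → ZMod 2) :=
  {x | ∀ y ∈ D, bInner x y = 0}

def hWt {n : ℕ} (x : Fin n → ZMod 2) : ℕ := (Finset.univ.filter fun i => x i ≠ 0).card

def IsTypeIIBin {n : ℕ} (D : Set (Fin n → ZMod 2)) : Prop :=
  D = bDual D ∧ ∀ y ∈ D, 4 ∣ hWt y

def IsExtremalTypeIIBin (n : ℕ) (D : Set (Fin n → ZMod 2)) : Prop :=
  IsTypeIIBin D ∧ sInf (hWt '' (D \ {0})) = 4 * (n / 24) + 4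

def residueSet {n : ℕ} (C : Set (Fin n → ZMod 4)) : Set (Fin n → ZMod 2) :=
  {y | ∃ c ∈ C, y = fun i => ZMod.castHom (by norm_num : (2:ℕ) ∣ 4) (ZMod 2) (c i)}

def torsionSet {n : ℕ} (C : Set (Fin n → ZMod 4)) : Set (Fin n → ZMod 2) :=
  {c | (fun i => 2 * ((c i).val : ZMod 4)) ∈ C}

def rInner {n : ℕ} (x y : Fin n → ℝ) : ℝ := ∑ i, x i * y i

def A4lattice {n : ℕ} (C : Set (Fin n → ZMod 4)) : Set (Fin n → ℝ) :=
  {x | ∃ z : Fin n → ℤ, (∀ i, 2 * x i = (z i : ℝ)) ∧ (fun i => (z i : ZMod 4)) ∈ C}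

def dualLattice {n : ℕ} (L : Set (Fin n → ℝ)) : Set (Fin n → ℝ) :=
  {y | ∀ x ∈ L, ∃ m : ℤ, rInner x y = (m : ℝ)}

def IsIntegralLattice {n : ℕ} (L : Set (Fin n → ℝ)) : Prop :=
  ∀ x ∈ L, ∀ y ∈ L, ∃ m : ℤ, rInner x y = (m : ℝ)

def IsEvenLattice {n : ℕ} (L : Set (Fin n → ℝ)) : Prop :=
  IsIntegralLattice L ∧ ∀ x ∈ L, ∃ m : ℤ, rInner x x = 2 * (m : ℝ)

def IsUnimodularLattice {n : ℕ} (L : Set (Fin n → ℝ)) : Prop :=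
  IsIntegralLattice L ∧ L = dualLattice L

def MonomiallyEquiv {n : ℕ} (C D : Set (Fin n → ZMod 4)) : Prop :=
  ∃ (σ : Equiv.Perm (Fin n)) (ε : Fin n → ZMod 4), (∀ i, ε i = 1 ∨ ε i = 3) ∧
    D = (fun x => fun i => ε i * x (σ i)) '' C


/-! ### Computable model: vectors over `ZMod 4` as pairs of 64-bit planes -/

namespace Z4Comp

/-- Sum of two vectors given as (low bits, high bits). -/
def addv (x y : ℕ × ℕ) : ℕ × ℕ :=
  (Nat.xor x.1 y.1, Nat.xor (Nat.xor x.2 y.2) (Nat.land x.1 y.1))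

/-- Binary encoding: the head of the list belongs to the top bit of the message. -/
def enc : List ℕ → ℕ → ℕ
  | [], _ => 0
  | g :: gs, m => bif Nat.testBit m gs.length then Nat.xor g (enc gs m) else enc gs m

/-- Encoding over `ZMod 4` with coefficients in `{0, 1}`. -/
def comb : List (ℕ × ℕ) → ℕ → ℕ × ℕ
  | [], _ => (0, 0)
  | g :: gs, m => bif Nat.testBit m gs.length then addv g (comb gs m) else comb gs m

/-- Number of ones among the lowest `k` bits. -/
def pc : ℕ → ℕ → ℕ
  | 0, _ => 0
  | k + 1, n => n % 2 + pc k (n / 2)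

/-- Parity of the lowest 64 bits. -/
def par (n : ℕ) : ℕ :=
  (fun a => (fun b => (fun c => (fun d => (fun e => (Nat.xor e (Nat.shiftRight e 1)) % 2)
    (Nat.xor d (Nat.shiftRight d 2))) (Nat.xor c (Nat.shiftRight c 4)))
    (Nat.xor b (Nat.shiftRight b 8))) (Nat.xor a (Nat.shiftRight a 16)))
    (Nat.xor n (Nat.shiftRight n 32))

/-- All-one plane of length `2 ^ k`. -/
def ones (k : ℕ) : ℕ := 2 ^ 2 ^ k - 1

/-- The bit plane of coordinate `j`: bit `m` is bit `j` of `enc rows m`. -/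
def plane : List ℕ → ℕ → ℕ
  | [], _ => 0
  | g :: gs, j => Nat.lor (plane gs j) (Nat.shiftLeft
      (bif Nat.testBit g j then Nat.xor (plane gs j) (ones gs.length) else plane gs j)
      (2 ^ gs.length))

/-- Add one plane to a bit-sliced counter. -/
def addBit : List ℕ → ℕ → List ℕ
  | [], p => bif Nat.beq p 0 then [] else [p]
  | c :: cs, p => Nat.xor c p :: addBit cs (Nat.land c p)

/-- Bit-sliced weight counter over the first `j` coordinates. -/
def cnt (rows : List ℕ) : ℕ → List ℕ
  | 0 => []
  | j + 1 => addBit (cnt rows j) (plane rows j)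

/-- Plane of positions where the counter is at least `t`. -/
def ge (full : ℕ) : List ℕ → ℕ → ℕ
  | [], t => bif Nat.beq t 0 then full else 0
  | c :: cs, t => bif Nat.beq (t % 2) 0 then ge full cs (t / 2)
      else Nat.lor (ge full cs (t / 2 + 1)) (Nat.land (ge full cs (t / 2)) c)

/-- Plane of parities of the intersection with `x`: bit `m` is the parity of `enc rows m & x`. -/
def parPl (rows : List ℕ) (x : ℕ) : ℕ := plane (rows.map (fun g => par (Nat.land g x))) 0

def orNZ (rows : List ℕ) : List ℕ → ℕ
  | [] => 0
  | x :: xs => Nat.lor (parPl rows x) (orNZ rows xs)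

def listMask : List ℕ → ℕ
  | [] => 0
  | m :: ms => Nat.lor (Nat.shiftLeft 1 m) (listMask ms)

/-- Every nonzero word has weight at least 6. -/
def chkMin (rows : List ℕ) : Bool :=
  Nat.beq (Nat.lor 1 (ge (ones rows.length) (cnt rows 64) 6)) (ones rows.length)

/-- Words of weight at most 8 are listed. -/
def chkEight (rows : List ℕ) (W : List ℕ) : Bool :=
  Nat.beq (Nat.lor 1 (Nat.lor (listMask W) (ge (ones rows.length) (cnt rows 64) 9)))
    (ones rows.length)

/-- Words of weight at most 16 are listed or have odd intersection with some element of `O`. -/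
def chkSixteen (rows : List ℕ) (O K : List ℕ) : Bool :=
  Nat.beq (Nat.lor 1 (Nat.lor (listMask K) (Nat.lor (orNZ rows O)
    (ge (ones rows.length) (cnt rows 64) 17)))) (ones rows.length)

/-- The data of a code together with its certificates. -/
structure Data where
  L : List (ℕ × ℕ)
  R : List (ℕ × ℕ)
  H : List ℕ
  W1 : List (ℕ × List ℕ)
  W2 : List (ℕ × List ℕ)
  K : List (ℕ × ℕ)
  F : List (ℕ × ℕ)
  S : List ℕ
  x6 : ℕ

namespace Data
variable (D : Data)

def LL : List ℕ := D.L.map Prod.fst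
def RR : List ℕ := D.R.map Prod.fst
def G : List (ℕ × ℕ) := D.L ++ D.R
def T2 : List ℕ := D.RR ++ D.H
def T : List ℕ := D.LL ++ D.T2

/-- A general codeword. -/
def cw (m t : ℕ) : ℕ × ℕ := addv (comb D.G m) (0, enc D.T t)

end Data

def ML : ℕ := 16777215
def MR : ℕ := 18446744073692774400

/-- The words of a block with the high planes of their certificates. -/
def certs (rows : List (ℕ × ℕ)) : List (ℕ × List ℕ) → List (ℕ × List (ℕ × ℕ))
  | [] => []
  | (m, cs) :: ws => ((enc (rows.map Prod.fst) m), cs.map (comb rows)) :: certs rows ws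

/-- Each word has weight 8, certificates are disjoint from it, and one of them is odd. -/
def chkCerts : List (ℕ × List (ℕ × ℕ)) → Bool
  | [] => true
  | (a, cs) :: ws => Nat.beq (pc 64 a) 8 && (cs.all (fun c => Nat.beq (Nat.land a c.1) 0) &&
      (cs.any (fun c => Nat.beq (par (Nat.land a c.2)) 1) && chkCerts ws))

def oddAny (w : ℕ) : List (ℕ × ℕ) → Bool
  | [] => false
  | c :: cs => bif Nat.beq (par (Nat.land w c.2)) 1 then true else oddAny w cs

/-- Plane of the left words `a` such that `a + b` meets one of the given certificates oddly. -/
def oddMask (rows : List ℕ) (b : ℕ) : List ℕ → ℕ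
  | [] => 0
  | d :: ds => Nat.lor (bif Nat.beq (par (Nat.land b d)) 1 then
      Nat.xor (parPl rows d) (ones rows.length) else parPl rows d) (oddMask rows b ds)

def chkRow (L : List (ℕ × ℕ)) (b mask : ℕ) : List (ℕ × List ℕ) → Bool
  | [] => true
  | (m, cs) :: ws => bif (bif Nat.testBit mask m then true else
        oddAny (Nat.xor (enc (L.map Prod.fst) m) b) (cs.map (comb L)))
      then chkRow L b mask ws else false

/-- For each right word `b`, every left word is dealt with by a certificate of either side. -/
def chkPairs (L : List (ℕ × ℕ)) (W : List (ℕ × List ℕ)) (wm : ℕ) : List (ℕ × List (ℕ × ℕ)) → Bool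
  | [] => true
  | (b, ds) :: vs => bif
      (bif Nat.beq (Nat.land wm (oddMask (L.map Prod.fst) b (ds.map Prod.snd))) wm then true
        else chkRow L b (oddMask (L.map Prod.fst) b (ds.map Prod.snd)) W)
      then chkPairs L W wm vs else false

def chkK (rows : List (ℕ × ℕ)) : List (ℕ × ℕ) → Bool
  | [] => true
  | (m, c) :: ws => Nat.beq (pc 64 (enc (rows.map Prod.fst) m)) 16 &&
      (Nat.beq (Nat.land (enc (rows.map Prod.fst) m) (comb rows c).1) 0 &&
      (Nat.beq (par (Nat.land (enc (rows.map Prod.fst) m) (comb rows c).2)) 1 && chkK rows ws))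



/-! ### Bit counting -/

/-- Number of ones among the lowest 64 bits. -/
def S (n : ℕ) : ℕ := ∑ i : Fin 64, (n.testBit i).toNat

theorem pc_eq (k n : ℕ) : pc k n = ∑ i ∈ range k, (n.testBit i).toNat := by
  induction k generalizing n with
  | zero => simp [pc]
  | succ k ih =>
    rw [pc, ih, Finset.sum_range_succ']
    simp only [Nat.testBit_succ, Nat.testBit_zero]
    rcases Nat.mod_two_eq_zero_or_one n with h | h <;> simp [h, add_comm]

theorem pc_S (n : ℕ) : pc 64 n = S n := by
  rw [pc_eq, S, Fin.sum_univ_eq_sum_range (fun i => (n.testBit i).toNat)]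

theorem pc_double (k n : ℕ) : pc (k + k) n % 2 = pc k (n ^^^ (n >>> k)) % 2 := by
  simp only [pc_eq, Finset.sum_range_add, ← Finset.sum_add_distrib]
  rw [Finset.sum_nat_mod, Finset.sum_nat_mod (range k) 2 (fun i => ((n ^^^ (n >>> k)).testBit i).toNat)]
  congr 1
  apply Finset.sum_congr rfl
  intro i _
  rw [Nat.testBit_xor, Nat.testBit_shiftRight]
  cases n.testBit i <;> cases n.testBit (k + i) <;> rfl

theorem xor_def' (a b : ℕ) : Nat.xor a b = a ^^^ b := rfl
theorem and_def' (a b : ℕ) : Nat.land a b = a &&& b := rfl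
theorem or_def' (a b : ℕ) : Nat.lor a b = a ||| b := rfl
theorem shr_def' (a b : ℕ) : Nat.shiftRight a b = a >>> b := rfl
theorem shl_def' (a b : ℕ) : Nat.shiftLeft a b = a <<< b := rfl

theorem par_eq (n : ℕ) : par n = S n % 2 := by
  rw [← pc_S]
  have h1 := fun n => pc_double 32 n
  have h2 := fun n => pc_double 16 n
  have h3 := fun n => pc_double 8 n
  have h4 := fun n => pc_double 4 n
  have h5 := fun n => pc_double 2 n
  have h6 := fun n => pc_double 1 n
  have h7 : ∀ n, pc 1 n = n % 2 := fun n => by rw [pc, pc, add_zero]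
  norm_num only at h1 h2 h3 h4 h5 h6
  rw [h1, h2, h3, h4, h5, h6, h7, Nat.mod_mod]
  simp only [par, xor_def', shr_def']

theorem S_xor_mod (a b : ℕ) : S (a ^^^ b) % 2 = (S a + S b) % 2 := by
  simp only [S, ← Finset.sum_add_distrib]
  rw [Finset.sum_nat_mod, Finset.sum_nat_mod univ 2 (fun i : Fin 64 => (a.testBit i).toNat + (b.testBit i).toNat)]
  refine congrArg (fun t => t % 2) ?_
  apply Finset.sum_congr rfl
  intro i _
  rw [Nat.testBit_xor]
  cases a.testBit i <;> cases b.testBit i <;> rfl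

theorem S_xor_disj (a b : ℕ) (h : a &&& b = 0) : S (a ^^^ b) = S a + S b := by
  simp only [S, ← Finset.sum_add_distrib]
  apply Finset.sum_congr rfl
  intro i _
  have := congrArg (fun n => n.testBit i) h
  simp only [Nat.testBit_and, Nat.zero_testBit] at this
  rw [Nat.testBit_xor]
  revert this
  cases a.testBit i <;> cases b.testBit i <;> simp

theorem S_mono_bit (a b : ℕ) (h : ∀ i : Fin 64, a.testBit i = true → b.testBit i = true) :
    S a ≤ S b := by
  apply Finset.sum_le_sum
  intro i _
  have := h i
  revert this
  cases a.testBit i <;> cases b.testBit i <;> simp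

@[simp] theorem S_zero : S 0 = 0 := by simp [S]

/-! ### Vectors -/

def vec (p : ℕ × ℕ) : Fin 64 → ZMod 4 := fun i =>
  (bif p.1.testBit i then 1 else 0) + (bif p.2.testBit i then 2 else 0)

theorem vec_addv (x y : ℕ × ℕ) : vec (addv x y) = vec x + vec y := by
  funext i
  have h1 : (addv x y).1 = x.1 ^^^ y.1 := rfl
  have h2 : (addv x y).2 = (x.2 ^^^ y.2) ^^^ (x.1 &&& y.1) := rfl
  simp only [vec, Pi.add_apply, h1, h2, Nat.testBit_xor, Nat.testBit_and]
  cases x.1.testBit i <;> cases x.2.testBit i <;> cases y.1.testBit i <;> cases y.2.testBit i <;>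
    decide

theorem vec_zero : vec (0, 0) = 0 := by
  funext i; simp [vec]

theorem vec_two_xor (a b : ℕ) : vec (0, a ^^^ b) = vec (0, a) + vec (0, b) := by
  rw [← vec_addv]
  congr 1
  simp [addv]

theorem vec_two (x : ℕ × ℕ) : vec (0, x.1) = vec x + vec x := by
  funext i
  simp only [vec, Pi.add_apply, Nat.zero_testBit]
  cases x.1.testBit i <;> cases x.2.testBit i <;> decide

theorem vec_inner (x y : ℕ × ℕ) : z4Inner (vec x) (vec y) =
    ((S (x.1 &&& y.1) + 2 * (S (x.1 &&& y.2) + S (x.2 &&& y.1)) : ℕ) : ZMod 4) := by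
  simp only [z4Inner, S, ← Finset.sum_add_distrib, Finset.mul_sum]
  rw [Nat.cast_sum]
  apply Finset.sum_congr rfl
  intro i _
  simp only [vec, Nat.testBit_and]
  cases x.1.testBit i <;> cases x.2.testBit i <;> cases y.1.testBit i <;> cases y.2.testBit i <;>
    decide

/-- Number of coordinates equal to 2. -/
def twos (x : ℕ × ℕ) : ℕ := ∑ i : Fin 64, (x.2.testBit i && !x.1.testBit i).toNat

theorem vec_wt (x : ℕ × ℕ) : euclWt (vec x) = S x.1 + 4 * twos x := by
  simp only [euclWt, S, twos, ← Finset.sum_add_distrib, Finset.mul_sum]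
  apply Finset.sum_congr rfl
  intro i _
  have key : ∀ a b : Bool, (if ((bif a then 1 else 0) + (bif b then 2 else 0) : ZMod 4) = 0 then 0
      else if ((bif a then 1 else 0) + (bif b then 2 else 0) : ZMod 4) = 2 then 4 else 1 : ℕ) =
      a.toNat + 4 * (b && !a).toNat := by decide
  exact key (x.1.testBit i) (x.2.testBit i)

theorem twos_eq (x : ℕ × ℕ) : twos x = S (x.2 ^^^ (x.2 &&& x.1)) := by
  simp only [S, twos]
  apply Finset.sum_congr rfl
  intro i _
  simp only [Nat.testBit_xor, Nat.testBit_and]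
  cases x.1.testBit i <;> cases x.2.testBit i <;> decide

/-- Coordinates of `hi` in a mask disjoint from `lo` count as twos. -/
theorem S_le_twos (x : ℕ × ℕ) (c : ℕ) (h : x.1 &&& c = 0) : S (x.2 &&& c) ≤ twos x := by
  rw [twos_eq]
  apply S_mono_bit
  intro i
  have := congrArg (fun n => n.testBit i) h
  simp only [Nat.testBit_and, Nat.zero_testBit] at this
  simp only [Nat.testBit_xor, Nat.testBit_and]
  revert this
  cases x.1.testBit i <;> cases x.2.testBit i <;> cases c.testBit i <;> simp

theorem wt_add (x y : Fin 64 → ZMod 4) (hxy : z4Inner x y = 0) (hx : 8 ∣ euclWt x)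
    (hy : 8 ∣ euclWt y) : 8 ∣ euclWt (x + y) := by
  have key : ∀ a b : ZMod 4, (((if a + b = 0 then 0 else if a + b = 2 then 4 else 1 : ℕ)) : ZMod 8)
      = ((if a = 0 then 0 else if a = 2 then 4 else 1 : ℕ) : ZMod 8)
        + ((if b = 0 then 0 else if b = 2 then 4 else 1 : ℕ) : ZMod 8)
        + ((2 * (a.val * b.val) : ℕ) : ZMod 8) := by decide
  have h1 : ((∑ i, (x i).val * (y i).val : ℕ) : ZMod 4) = 0 := by
    rw [← hxy, z4Inner, Nat.cast_sum]
    apply Finset.sum_congr rfl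
    intro i _
    simp
  have h2 : (euclWt (x + y) : ZMod 8) = euclWt x + euclWt y +
      ((2 * ∑ i, (x i).val * (y i).val : ℕ) : ZMod 8) := by
    simp only [euclWt, Finset.mul_sum]
    rw [Nat.cast_sum, Nat.cast_sum, Nat.cast_sum, Nat.cast_sum, ← Finset.sum_add_distrib,
      ← Finset.sum_add_distrib]
    apply Finset.sum_congr rfl
    intro i _
    exact key (x i) (y i)
  rw [ZMod.natCast_eq_zero_iff] at h1
  have h3 : 8 ∣ 2 * ∑ i, (x i).val * (y i).val := by omega
  rw [← ZMod.natCast_eq_zero_iff] at hx hy h3 ⊢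
  rw [h2, hx, hy, h3]; simp



/-! ### Encodings -/

theorem enc_congr (l : List ℕ) (m n : ℕ) (h : ∀ i < l.length, m.testBit i = n.testBit i) :
    enc l m = enc l n := by
  induction l with
  | nil => rfl
  | cons g gs ih =>
    have h1 := ih (fun i hi => h i (by simp; omega))
    have h2 := h gs.length (by simp)
    simp only [enc, h1, h2]

theorem enc_mod (l : List ℕ) (m : ℕ) : enc l (m % 2 ^ l.length) = enc l m := by
  apply enc_congr
  intro i hi
  simp [Nat.testBit_mod_two_pow, hi]

theorem enc_zero (l : List ℕ) : enc l 0 = 0 := by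
  induction l with
  | nil => rfl
  | cons g gs ih => simp [enc, ih]

theorem enc_xor (l : List ℕ) (m n : ℕ) : enc l (m ^^^ n) = enc l m ^^^ enc l n := by
  induction l with
  | nil => simp [enc]
  | cons g gs ih =>
    simp only [enc, Nat.testBit_xor, ih, xor_def']
    apply Nat.eq_of_testBit_eq
    intro i
    cases m.testBit gs.length <;> cases n.testBit gs.length <;> simp <;>
    cases g.testBit i <;> cases (enc gs m).testBit i <;> cases (enc gs n).testBit i <;> rfl

theorem enc_append (A B : List ℕ) (m : ℕ) :
    enc (A ++ B) m = enc A (m >>> B.length) ^^^ enc B m := by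
  induction A with
  | nil => simp [enc]
  | cons g gs ih =>
    simp only [List.cons_append, enc, ih, xor_def', List.length_append, Nat.testBit_shiftRight,
      Nat.add_comm B.length]
    cases m.testBit (gs.length + B.length) <;> simp [Nat.xor_assoc]

theorem enc_map (f : ℕ → ℕ) (h0 : f 0 = 0) (hf : ∀ a b, f (a ^^^ b) = f a ^^^ f b) (l : List ℕ)
    (m : ℕ) : enc (l.map f) m = f (enc l m) := by
  induction l with
  | nil => simp [enc, h0]
  | cons g gs ih =>
    simp only [List.map_cons, enc, ih, xor_def', List.length_map]
    cases m.testBit gs.length <;> simp [hf]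

theorem enc_mem (l : List ℕ) (P : ℕ → Prop) (h0 : P 0) (hx : ∀ a b, P a → P b → P (a ^^^ b))
    (hl : ∀ g ∈ l, P g) (m : ℕ) : P (enc l m) := by
  induction l with
  | nil => exact h0
  | cons g gs ih =>
    have h1 := ih (fun g hg => hl g (by simp [hg]))
    simp only [enc, xor_def']
    cases m.testBit gs.length
    · exact h1
    · exact hx _ _ (hl g (by simp)) h1

theorem enc_land (l : List ℕ) (M : ℕ) (hl : ∀ g ∈ l, g &&& M = g) (m : ℕ) :
    enc l m &&& M = enc l m := by
  apply enc_mem l (fun a => a &&& M = a)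
  · simp
  · intro a b ha hb
    rw [Nat.and_xor_distrib_right, ha, hb]
  · exact hl

theorem comb_congr (l : List (ℕ × ℕ)) (m n : ℕ) (h : ∀ i < l.length, m.testBit i = n.testBit i) :
    comb l m = comb l n := by
  induction l with
  | nil => rfl
  | cons g gs ih =>
    have h1 := ih (fun i hi => h i (by simp; omega))
    have h2 := h gs.length (by simp)
    simp only [comb, h1, h2]

theorem comb_zero (l : List (ℕ × ℕ)) : comb l 0 = (0, 0) := by
  induction l with
  | nil => rfl
  | cons g gs ih => simp [comb, ih]

theorem comb_fst (l : List (ℕ × ℕ)) (m : ℕ) : (comb l m).1 = enc (l.map Prod.fst) m := by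
  induction l with
  | nil => rfl
  | cons g gs ih =>
    simp only [comb, List.map_cons, enc, List.length_map, ← ih]
    cases m.testBit gs.length <;> rfl

theorem comb_self (l : List (ℕ × ℕ)) (g : ℕ × ℕ) (hg : g ∈ l) :
    ∃ m < 2 ^ l.length, comb l m = g := by
  induction l with
  | nil => simp at hg
  | cons a gs ih =>
    rcases List.mem_cons.1 hg with h | h
    · refine ⟨2 ^ gs.length, by simp [pow_succ], ?_⟩
      have h1 : comb gs (2 ^ gs.length) = comb gs 0 := by
        apply comb_congr
        intro i hi
        simp [Nat.testBit_two_pow]; omega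
      simp [comb, h1, comb_zero, h, addv]
    · obtain ⟨m, hm, h1⟩ := ih h
      refine ⟨m, by simp [pow_succ]; omega, ?_⟩
      simp [comb, h1, Nat.testBit_lt_two_pow hm]

theorem enc_self (l : List ℕ) (g : ℕ) (hg : g ∈ l) : ∃ m < 2 ^ l.length, enc l m = g := by
  obtain ⟨m, hm, h⟩ := comb_self (l.map (fun a => (a, 0))) (g, 0) (by simp [hg])
  refine ⟨m, by simpa using hm, ?_⟩
  have := comb_fst (l.map (fun a => (a, 0))) m
  rw [h] at this
  simp [Function.comp_def] at this
  exact this.symm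

theorem vec_comb_add (l : List (ℕ × ℕ)) (m n : ℕ) : vec (comb l m) + vec (comb l n) =
    vec (comb l (m ^^^ n)) + vec (0, enc (l.map Prod.fst) (m &&& n)) := by
  induction l with
  | nil => simp [comb, enc, vec_zero]
  | cons g gs ih =>
    simp only [comb, enc, List.map_cons, List.length_map, Nat.testBit_xor, Nat.testBit_and, xor_def']
    cases m.testBit gs.length <;> cases n.testBit gs.length <;>
      simp only [cond_true, cond_false, Bool.xor_false, Bool.xor_true, Bool.not_true,
        Bool.not_false, Bool.and_true, Bool.and_false, vec_addv, vec_two_xor, vec_two]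
    · exact ih
    · rw [add_left_comm, ih, add_assoc]
    · rw [add_assoc, ih, add_assoc]
    · rw [add_add_add_comm, ih]; abel

/-! ### Bit-sliced evaluation -/

theorem testBit_ones (k m : ℕ) : (ones k).testBit m = decide (m < 2 ^ k) := by
  rw [ones, Nat.testBit_two_pow_sub_one]

theorem plane_testBit (rows : List ℕ) (j m : ℕ) :
    (plane rows j).testBit m = (decide (m < 2 ^ rows.length) && (enc rows m).testBit j) := by
  induction rows generalizing m with
  | nil => simp [plane, enc]
  | cons g gs ih =>
    simp only [plane, or_def', shl_def', xor_def', Nat.testBit_or, Nat.testBit_shiftLeft, enc,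
      List.length_cons]
    by_cases h1 : m < 2 ^ gs.length
    · have h2 : ¬ (m ≥ 2 ^ gs.length) := by omega
      have h3 : m < 2 ^ (gs.length + 1) := by rw [pow_succ]; omega
      simp [ih, h1, h2, h3, Nat.testBit_lt_two_pow h1]
    · have h2 : m ≥ 2 ^ gs.length := by omega
      by_cases h3 : m < 2 ^ (gs.length + 1)
      · have h4 : m - 2 ^ gs.length < 2 ^ gs.length := by rw [pow_succ] at h3; omega
        have h5 : m.testBit gs.length = true := by
          obtain ⟨d, hd⟩ := Nat.exists_eq_add_of_le h2
          rw [hd, Nat.testBit_two_pow_add_eq, Nat.testBit_lt_two_pow (by omega)]; rfl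
        have h6 : enc gs (m - 2 ^ gs.length) = enc gs m := by
          apply enc_congr
          intro i hi
          obtain ⟨d, hd⟩ := Nat.exists_eq_add_of_le h2
          rw [hd, Nat.add_sub_cancel_left, Nat.testBit_two_pow_add_gt hi]
        cases hg : g.testBit j <;>
          simp [ih, h1, h2, h3, h4, h5, h6, hg, testBit_ones]
      · have h4 : ¬ m - 2 ^ gs.length < 2 ^ gs.length := by rw [pow_succ] at h3; omega
        cases hg : g.testBit j <;>
          simp [ih, h1, h2, h3, h4, testBit_ones]

/-- Value of a bit-sliced counter at position `m`. -/
def val : List ℕ → ℕ → ℕ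
  | [], _ => 0
  | c :: cs, m => (c.testBit m).toNat + 2 * val cs m

theorem val_addBit (cs : List ℕ) (p m : ℕ) :
    val (addBit cs p) m = val cs m + (p.testBit m).toNat := by
  induction cs generalizing p with
  | nil =>
    simp only [addBit]
    cases h : Nat.beq p 0
    · simp [val]
    · have : p = 0 := Nat.eq_of_beq_eq_true h
      simp [val, this]
  | cons c cs ih =>
    simp only [addBit, val, ih, xor_def', and_def', Nat.testBit_xor, Nat.testBit_and]
    cases c.testBit m <;> cases p.testBit m <;> simp <;> omega

theorem val_cnt (rows : List ℕ) (m k : ℕ) :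
    val (cnt rows k) m = ∑ j ∈ range k, ((plane rows j).testBit m).toNat := by
  induction k with
  | zero => simp [cnt, val]
  | succ k ih => rw [cnt, val_addBit, ih, Finset.sum_range_succ]

theorem val_cnt_S (rows : List ℕ) (m : ℕ) (hm : m < 2 ^ rows.length) :
    val (cnt rows 64) m = S (enc rows m) := by
  rw [val_cnt, ← pc_S, pc_eq]
  apply Finset.sum_congr rfl
  intro j _
  rw [plane_testBit]; simp [hm]

theorem ge_testBit (full : ℕ) (cs : List ℕ) (t m : ℕ) (h : (ge full cs t).testBit m = true) :
    t ≤ val cs m := by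
  induction cs generalizing t with
  | nil =>
    simp only [ge] at h
    cases h1 : Nat.beq t 0
    · simp [h1] at h
    · have : t = 0 := Nat.eq_of_beq_eq_true h1
      omega
  | cons c cs ih =>
    simp only [ge] at h
    simp only [val]
    cases h1 : Nat.beq (t % 2) 0
    · simp only [h1, cond_false, or_def', and_def', Nat.testBit_or, Nat.testBit_and,
        Bool.or_eq_true, Bool.and_eq_true] at h
      rcases h with h | ⟨h, h2⟩
      · have := ih _ h; omega
      · have := ih _ h
        simp only [h2, Bool.toNat_true]; omega
    · have h2 : t % 2 = 0 := Nat.eq_of_beq_eq_true h1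
      simp only [h1, cond_true] at h
      have := ih _ h; omega

theorem listMask_testBit (W : List ℕ) (m : ℕ) : (listMask W).testBit m = true ↔ m ∈ W := by
  induction W with
  | nil => simp [listMask]
  | cons a W ih =>
    simp only [listMask, or_def', shl_def', Nat.testBit_or, Bool.or_eq_true, ih, List.mem_cons,
      Nat.one_shiftLeft, Nat.testBit_two_pow, decide_eq_true_eq]
    rw [eq_comm]

theorem par_xor (a b : ℕ) : par (a ^^^ b) = par a ^^^ par b := by
  rw [par_eq, par_eq, par_eq, S_xor_mod, Nat.add_mod]
  rcases Nat.mod_two_eq_zero_or_one (S a) with h | h <;>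
  rcases Nat.mod_two_eq_zero_or_one (S b) with h' | h' <;> simp [h, h']

theorem parPl_testBit (rows : List ℕ) (x m : ℕ) : (parPl rows x).testBit m =
    (decide (m < 2 ^ rows.length) && decide (S (enc rows m &&& x) % 2 = 1)) := by
  rw [parPl, plane_testBit, enc_map (fun g => par (Nat.land g x)), List.length_map]
  · rw [and_def', par_eq, Nat.testBit_zero, Nat.mod_mod]
  · rw [and_def', par_eq, Nat.zero_and, S_zero]
  · intro a b
    simp only [and_def', Nat.and_xor_distrib_right, par_xor]

theorem orNZ_testBit (rows O : List ℕ) (m : ℕ) (h : (orNZ rows O).testBit m = true) :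
    ∃ x ∈ O, S (enc rows m &&& x) % 2 = 1 := by
  induction O with
  | nil => simp [orNZ] at h
  | cons a O ih =>
    simp only [orNZ, or_def', Nat.testBit_or, Bool.or_eq_true, parPl_testBit, Bool.and_eq_true,
      decide_eq_true_eq] at h
    rcases h with h | h
    · exact ⟨a, by simp, h.2⟩
    · obtain ⟨x, hx, h⟩ := ih h
      exact ⟨x, by simp [hx], h⟩

theorem testBit_one_eq (m : ℕ) (h : (1 : ℕ).testBit m = true) : m = 0 := by
  by_contra hm
  rw [Nat.testBit_lt_two_pow (Nat.one_lt_two_pow hm)] at h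
  simp at h

theorem chkMin_spec (rows : List ℕ) (h : chkMin rows = true) (m : ℕ) (hm : m < 2 ^ rows.length) :
    m = 0 ∨ 6 ≤ S (enc rows m) := by
  have h1 := Nat.eq_of_beq_eq_true h
  have h2 := congrArg (fun n => n.testBit m) h1
  simp only [or_def', Nat.testBit_or, testBit_ones, hm, decide_true, Bool.or_eq_true] at h2
  rcases h2 with h2 | h2
  · exact Or.inl (testBit_one_eq m h2)
  · right
    rw [← val_cnt_S rows m hm]
    exact ge_testBit _ _ _ _ h2

theorem chkEight_spec (rows W : List ℕ) (h : chkEight rows W = true) (m : ℕ)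
    (hm : m < 2 ^ rows.length) : m = 0 ∨ m ∈ W ∨ 9 ≤ S (enc rows m) := by
  have h1 := Nat.eq_of_beq_eq_true h
  have h2 := congrArg (fun n => n.testBit m) h1
  simp only [or_def', Nat.testBit_or, testBit_ones, hm, decide_true, Bool.or_eq_true,
    listMask_testBit] at h2
  rcases h2 with h2 | h2 | h2
  · exact Or.inl (testBit_one_eq m h2)
  · exact Or.inr (Or.inl h2)
  · right; right
    rw [← val_cnt_S rows m hm]
    exact ge_testBit _ _ _ _ h2

theorem chkSixteen_spec (rows O K : List ℕ) (h : chkSixteen rows O K = true) (m : ℕ)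
    (hm : m < 2 ^ rows.length) : m = 0 ∨ m ∈ K ∨ (∃ x ∈ O, S (enc rows m &&& x) % 2 = 1) ∨
      17 ≤ S (enc rows m) := by
  have h1 := Nat.eq_of_beq_eq_true h
  have h2 := congrArg (fun n => n.testBit m) h1
  simp only [or_def', Nat.testBit_or, testBit_ones, hm, decide_true, Bool.or_eq_true,
    listMask_testBit] at h2
  rcases h2 with h2 | h2 | h2 | h2
  · exact Or.inl (testBit_one_eq m h2)
  · exact Or.inr (Or.inl h2)
  · exact Or.inr (Or.inr (Or.inl (orNZ_testBit _ _ _ h2)))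
  · right; right; right
    rw [← val_cnt_S rows m hm]
    exact ge_testBit _ _ _ _ h2

/-! ### Certificates -/

theorem oddAny_spec (w : ℕ) (cs : List (ℕ × ℕ)) (h : oddAny w cs = true) :
    ∃ c ∈ cs, S (w &&& c.2) % 2 = 1 := by
  induction cs with
  | nil => simp [oddAny] at h
  | cons c cs ih =>
    simp only [oddAny] at h
    cases h1 : Nat.beq (par (Nat.land w c.2)) 1
    · simp only [h1, cond_false] at h
      obtain ⟨x, hx, h⟩ := ih h
      exact ⟨x, by simp [hx], h⟩
    · have h2 := Nat.eq_of_beq_eq_true h1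
      rw [par_eq] at h2
      exact ⟨c, by simp, h2⟩

theorem certs_mem (rows : List (ℕ × ℕ)) (W : List (ℕ × List ℕ)) (w : ℕ × List ℕ) (hw : w ∈ W) :
    (enc (rows.map Prod.fst) w.1, w.2.map (comb rows)) ∈ certs rows W := by
  induction W with
  | nil => simp at hw
  | cons a W ih =>
    rcases List.mem_cons.1 hw with h | h
    · subst h; simp [certs]
    · simp [certs, ih h]

theorem chkCerts_spec (V : List (ℕ × List (ℕ × ℕ))) (h : chkCerts V = true)
    (v : ℕ × List (ℕ × ℕ)) (hv : v ∈ V) : S v.1 = 8 ∧ (∀ c ∈ v.2, v.1 &&& c.1 = 0) ∧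
      ∃ c ∈ v.2, S (v.1 &&& c.2) % 2 = 1 := by
  induction V with
  | nil => simp at hv
  | cons a V ih =>
    obtain ⟨a, cs⟩ := a
    simp only [chkCerts, Bool.and_eq_true] at h
    obtain ⟨h1, h2, h3, h4⟩ := h
    rcases List.mem_cons.1 hv with h | h
    · subst h
      refine ⟨?_, ?_, ?_⟩
      · rw [← pc_S]; exact Nat.eq_of_beq_eq_true h1
      · intro c hc
        exact Nat.eq_of_beq_eq_true (List.all_eq_true.1 h2 c hc)
      · obtain ⟨c, hc, h⟩ := List.any_eq_true.1 h3
        refine ⟨c, hc, ?_⟩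
        have := Nat.eq_of_beq_eq_true h
        rwa [par_eq] at this
    · exact ih h4 h

theorem oddMask_spec (rows : List ℕ) (b : ℕ) (ds : List ℕ) (m : ℕ)
    (h : (oddMask rows b ds).testBit m = true) :
    ∃ d ∈ ds, S ((enc rows m ^^^ b) &&& d) % 2 = 1 := by
  induction ds with
  | nil => simp [oddMask] at h
  | cons d ds ih =>
    simp only [oddMask, or_def', xor_def', Nat.testBit_or, Bool.or_eq_true] at h
    rcases h with h | h
    · refine ⟨d, by simp, ?_⟩
      rw [Nat.and_xor_distrib_right, S_xor_mod]
      cases h1 : Nat.beq (par (Nat.land b d)) 1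
      · have h2 : S (b &&& d) % 2 ≠ 1 := by
          have := Nat.ne_of_beq_eq_false h1
          rwa [par_eq] at this
        simp only [h1, cond_false, parPl_testBit, Bool.and_eq_true, decide_eq_true_eq] at h
        omega
      · have h2 := Nat.eq_of_beq_eq_true h1
        rw [par_eq, and_def'] at h2
        simp only [h1, cond_true, Nat.testBit_xor, parPl_testBit, testBit_ones] at h
        by_cases h3 : m < 2 ^ rows.length
        · simp only [h3, decide_true, Bool.true_and, Bool.xor_true, Bool.not_eq_true',
            decide_eq_false_iff_not] at h
          omega
        · simp [h3] at h
    · obtain ⟨x, hx, h⟩ := ih h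
      exact ⟨x, by simp [hx], h⟩

theorem chkRow_spec (L : List (ℕ × ℕ)) (b mask : ℕ) (W : List (ℕ × List ℕ))
    (h : chkRow L b mask W = true) (w : ℕ × List ℕ) (hw : w ∈ W) : mask.testBit w.1 = true ∨
      ∃ c ∈ w.2.map (comb L), S ((enc (L.map Prod.fst) w.1 ^^^ b) &&& c.2) % 2 = 1 := by
  induction W with
  | nil => simp at hw
  | cons a W ih =>
    obtain ⟨m, cs⟩ := a
    simp only [chkRow, Bool.cond_false_right, Bool.and_eq_true, Bool.cond_true_left,
      Bool.or_eq_true] at h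
    rcases List.mem_cons.1 hw with h1 | h1
    · subst h1
      rcases h.1 with h2 | h2
      · exact Or.inl h2
      · exact Or.inr (oddAny_spec _ _ h2)
    · exact ih h.2 h1

theorem chkPairs_spec (L : List (ℕ × ℕ)) (W : List (ℕ × List ℕ)) (V : List (ℕ × List (ℕ × ℕ)))
    (h : chkPairs L W (listMask (W.map Prod.fst)) V = true) (v : ℕ × List (ℕ × ℕ)) (hv : v ∈ V)
    (w : ℕ × List ℕ) (hw : w ∈ W) :
    (∃ c ∈ v.2, S ((enc (L.map Prod.fst) w.1 ^^^ v.1) &&& c.2) % 2 = 1) ∨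
      ∃ c ∈ w.2.map (comb L), S ((enc (L.map Prod.fst) w.1 ^^^ v.1) &&& c.2) % 2 = 1 := by
  induction V with
  | nil => simp at hv
  | cons a V ih =>
    obtain ⟨b, ds⟩ := a
    simp only [chkPairs, Bool.cond_false_right, Bool.and_eq_true, Bool.cond_true_left,
      Bool.or_eq_true] at h
    rcases List.mem_cons.1 hv with h1 | h1
    · subst h1
      have key : (oddMask (L.map Prod.fst) b (ds.map Prod.snd)).testBit w.1 = true ∨
          ∃ c ∈ w.2.map (comb L), S ((enc (L.map Prod.fst) w.1 ^^^ b) &&& c.2) % 2 = 1 := by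
        rcases h.1 with h2 | h2
        · left
          have h3 := congrArg (fun n => n.testBit w.1) (Nat.eq_of_beq_eq_true h2)
          have h4 : (listMask (W.map Prod.fst)).testBit w.1 = true :=
            (listMask_testBit _ _).2 (List.mem_map_of_mem hw)
          simpa [and_def', Nat.testBit_and, h4] using h3
        · exact chkRow_spec _ _ _ _ h2 w hw
      rcases key with h2 | h2
      · left
        obtain ⟨d, hd, h3⟩ := oddMask_spec _ _ _ _ h2
        obtain ⟨c, hc, rfl⟩ := List.mem_map.1 hd
        exact ⟨c, hc, h3⟩
      · exact Or.inr h2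
    · exact ih h.2 h1

theorem chkK_spec (rows : List (ℕ × ℕ)) (K : List (ℕ × ℕ)) (h : chkK rows K = true) (k : ℕ × ℕ)
    (hk : k ∈ K) : S (enc (rows.map Prod.fst) k.1) = 16 ∧
      enc (rows.map Prod.fst) k.1 &&& (comb rows k.2).1 = 0 ∧
      S (enc (rows.map Prod.fst) k.1 &&& (comb rows k.2).2) % 2 = 1 := by
  induction K with
  | nil => simp at hk
  | cons a K ih =>
    obtain ⟨m, c⟩ := a
    simp only [chkK, Bool.and_eq_true] at h
    obtain ⟨h1, h2, h3, h4⟩ := h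
    rcases List.mem_cons.1 hk with h | h
    · subst h
      refine ⟨?_, Nat.eq_of_beq_eq_true h2, ?_⟩
      · rw [← pc_S]; exact Nat.eq_of_beq_eq_true h1
      · have := Nat.eq_of_beq_eq_true h3
        rwa [par_eq] at this
    · exact ih h4 h



/-! ### The code attached to the data -/

/-- Information positions of the generator rows. -/
def ppos (i : ℕ) : ℕ := bif Nat.blt i 12 then 23 - i else 75 - i

/-- The complementary positions. -/
def rpos (i : ℕ) : ℕ := bif Nat.blt i 12 then i else i + 12

def maskR : ℕ := 8796076249087
def maskP : ℕ := 18446708889354235904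
def maskPQ : ℕ := 18446735277633302528
def maskRQ : ℕ := 35184355315711

def Data.row (D : Data) (i : ℕ) : ℕ × ℕ := D.G.getD i (0, 0)
def Data.dl (D : Data) (i : ℕ) : ℕ × ℕ := D.F.getD i (0, 0)

def Data.gens (D : Data) : List (ℕ × ℕ) := D.G ++ D.H.map (fun h => (0, h))

def chkOrth (l : List (ℕ × ℕ)) : Bool :=
  l.all fun x => l.all fun y => Nat.beq ((pc 64 (Nat.land x.1 y.1) +
    2 * (par (Nat.land x.1 y.2) + par (Nat.land x.2 y.1))) % 4) 0

def chkWt (l : List (ℕ × ℕ)) : Bool :=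
  l.all fun x => Nat.beq ((pc 64 x.1 + 4 * pc 64 (Nat.xor x.2 (Nat.land x.2 x.1))) % 8) 0

def chkMask (l : List ℕ) (M : ℕ) : Bool := l.all fun x => Nat.beq (Nat.land x M) x

def chkRows (D : Data) : Bool := (List.range 31).all fun i =>
  Nat.beq (Nat.land (D.row i).1 maskP) (2 ^ ppos i) && Nat.beq (Nat.land (D.row i).2 maskP) 0

def chkDuals (D : Data) : Bool := (List.range 31).all fun i =>
  Nat.beq (Nat.land (D.cw (D.dl i).1 (D.dl i).2).1 maskR) (2 ^ rpos i) &&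
  Nat.beq (Nat.land (D.cw (D.dl i).1 (D.dl i).2).2 maskR) 0

def chkMid (D : Data) : Bool := (List.range 2).all fun k =>
  Nat.beq (Nat.land (enc D.T (D.S.getD k 0)) maskRQ) (2 ^ (43 + k)) &&
  Nat.beq (Nat.land (D.H.getD k 0) maskPQ) (2 ^ (43 + k))

def chkLen (D : Data) : Bool :=
  Nat.beq D.L.length 12 && (Nat.beq D.R.length 19 && Nat.beq D.H.length 2)

def chkOnes (D : Data) : Bool :=
  Nat.beq (D.cw 2146959360 0).1 ML && Nat.beq (D.cw 2146959360 0).2 0 &&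
  (Nat.beq (D.cw 524287 0).1 MR && Nat.beq (D.cw 524287 0).2 0)

/-- Strictly increasing list, all entries above `p`. -/
def chkInc : ℕ → List ℕ → Bool
  | _, [] => true
  | p, x :: xs => Nat.blt p x && chkInc x xs

def Data.V1 (D : Data) : List ℕ := D.W1.map (fun w => enc D.LL w.1)
def Data.V2 (D : Data) : List ℕ := D.W2.map (fun w => enc D.RR w.1)

/-- All the finite checks. -/
structure Valid (D : Data) : Prop where
  len : chkLen D = true
  orth : chkOrth D.gens = true
  wt : chkWt D.gens = true
  maskL : chkMask D.LL ML = true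
  maskT : chkMask D.T2 MR = true
  rows : chkRows D = true
  duals : chkDuals D = true
  mid : chkMid D = true
  allOnes : chkOnes D = true
  minL : chkMin D.LL = true
  minT : chkMin D.T2 = true
  eightL : chkEight D.LL (D.W1.map Prod.fst) = true
  eightR : chkEight D.RR (D.W2.map Prod.fst) = true
  sixteenL : chkSixteen D.LL (D.R.map Prod.snd) [] = true
  sixteenR : chkSixteen D.RR (D.L.map Prod.snd) (D.K.map Prod.fst) = true
  certL : chkCerts (certs D.L D.W1) = true
  certR : chkCerts (certs D.R D.W2) = true
  kern : chkK D.R D.K = true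
  pairs : chkPairs D.L D.W1 (listMask (D.W1.map Prod.fst)) (certs D.R D.W2) = true
  six : Nat.beq (pc 64 (enc D.T D.x6)) 6 = true
  inc : chkInc 0 (D.V1 ++ D.V2) = true

/-- The code generated by the rows. -/
def code (D : Data) : Submodule (ZMod 4) (Fin 64 → ZMod 4) :=
  Submodule.span (ZMod 4) {v | ∃ g ∈ D.gens, v = vec g}

theorem inner_dot (x y : Fin 64 → ZMod 4) : z4Inner x y = dotProduct x y := rfl

theorem inner_comm (x y : Fin 64 → ZMod 4) : z4Inner x y = z4Inner y x := by
  rw [inner_dot, inner_dot, dotProduct_comm]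

section
variable {D : Data}

theorem gen_mem {g : ℕ × ℕ} (hg : g ∈ D.gens) : vec g ∈ code D :=
  Submodule.subset_span ⟨g, hg, rfl⟩

theorem comb_mem_code (l : List (ℕ × ℕ)) (hl : ∀ g ∈ l, vec g ∈ code D) (m : ℕ) :
    vec (comb l m) ∈ code D := by
  induction l with
  | nil => simp [comb, vec_zero]
  | cons g gs ih =>
    have h1 := ih (fun g hg => hl g (by simp [hg]))
    simp only [comb]
    cases m.testBit gs.length
    · exact h1
    · rw [cond_true, vec_addv]
      exact add_mem (hl g (by simp)) h1

theorem L_mem {g : ℕ × ℕ} (hg : g ∈ D.L) : vec g ∈ code D := gen_mem (by simp [Data.gens, Data.G, hg])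
theorem R_mem {g : ℕ × ℕ} (hg : g ∈ D.R) : vec g ∈ code D := gen_mem (by simp [Data.gens, Data.G, hg])
theorem G_mem {g : ℕ × ℕ} (hg : g ∈ D.G) : vec g ∈ code D := gen_mem (by simp [Data.gens, hg])
theorem H_mem {h : ℕ} (hg : h ∈ D.H) : vec (0, h) ∈ code D := gen_mem (by simp [Data.gens, hg])

theorem T_mem (t : ℕ) : vec (0, enc D.T t) ∈ code D := by
  apply enc_mem D.T (fun a => vec (0, a) ∈ code D)
  · rw [vec_zero]; exact zero_mem _
  · intro a b ha hb
    rw [vec_two_xor]; exact add_mem ha hb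
  · intro g hg
    simp only [Data.T, Data.T2, Data.LL, Data.RR, List.mem_append, List.mem_map] at hg
    rcases hg with ⟨x, hx, rfl⟩ | ⟨x, hx, rfl⟩ | hg
    · rw [vec_two]; exact add_mem (L_mem hx) (L_mem hx)
    · rw [vec_two]; exact add_mem (R_mem hx) (R_mem hx)
    · exact H_mem hg

theorem cw_mem (m t : ℕ) : vec (D.cw m t) ∈ code D := by
  rw [Data.cw, vec_addv]
  exact add_mem (comb_mem_code _ (fun g hg => G_mem hg) m) (T_mem t)

theorem lens (hV : Valid D) : D.L.length = 12 ∧ D.R.length = 19 ∧ D.H.length = 2 := by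
  have := hV.len
  simp only [chkLen, Bool.and_eq_true] at this
  exact ⟨Nat.eq_of_beq_eq_true this.1, Nat.eq_of_beq_eq_true this.2.1,
    Nat.eq_of_beq_eq_true this.2.2⟩

theorem encG_T (hV : Valid D) (u : ℕ) : enc (D.G.map Prod.fst) u = enc D.T (u <<< 2) := by
  have h1 : D.T = D.G.map Prod.fst ++ D.H := by
    simp [Data.T, Data.T2, Data.LL, Data.RR, Data.G]
  rw [h1, enc_append, (lens hV).2.2]
  have h2 : enc D.H (u <<< 2) = enc D.H 0 := by
    apply enc_congr
    intro i hi
    rw [(lens hV).2.2] at hi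
    rw [Nat.testBit_shiftLeft]
    simp; omega
  rw [h2, enc_zero, Nat.xor_zero]
  apply enc_congr
  intro i hi
  rw [Nat.testBit_shiftRight, Nat.testBit_shiftLeft]
  simp

theorem cw_add (hV : Valid D) (m t m' t' : ℕ) : ∃ m'' t'', vec (D.cw m t) + vec (D.cw m' t') =
    vec (D.cw m'' t'') := by
  refine ⟨m ^^^ m', ((m &&& m') <<< 2) ^^^ (t ^^^ t'), ?_⟩
  simp only [Data.cw, vec_addv, enc_xor, vec_two_xor]
  rw [add_add_add_comm, vec_comb_add, encG_T hV, add_assoc]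

theorem mem_code (hV : Valid D) {z : Fin 64 → ZMod 4} (hz : z ∈ code D) :
    ∃ m t, z = vec (D.cw m t) := by
  have hzero : (0 : Fin 64 → ZMod 4) = vec (D.cw 0 0) := by
    rw [Data.cw, vec_addv, comb_zero, enc_zero, vec_zero, add_zero]
  have hadd : ∀ x y : Fin 64 → ZMod 4, (∃ m t, x = vec (D.cw m t)) → (∃ m t, y = vec (D.cw m t)) →
      ∃ m t, x + y = vec (D.cw m t) := by
    rintro x y ⟨m, t, rfl⟩ ⟨m', t', rfl⟩
    exact cw_add hV _ _ _ _
  refine Submodule.span_induction (p := fun z _ => ∃ m t, z = vec (D.cw m t)) ?_ ?_ ?_ ?_ hz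
  · rintro x ⟨g, hg, rfl⟩
    simp only [Data.gens, List.mem_append, List.mem_map] at hg
    rcases hg with hg | ⟨h, hh, rfl⟩
    · obtain ⟨m, -, hm⟩ := comb_self D.G g hg
      refine ⟨m, 0, ?_⟩
      rw [Data.cw, vec_addv, hm, enc_zero, vec_zero, add_zero]
    · obtain ⟨t, -, ht⟩ := enc_self D.T h (by simp [Data.T, Data.T2, hh])
      refine ⟨0, t, ?_⟩
      rw [Data.cw, vec_addv, comb_zero, ht, vec_zero, zero_add]
  · exact ⟨0, 0, hzero⟩
  · intro x y _ _ hx hy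
    exact hadd x y hx hy
  · intro r x _ hx
    have : ∀ r : ZMod 4, r = 0 ∨ r = 1 ∨ r = 1 + 1 ∨ r = 1 + 1 + 1 := by decide
    rcases this r with rfl | rfl | rfl | rfl
    · rw [zero_smul]; exact ⟨0, 0, hzero⟩
    · rwa [one_smul]
    · rw [add_smul, one_smul]; exact hadd _ _ hx hx
    · rw [add_smul, add_smul, one_smul]; exact hadd _ _ (hadd _ _ hx hx) hx

/-! ### Self-orthogonality and weights -/

theorem gens_orth (hV : Valid D) {x y : ℕ × ℕ} (hx : x ∈ D.gens) (hy : y ∈ D.gens) :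
    z4Inner (vec x) (vec y) = 0 := by
  have h1 := Nat.eq_of_beq_eq_true (List.all_eq_true.1 (List.all_eq_true.1 hV.orth x hx) y hy)
  rw [pc_S, par_eq, par_eq] at h1
  simp only [and_def'] at h1
  rw [vec_inner, ZMod.natCast_eq_zero_iff]
  omega

theorem code_orth (hV : Valid D) {x y : Fin 64 → ZMod 4} (hx : x ∈ code D) (hy : y ∈ code D) :
    z4Inner x y = 0 := by
  refine Submodule.span_induction (p := fun z _ => z4Inner z y = 0) ?_ ?_ ?_ ?_ hx
  · rintro _ ⟨g, hg, rfl⟩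
    refine Submodule.span_induction (p := fun z _ => z4Inner (vec g) z = 0) ?_ ?_ ?_ ?_ hy
    · rintro _ ⟨g', hg', rfl⟩
      exact gens_orth hV hg hg'
    · simp [inner_dot]
    · intro a b _ _ ha hb
      rw [inner_dot] at *
      rw [dotProduct_add, ha, hb, add_zero]
    · intro r a _ ha
      rw [inner_dot] at *
      rw [dotProduct_smul, ha, smul_zero]
  · simp [inner_dot]
  · intro a b _ _ ha hb
    rw [inner_dot] at *
    rw [add_dotProduct, ha, hb, add_zero]
  · intro r a _ ha
    rw [inner_dot] at *
    rw [smul_dotProduct, ha, smul_zero]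

theorem smul_cases (r : ZMod 4) (x : Fin 64 → ZMod 4) :
    r • x = 0 ∨ r • x = x ∨ r • x = x + x ∨ r • x = x + x + x := by
  have : ∀ r : ZMod 4, r = 0 ∨ r = 1 ∨ r = 1 + 1 ∨ r = 1 + 1 + 1 := by decide
  rcases this r with rfl | rfl | rfl | rfl
  · left; rw [zero_smul]
  · right; left; rw [one_smul]
  · right; right; left; rw [add_smul, one_smul]
  · right; right; right; rw [add_smul, add_smul, one_smul]

theorem code_wt (hV : Valid D) {x : Fin 64 → ZMod 4} (hx : x ∈ code D) : 8 ∣ euclWt x := by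
  have hz : euclWt (0 : Fin 64 → ZMod 4) = 0 := by simp [euclWt]
  refine Submodule.span_induction (p := fun z _ => 8 ∣ euclWt z) ?_ ?_ ?_ ?_ hx
  · rintro _ ⟨g, hg, rfl⟩
    have h1 := Nat.eq_of_beq_eq_true (List.all_eq_true.1 hV.wt g hg)
    rw [pc_S, pc_S, xor_def', and_def', ← twos_eq, ← vec_wt] at h1
    exact Nat.dvd_of_mod_eq_zero h1
  · rw [hz]; exact dvd_zero _
  · intro a b ha hb h1 h2
    exact wt_add a b (code_orth hV ha hb) h1 h2
  · intro r x hx h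
    have h2 : 8 ∣ euclWt (x + x) := wt_add x x (code_orth hV hx hx) h h
    have h3 : 8 ∣ euclWt (x + x + x) := wt_add (x + x) x (code_orth hV (add_mem hx hx) hx) h2 h
    generalize hy : r • x = y
    rcases smul_cases r x with h' | h' | h' | h' <;> rw [hy] at h' <;> subst h'
    · rw [hz]; exact dvd_zero _
    · exact h
    · exact h2
    · exact h3

/-! ### Self-duality -/

theorem vec_mask1 (x : ℕ × ℕ) (M k : ℕ) (n : Fin 64) (h1 : x.1 &&& M = 2 ^ k) (h2 : x.2 &&& M = 0)
    (hn : M.testBit n = true) : vec x n = if (n : ℕ) = k then 1 else 0 := by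
  have h3 := congrArg (fun a => a.testBit n) h1
  have h4 := congrArg (fun a => a.testBit n) h2
  simp only [Nat.testBit_and, hn, Bool.and_true, Nat.testBit_two_pow, Nat.zero_testBit] at h3 h4
  simp only [vec, h3, h4]
  by_cases h : (n : ℕ) = k
  · simp [h]
  · simp [h, Ne.symm h]

theorem vec_mask2 (e : ℕ) (M k : ℕ) (n : Fin 64) (h1 : e &&& M = 2 ^ k)
    (hn : M.testBit n = true) : vec (0, e) n = if (n : ℕ) = k then 2 else 0 := by
  have h3 := congrArg (fun a => a.testBit n) h1
  simp only [Nat.testBit_and, hn, Bool.and_true, Nat.testBit_two_pow] at h3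
  simp only [vec, h3]
  by_cases h : (n : ℕ) = k
  · simp [h]
  · simp [h, Ne.symm h]

theorem inner_pick (y w : Fin 64 → ZMod 4) (r : Fin 64) (h : ∀ n, n ≠ r → y n * w n = 0) :
    z4Inner y w = y r * w r := by
  rw [z4Inner]
  exact Finset.sum_eq_single r (fun n _ hn => h n hn) (by simp)

theorem ppos_lt : ∀ i : Fin 31, ppos i < 64 := by decide +kernel
theorem rpos_lt : ∀ i : Fin 31, rpos i < 64 := by decide +kernel
def pp (i : Fin 31) : Fin 64 := ⟨ppos i, ppos_lt i⟩
def rp (i : Fin 31) : Fin 64 := ⟨rpos i, rpos_lt i⟩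

theorem maskP_pp : ∀ i, maskP.testBit (pp i) = true := by decide +kernel
theorem maskP_cover : ∀ n : Fin 64, maskP.testBit n = true → ∃ i, n = pp i := by decide +kernel
theorem maskR_cover : ∀ n : Fin 64, maskR.testBit n = true → ∃ i, n = rp i := by decide +kernel
theorem pp_inj : ∀ i j : Fin 31, ppos i = ppos j → i = j := by decide +kernel
theorem mask_cases : ∀ n : Fin 64, maskP.testBit n = true ∨ maskR.testBit n = true ∨
    (n : ℕ) = 43 ∨ (n : ℕ) = 44 := by decide +kernel
theorem mask_cases' : ∀ n : Fin 64, maskP.testBit n = true ∨ maskRQ.testBit n = true := by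
  decide +kernel
theorem maskP_PQ : ∀ n : Fin 64, maskP.testBit n = true →
    maskPQ.testBit n = true ∧ (n : ℕ) ≠ 43 ∧ (n : ℕ) ≠ 44 := by decide +kernel
theorem maskPQ_43 : maskPQ.testBit 43 = true := by decide +kernel
theorem maskPQ_44 : maskPQ.testBit 44 = true := by decide +kernel

theorem row_spec (hV : Valid D) (i : Fin 31) (n : Fin 64) (hn : maskP.testBit n = true) :
    vec (D.row i) n = if (n : ℕ) = ppos i then 1 else 0 := by
  have h := List.all_eq_true.1 hV.rows i (List.mem_range.2 i.2)
  rw [Bool.and_eq_true] at h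
  exact vec_mask1 _ _ _ n (Nat.eq_of_beq_eq_true h.1) (Nat.eq_of_beq_eq_true h.2) hn

theorem row_mem (hV : Valid D) (i : Fin 31) : D.row i ∈ D.G := by
  have h := lens hV
  have h1 : (i : ℕ) < D.G.length := by simp [Data.G, h]
  rw [Data.row, List.getD_eq_getElem _ _ h1]
  exact List.getElem_mem h1

theorem dual_spec (hV : Valid D) (i : Fin 31) (n : Fin 64) (hn : maskR.testBit n = true) :
    vec (D.cw (D.dl i).1 (D.dl i).2) n = if (n : ℕ) = rpos i then 1 else 0 := by
  have h := List.all_eq_true.1 hV.duals i (List.mem_range.2 i.2)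
  rw [Bool.and_eq_true] at h
  exact vec_mask1 _ _ _ n (Nat.eq_of_beq_eq_true h.1) (Nat.eq_of_beq_eq_true h.2) hn

theorem mid_spec (hV : Valid D) (k : ℕ) (hk : k < 2) (n : Fin 64) (hn : maskRQ.testBit n = true) :
    vec (0, enc D.T (D.S.getD k 0)) n = if (n : ℕ) = 43 + k then 2 else 0 := by
  have h := List.all_eq_true.1 hV.mid k (List.mem_range.2 hk)
  rw [Bool.and_eq_true] at h
  exact vec_mask2 _ _ _ n (Nat.eq_of_beq_eq_true h.1) hn

theorem H_spec (hV : Valid D) (k : ℕ) (hk : k < 2) (n : Fin 64) (hn : maskPQ.testBit n = true) :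
    vec (0, D.H.getD k 0) n = if (n : ℕ) = 43 + k then 2 else 0 := by
  have h := List.all_eq_true.1 hV.mid k (List.mem_range.2 hk)
  rw [Bool.and_eq_true] at h
  exact vec_mask2 _ _ _ n (Nat.eq_of_beq_eq_true h.2) hn

theorem H_mem' (hV : Valid D) (k : ℕ) (hk : k < 2) : vec (0, D.H.getD k 0) ∈ code D := by
  have h1 : k < D.H.length := by rw [(lens hV).2.2]; exact hk
  rw [List.getD_eq_getElem _ _ h1]
  exact H_mem (List.getElem_mem h1)

theorem dual_le (hV : Valid D) {x : Fin 64 → ZMod 4} (hx : ∀ c ∈ code D, z4Inner x c = 0) :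
    x ∈ code D := by
  set u : Fin 64 → ZMod 4 := ∑ i : Fin 31, x (pp i) • vec (D.row i) with hu
  have hum : u ∈ code D :=
    Submodule.sum_mem _ (fun i _ => Submodule.smul_mem _ _ (G_mem (row_mem hV i)))
  set y := x - u with hy
  have hyP : ∀ n : Fin 64, maskP.testBit n = true → y n = 0 := by
    intro n hn
    obtain ⟨j, rfl⟩ := maskP_cover n hn
    have h1 : u (pp j) = x (pp j) := by
      rw [hu, Finset.sum_apply, Finset.sum_eq_single j]
      · rw [Pi.smul_apply, row_spec hV j _ hn]
        simp [pp]
      · intro i _ hij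
        rw [Pi.smul_apply, row_spec hV i _ hn, if_neg, smul_zero]
        intro h
        exact hij (pp_inj _ _ h).symm
      · simp
    rw [hy, Pi.sub_apply, h1, sub_self]
  have hyC : ∀ c ∈ code D, z4Inner y c = 0 := by
    intro c hc
    rw [hy, inner_dot, sub_dotProduct, ← inner_dot, ← inner_dot, hx c hc, code_orth hV hum hc,
      sub_zero]
  have hmid : ∀ (k : ℕ) (hk : k < 2), ∃ κ : ZMod 4, y ⟨43 + k, by omega⟩ = κ * 2 := by
    intro k hk
    have h1 := hyC _ (T_mem (D.S.getD k 0))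
    rw [inner_pick y _ ⟨43 + k, by omega⟩] at h1
    · have h2 : maskRQ.testBit (43 + k) = true := by
        have : k = 0 ∨ k = 1 := by omega
        rcases this with rfl | rfl <;> decide +kernel
      rw [mid_spec hV k hk _ h2] at h1
      simp only [if_true] at h1
      have h3 : ∀ a : ZMod 4, a * 2 = 0 → ∃ κ : ZMod 4, a = κ * 2 := by decide
      exact h3 _ h1
    · intro n hn
      rcases mask_cases' n with h2 | h2
      · rw [hyP n h2, zero_mul]
      · rw [mid_spec hV k hk _ h2, if_neg, mul_zero]
        intro h; exact hn (Fin.ext h)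
  obtain ⟨κ0, h0⟩ := hmid 0 (by omega)
  obtain ⟨κ1, h1⟩ := hmid 1 (by omega)
  set w : Fin 64 → ZMod 4 := κ0 • vec (0, D.H.getD 0 0) + κ1 • vec (0, D.H.getD 1 0) with hw
  have hwm : w ∈ code D := add_mem (Submodule.smul_mem _ _ (H_mem' hV 0 (by omega)))
    (Submodule.smul_mem _ _ (H_mem' hV 1 (by omega)))
  set v := y - w with hv
  have hvC : ∀ c ∈ code D, z4Inner v c = 0 := by
    intro c hc
    rw [hv, inner_dot, sub_dotProduct, ← inner_dot, ← inner_dot, hyC c hc, code_orth hV hwm hc,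
      sub_zero]
  have hvP : ∀ n : Fin 64, maskP.testBit n = true → v n = 0 := by
    intro n hn
    obtain ⟨h2, h3, h4⟩ := maskP_PQ n hn
    rw [hv, hw]
    simp only [Pi.sub_apply, Pi.add_apply, Pi.smul_apply, H_spec hV 0 (by omega) n h2,
      H_spec hV 1 (by omega) n h2, hyP n hn]
    simp [h3, h4]
  have hv43 : v 43 = 0 := by
    rw [hv, hw]
    simp only [Pi.sub_apply, Pi.add_apply, Pi.smul_apply, H_spec hV 0 (by omega) 43 maskPQ_43,
      H_spec hV 1 (by omega) 43 maskPQ_43]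
    rw [show y 43 = κ0 * 2 from h0]
    simp
  have hv44 : v 44 = 0 := by
    rw [hv, hw]
    simp only [Pi.sub_apply, Pi.add_apply, Pi.smul_apply, H_spec hV 0 (by omega) 44 maskPQ_44,
      H_spec hV 1 (by omega) 44 maskPQ_44]
    rw [show y 44 = κ1 * 2 from h1]
    simp
  have hv0 : v = 0 := by
    have hc : ∀ n : Fin 64, maskR.testBit n = true ∨ v n = 0 := by
      intro n
      rcases mask_cases n with h | h | h | h
      · exact Or.inr (hvP n h)
      · exact Or.inl h
      · right; rw [show n = 43 from Fin.ext h, hv43]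
      · right; rw [show n = 44 from Fin.ext h, hv44]
    funext n
    rcases hc n with h | h
    · obtain ⟨j, rfl⟩ := maskR_cover n h
      have h2 := hvC _ (cw_mem (D.dl j).1 (D.dl j).2)
      rw [inner_pick v _ (rp j)] at h2
      · rw [dual_spec hV j _ h] at h2
        simpa [rp] using h2
      · intro n hn
        rcases hc n with h3 | h3
        · rw [dual_spec hV j _ h3, if_neg, mul_zero]
          intro h4; exact hn (Fin.ext h4)
        · rw [h3, zero_mul]
    · exact h
  have : x = w + u := by
    have h1 : x = v + w + u := by rw [hv, hy]; abel
    rw [h1, hv0, zero_add]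
  rw [this]
  exact add_mem hwm hum

end


/-! ### The minimum weight -/

section
variable {D : Data}

theorem core (hV : Valid D) {z c : ℕ × ℕ} (hz : vec z ∈ code D) (hc : vec c ∈ code D)
    (h : z.1 &&& c.1 = 0) : (S (z.1 &&& c.2) + S (z.2 &&& c.1)) % 2 = 0 := by
  have h1 := code_orth hV hz hc
  rw [vec_inner, h, S_zero, ZMod.natCast_eq_zero_iff] at h1
  omega

/-- Weight bound for words whose residue lives on a single block. -/
theorem block_bound (hV : Valid D) {z : ℕ × ℕ} (hz : vec z ∈ code D) (MB : ℕ)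
    (hMB : vec (MB, 0) ∈ code D) (ha : z.1 &&& MB = 0)
    (h8 : 9 ≤ S z.1 ∨ (S z.1 = 8 ∧ ∃ c : ℕ × ℕ, vec c ∈ code D ∧ c.1 &&& MB = 0 ∧
      z.1 &&& c.1 = 0 ∧ S (z.1 &&& c.2) % 2 = 1))
    (h16 : 17 ≤ S z.1 ∨ (S z.1 = 16 ∧ ∃ c : ℕ × ℕ, vec c ∈ code D ∧
      z.1 &&& c.1 = 0 ∧ S (z.1 &&& c.2) % 2 = 1) ∨ ∃ c : ℕ × ℕ, vec c ∈ code D ∧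
      c.1 &&& MB = c.1 ∧ S (z.1 &&& c.2) % 2 = 1) : 16 < S z.1 + 4 * twos z := by
  rcases h16 with h | ⟨h, c, hc, h1, h2⟩ | ⟨c, hc, h1, h2⟩
  · omega
  · have h3 := core hV hz hc h1
    have h4 := S_le_twos z c.1 h1
    omega
  · have h0 : z.1 &&& c.1 = 0 := by
      rw [← h1, Nat.and_comm c.1, ← Nat.and_assoc, ha, Nat.zero_and]
    have h3 := core hV hz hc h0
    have h4 := core hV hz hMB ha
    simp only [Nat.and_zero, S_zero, zero_add] at h4
    have h5 : S (z.2 &&& c.1) ≤ S (z.2 &&& MB) := by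
      apply S_mono_bit
      intro i
      rw [← h1]
      simp only [Nat.testBit_and, Bool.and_eq_true]
      rintro ⟨hh1, -, hh2⟩
      exact ⟨hh1, hh2⟩
    have h6 := S_le_twos z MB ha
    rcases h8 with h | ⟨h, d, hd, h7, h8, h9⟩
    · omega
    · have h10 := core hV hz hd h8
      have h11 : z.1 &&& (d.1 ^^^ MB) = 0 := by
        rw [Nat.and_xor_distrib_left, h8, ha, Nat.xor_zero]
      have h12 := S_le_twos z (d.1 ^^^ MB) h11
      rw [Nat.and_xor_distrib_left, S_xor_disj] at h12
      · omega
      · rw [Nat.and_assoc, Nat.and_left_comm d.1, h7, Nat.and_zero, Nat.and_zero]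

theorem two_bound (hV : Valid D) {z c : ℕ × ℕ} (hz : vec z ∈ code D) (hc : vec c ∈ code D)
    (h : z.1 &&& c.1 = 0) (h2 : S (z.1 &&& c.2) % 2 = 1) (h3 : 16 ≤ S z.1) :
    16 < S z.1 + 4 * twos z := by
  have h4 := core hV hz hc h
  have h5 := S_le_twos z c.1 h
  omega

theorem maskL_spec (hV : Valid D) : ∀ g ∈ D.LL, g &&& ML = g := fun g hg =>
  Nat.eq_of_beq_eq_true (List.all_eq_true.1 hV.maskL g hg)
theorem maskT_spec (hV : Valid D) : ∀ g ∈ D.T2, g &&& MR = g := fun g hg =>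
  Nat.eq_of_beq_eq_true (List.all_eq_true.1 hV.maskT g hg)
theorem maskR_spec (hV : Valid D) : ∀ g ∈ D.RR, g &&& MR = g := fun g hg =>
  maskT_spec hV g (by simp [Data.T2, hg])

theorem encL_mask (hV : Valid D) (m : ℕ) : enc D.LL m &&& ML = enc D.LL m :=
  enc_land _ _ (maskL_spec hV) m
theorem encR_mask (hV : Valid D) (m : ℕ) : enc D.RR m &&& MR = enc D.RR m :=
  enc_land _ _ (maskR_spec hV) m
theorem encT_mask (hV : Valid D) (m : ℕ) : enc D.T2 m &&& MR = enc D.T2 m :=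
  enc_land _ _ (maskT_spec hV) m

theorem ML_MR : ML &&& MR = 0 := by decide +kernel

theorem disj_LR {a b : ℕ} (ha : a &&& ML = a) (hb : b &&& MR = b) : a &&& b = 0 := by
  rw [← ha, ← hb, Nat.and_assoc, Nat.and_left_comm ML, ML_MR, Nat.and_zero, Nat.and_zero]

theorem disj_RL {a b : ℕ} (ha : a &&& ML = a) (hb : b &&& MR = b) : b &&& a = 0 := by
  rw [Nat.and_comm, disj_LR ha hb]

theorem vec_ones (hV : Valid D) : vec (ML, 0) ∈ code D ∧ vec (MR, 0) ∈ code D := by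
  have h := hV.allOnes
  simp only [chkOnes, Bool.and_eq_true] at h
  obtain ⟨⟨h1, h2⟩, h3, h4⟩ := h
  have e1 : D.cw 2146959360 0 = (ML, 0) :=
    Prod.ext (Nat.eq_of_beq_eq_true h1) (Nat.eq_of_beq_eq_true h2)
  have e2 : D.cw 524287 0 = (MR, 0) :=
    Prod.ext (Nat.eq_of_beq_eq_true h3) (Nat.eq_of_beq_eq_true h4)
  rw [← e1, ← e2]
  exact ⟨cw_mem _ _, cw_mem _ _⟩

theorem lenLL (hV : Valid D) : D.LL.length = 12 := by simp [Data.LL, (lens hV).1]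
theorem lenRR (hV : Valid D) : D.RR.length = 19 := by simp [Data.RR, (lens hV).2.1]
theorem lenT2 (hV : Valid D) : D.T2.length = 21 := by
  simp [Data.T2, lenRR hV, (lens hV).2.2]

theorem cw_fst (hV : Valid D) (m t : ℕ) :
    (D.cw m t).1 = enc D.LL (m >>> 19) ^^^ enc D.RR m := by
  have h1 : (D.cw m t).1 = (comb D.G m).1 ^^^ 0 := rfl
  rw [h1, comb_fst, Nat.xor_zero, Data.G, List.map_append, enc_append]
  have := lenRR hV
  rw [Data.RR] at this
  rw [this]; rfl

theorem combL_mem (m : ℕ) : vec (comb D.L m) ∈ code D := comb_mem_code _ (fun _ h => L_mem h) m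
theorem combR_mem (m : ℕ) : vec (comb D.R m) ∈ code D := comb_mem_code _ (fun _ h => R_mem h) m

theorem combL_mask (hV : Valid D) (m : ℕ) : (comb D.L m).1 &&& ML = (comb D.L m).1 := by
  rw [comb_fst]; exact encL_mask hV m
theorem combR_mask (hV : Valid D) (m : ℕ) : (comb D.R m).1 &&& MR = (comb D.R m).1 := by
  rw [comb_fst]; exact encR_mask hV m

theorem MLself : ML &&& ML = ML := Nat.and_self _
theorem MRself : MR &&& MR = MR := Nat.and_self _

/-- Left words of weight at most eight. -/
theorem eightL (hV : Valid D) (m : ℕ) (hm : m < 2 ^ 12) : m = 0 ∨ (∃ w ∈ D.W1, w.1 = m ∧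
    S (enc D.LL m) = 8) ∨ 9 ≤ S (enc D.LL m) := by
  rcases chkEight_spec _ _ hV.eightL m (by rwa [lenLL hV]) with h | h | h
  · exact Or.inl h
  · right; left
    obtain ⟨w, hw, rfl⟩ := List.mem_map.1 h
    exact ⟨w, hw, rfl, (chkCerts_spec _ hV.certL _ (certs_mem _ _ w hw)).1⟩
  · exact Or.inr (Or.inr h)

theorem eightR (hV : Valid D) (m : ℕ) (hm : m < 2 ^ 19) : m = 0 ∨ (∃ w ∈ D.W2, w.1 = m ∧
    S (enc D.RR m) = 8) ∨ 9 ≤ S (enc D.RR m) := by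
  rcases chkEight_spec _ _ hV.eightR m (by rwa [lenRR hV]) with h | h | h
  · exact Or.inl h
  · right; left
    obtain ⟨w, hw, rfl⟩ := List.mem_map.1 h
    exact ⟨w, hw, rfl, (chkCerts_spec _ hV.certR _ (certs_mem _ _ w hw)).1⟩
  · exact Or.inr (Or.inr h)

theorem certL_spec (hV : Valid D) (w : ℕ × List ℕ) (hw : w ∈ D.W1) :
    (∀ c ∈ w.2.map (comb D.L), vec c ∈ code D ∧ c.1 &&& ML = c.1 ∧ enc D.LL w.1 &&& c.1 = 0) ∧
    ∃ c ∈ w.2.map (comb D.L), S (enc D.LL w.1 &&& c.2) % 2 = 1 := by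
  have h := chkCerts_spec _ hV.certL _ (certs_mem _ _ w hw)
  refine ⟨?_, h.2.2⟩
  intro c hc
  refine ⟨?_, ?_, h.2.1 c hc⟩
  · obtain ⟨k, -, rfl⟩ := List.mem_map.1 hc
    exact combL_mem k
  · obtain ⟨k, -, rfl⟩ := List.mem_map.1 hc
    exact combL_mask hV k

theorem certR_spec (hV : Valid D) (w : ℕ × List ℕ) (hw : w ∈ D.W2) :
    (∀ c ∈ w.2.map (comb D.R), vec c ∈ code D ∧ c.1 &&& MR = c.1 ∧ enc D.RR w.1 &&& c.1 = 0) ∧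
    ∃ c ∈ w.2.map (comb D.R), S (enc D.RR w.1 &&& c.2) % 2 = 1 := by
  have h := chkCerts_spec _ hV.certR _ (certs_mem _ _ w hw)
  refine ⟨?_, h.2.2⟩
  intro c hc
  refine ⟨?_, ?_, h.2.1 c hc⟩
  · obtain ⟨k, -, rfl⟩ := List.mem_map.1 hc
    exact combR_mem k
  · obtain ⟨k, -, rfl⟩ := List.mem_map.1 hc
    exact combR_mask hV k

theorem left_bound (hV : Valid D) {z : ℕ × ℕ} (hz : vec z ∈ code D) (m : ℕ) (hm : m < 2 ^ 12)
    (h0 : m ≠ 0) (h : z.1 = enc D.LL m) : 16 < S z.1 + 4 * twos z := by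
  apply block_bound hV hz MR (vec_ones hV).2
  · rw [h]; exact disj_LR (encL_mask hV m) MRself
  · rcases eightL hV m hm with h1 | ⟨w, hw, rfl, h1⟩ | h1
    · exact absurd h1 h0
    · right
      rw [h]
      refine ⟨h1, ?_⟩
      obtain ⟨h2, c, hc, h3⟩ := certL_spec hV w hw
      exact ⟨c, (h2 c hc).1, disj_LR (h2 c hc).2.1 MRself, (h2 c hc).2.2, h3⟩
    · left; rw [h]; exact h1
  · rcases chkSixteen_spec _ _ _ hV.sixteenL m (by rwa [lenLL hV]) with h1 | h1 | ⟨x, hx, h1⟩ | h1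
    · exact absurd h1 h0
    · simp at h1
    · right; right
      obtain ⟨c, hc, rfl⟩ := List.mem_map.1 hx
      refine ⟨c, R_mem hc, maskR_spec hV _ (List.mem_map_of_mem hc), ?_⟩
      rw [h]; exact h1
    · left; rw [h]; exact h1

theorem right_bound (hV : Valid D) {z : ℕ × ℕ} (hz : vec z ∈ code D) (m : ℕ) (hm : m < 2 ^ 19)
    (h0 : m ≠ 0) (h : z.1 = enc D.RR m) : 16 < S z.1 + 4 * twos z := by
  apply block_bound hV hz ML (vec_ones hV).1
  · rw [h]; exact disj_RL MLself (encR_mask hV m)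
  · rcases eightR hV m hm with h1 | ⟨w, hw, rfl, h1⟩ | h1
    · exact absurd h1 h0
    · right
      rw [h]
      refine ⟨h1, ?_⟩
      obtain ⟨h2, c, hc, h3⟩ := certR_spec hV w hw
      exact ⟨c, (h2 c hc).1, disj_RL MLself (h2 c hc).2.1, (h2 c hc).2.2, h3⟩
    · left; rw [h]; exact h1
  · rcases chkSixteen_spec _ _ _ hV.sixteenR m (by rwa [lenRR hV]) with h1 | h1 | ⟨x, hx, h1⟩ | h1
    · exact absurd h1 h0
    · right; left
      obtain ⟨k, hk, rfl⟩ := List.mem_map.1 h1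
      obtain ⟨h2, h3, h4⟩ := chkK_spec _ _ hV.kern k hk
      rw [h]
      exact ⟨h2, comb D.R k.2, combR_mem _, h3, h4⟩
    · right; right
      obtain ⟨c, hc, rfl⟩ := List.mem_map.1 hx
      refine ⟨c, L_mem hc, maskL_spec hV _ (List.mem_map_of_mem hc), ?_⟩
      rw [h]; exact h1
    · left; rw [h]; exact h1

theorem both_bound (hV : Valid D) {z : ℕ × ℕ} (hz : vec z ∈ code D) (m n : ℕ) (hm : m < 2 ^ 12)
    (hn : n < 2 ^ 19) (hm0 : m ≠ 0) (hn0 : n ≠ 0) (h : z.1 = enc D.LL m ^^^ enc D.RR n) :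
    16 < S z.1 + 4 * twos z := by
  have hS : S z.1 = S (enc D.LL m) + S (enc D.RR n) := by
    rw [h]; exact S_xor_disj _ _ (disj_LR (encL_mask hV m) (encR_mask hV n))
  rcases eightL hV m hm with h1 | ⟨v, hv, rfl, h1⟩ | h1
  · exact absurd h1 hm0
  · rcases eightR hV n hn with h2 | ⟨w, hw, rfl, h2⟩ | h2
    · exact absurd h2 hn0
    · have h16 : 16 ≤ S z.1 := by omega
      rcases chkPairs_spec _ _ _ hV.pairs _ (certs_mem _ _ w hw) v hv with ⟨c, hc, h3⟩ | ⟨c, hc, h3⟩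
      · have h4 := (certR_spec hV w hw).1 c hc
        refine two_bound hV hz h4.1 ?_ ?_ h16
        · rw [h, Nat.and_xor_distrib_right, h4.2.2, disj_LR (encL_mask hV _) h4.2.1, Nat.xor_zero]
        · rw [h]; exact h3
      · have h4 := (certL_spec hV v hv).1 c hc
        refine two_bound hV hz h4.1 ?_ ?_ h16
        · rw [h, Nat.and_xor_distrib_right, h4.2.2, disj_RL h4.2.1 (encR_mask hV _), Nat.xor_zero]
        · rw [h]; exact h3
    · omega
  · rcases eightR hV n hn with h2 | ⟨w, hw, rfl, h2⟩ | h2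
    · exact absurd h2 hn0
    · omega
    · omega

theorem split_msg (hV : Valid D) (m t : ℕ) : (D.cw m t).1 =
    enc D.LL ((m >>> 19) % 2 ^ 12) ^^^ enc D.RR (m % 2 ^ 19) := by
  rw [cw_fst hV]
  have h1 := enc_mod D.LL (m >>> 19)
  have h2 := enc_mod D.RR m
  rw [lenLL hV] at h1
  rw [lenRR hV] at h2
  rw [h1, h2]

theorem twos_zero (a : ℕ) : twos (0, a) = S a := by
  rw [twos_eq]; simp

theorem torsion_bound (hV : Valid D) (t : ℕ) (h : vec (0, enc D.T t) ≠ 0) :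
    24 ≤ euclWt (vec (0, enc D.T t)) := by
  have h1 : enc D.T t = enc D.LL ((t >>> 21) % 2 ^ 12) ^^^ enc D.T2 (t % 2 ^ 21) := by
    have h1 := enc_mod D.LL (t >>> 21)
    have h2 := enc_mod D.T2 t
    rw [lenLL hV] at h1
    rw [lenT2 hV] at h2
    rw [h1, h2, Data.T, enc_append, lenT2 hV]
  have h2 : S (enc D.T t) = S (enc D.LL ((t >>> 21) % 2 ^ 12)) + S (enc D.T2 (t % 2 ^ 21)) := by
    rw [h1]; exact S_xor_disj _ _ (disj_LR (encL_mask hV _) (encT_mask hV _))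
  rw [vec_wt, twos_zero, S_zero, zero_add]
  have h3 := chkMin_spec _ hV.minL ((t >>> 21) % 2 ^ 12)
    (by rw [lenLL hV]; exact Nat.mod_lt _ (by norm_num))
  have h4 := chkMin_spec _ hV.minT (t % 2 ^ 21)
    (by rw [lenT2 hV]; exact Nat.mod_lt _ (by norm_num))
  rcases h3 with h3 | h3
  · rcases h4 with h4 | h4
    · exfalso
      apply h
      rw [h1, h3, h4, enc_zero, enc_zero, Nat.xor_zero, vec_zero]
    · omega
  · omega

theorem comb_trivial (hV : Valid D) (m : ℕ) (h1 : (m >>> 19) % 2 ^ 12 = 0)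
    (h2 : m % 2 ^ 19 = 0) : comb D.G m = (0, 0) := by
  rw [← comb_zero D.G]
  apply comb_congr
  intro i hi
  have h3 : i < 31 := by
    have := lens hV
    simp only [Data.G, List.length_append] at hi
    omega
  by_cases h4 : i < 19
  · have := congrArg (fun n => n.testBit i) h2
    simp only [Nat.testBit_mod_two_pow, Nat.zero_testBit, h4, decide_true, Bool.true_and] at this
    rw [this, Nat.zero_testBit]
  · have := congrArg (fun n => n.testBit (i - 19)) h1
    simp only [Nat.testBit_mod_two_pow, Nat.testBit_shiftRight, Nat.zero_testBit] at this
    rw [show 19 + (i - 19) = i by omega] at this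
    have h5 : i - 19 < 12 := by omega
    simpa [h5] using this

theorem min_bound (hV : Valid D) {z : Fin 64 → ZMod 4} (hz : z ∈ code D) (h0 : z ≠ 0) :
    24 ≤ euclWt z := by
  have h8 := code_wt hV hz
  obtain ⟨m, t, rfl⟩ := mem_code hV hz
  have hs := split_msg hV m t
  have hm : (m >>> 19) % 2 ^ 12 < 2 ^ 12 := Nat.mod_lt _ (by norm_num)
  have hn : m % 2 ^ 19 < 2 ^ 19 := Nat.mod_lt _ (by norm_num)
  by_cases h1 : (m >>> 19) % 2 ^ 12 = 0
  · by_cases h2 : m % 2 ^ 19 = 0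
    · have h3 : vec (D.cw m t) = vec (0, enc D.T t) := by
        rw [Data.cw, vec_addv, comb_trivial hV m h1 h2, vec_zero, zero_add]
      rw [h3] at h0 ⊢
      exact torsion_bound hV t h0
    · rw [h1, enc_zero, Nat.zero_xor] at hs
      have := right_bound hV hz _ hn h2 hs
      rw [← vec_wt] at this
      omega
  · by_cases h2 : m % 2 ^ 19 = 0
    · rw [h2, enc_zero, Nat.xor_zero] at hs
      have := left_bound hV hz _ hm h1 hs
      rw [← vec_wt] at this
      omega
    · have := both_bound hV hz _ _ hm hn h1 h2 hs
      rw [← vec_wt] at this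
      omega

theorem code_extremal (hV : Valid D) :
    IsExtremalTypeIIZ4 64 (code D : Set (Fin 64 → ZMod 4)) := by
  refine ⟨⟨?_, ?_⟩, ?_⟩
  · apply Set.Subset.antisymm
    · intro x hx c hc
      exact code_orth hV hx hc
    · intro x hx
      exact dual_le hV hx
  · intro c hc
    exact code_wt hV hc
  · have h6 : euclWt (vec (0, enc D.T D.x6)) = 24 := by
      have := Nat.eq_of_beq_eq_true hV.six
      rw [pc_S] at this
      rw [vec_wt, twos_zero, this, S_zero]
    have hne : vec (0, enc D.T D.x6) ≠ 0 := by
      intro h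
      rw [h] at h6
      simp [euclWt] at h6
    have hmem : 24 ∈ euclWt '' ((code D : Set (Fin 64 → ZMod 4)) \ {0}) :=
      ⟨_, ⟨T_mem D.x6, hne⟩, h6⟩
    show _ = 24
    apply le_antisymm
    · exact Nat.sInf_le hmem
    · apply le_csInf ⟨24, hmem⟩
      rintro _ ⟨z, ⟨hz, h0⟩, rfl⟩
      exact min_bound hV hz h0

end


/-! ### Residue codes -/

/-- Reduction modulo two. -/
def red (c : Fin 64 → ZMod 4) : Fin 64 → ZMod 2 :=
  fun i => ZMod.castHom (by norm_num : (2 : ℕ) ∣ 4) (ZMod 2) (c i)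

def bv (a : ℕ) : Fin 64 → ZMod 2 := fun i => bif a.testBit i then 1 else 0

theorem red_vec (x : ℕ × ℕ) : red (vec x) = bv x.1 := by
  funext i
  simp only [red, vec, bv]
  cases x.1.testBit i <;> cases x.2.testBit i <;> decide

theorem bv_xor (a b : ℕ) : bv (a ^^^ b) = bv a + bv b := by
  funext i
  simp only [bv, Pi.add_apply, Nat.testBit_xor]
  cases a.testBit i <;> cases b.testBit i <;> decide

theorem bv_zero : bv 0 = 0 := by
  funext i; simp [bv]

theorem hWt_bv (a : ℕ) : hWt (bv a) = S a := by
  rw [hWt, Finset.card_filter, S]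
  apply Finset.sum_congr rfl
  intro i _
  have key : ∀ b : Bool, (if (bif b then 1 else 0 : ZMod 2) ≠ 0 then 1 else 0 : ℕ) = b.toNat := by
    decide
  exact key (a.testBit i)

theorem bv_inj {a b : ℕ} (ha : a < 2 ^ 64) (hb : b < 2 ^ 64) (h : bv a = bv b) : a = b := by
  apply Nat.eq_of_testBit_eq
  intro i
  by_cases hi : i < 64
  · have := congrFun h ⟨i, hi⟩
    simp only [bv] at this
    revert this
    cases a.testBit i <;> cases b.testBit i <;> simp
  · have h1 : 2 ^ 64 ≤ 2 ^ i := Nat.pow_le_pow_right (by norm_num) (by omega)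
    rw [Nat.testBit_lt_two_pow (by omega), Nat.testBit_lt_two_pow (by omega)]

section
variable {D : Data}

theorem mem_residue (hV : Valid D) (y : Fin 64 → ZMod 2) :
    y ∈ residueSet (code D : Set (Fin 64 → ZMod 4)) ↔ ∃ m t, y = bv (D.cw m t).1 := by
  constructor
  · rintro ⟨c, hc, rfl⟩
    obtain ⟨m, t, rfl⟩ := mem_code hV hc
    exact ⟨m, t, red_vec _⟩
  · rintro ⟨m, t, rfl⟩
    exact ⟨_, cw_mem m t, (red_vec _).symm⟩

theorem row_indep (hV : Valid D) :
    LinearIndependent (ZMod 2) (fun i : Fin 31 => bv (D.row i).1) := by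
  rw [Fintype.linearIndependent_iff]
  intro g hg j
  have h1 := congrFun hg (pp j)
  rw [Finset.sum_apply, Finset.sum_eq_single j] at h1
  · rw [Pi.smul_apply, ← red_vec] at h1
    simp only [red, row_spec hV j _ (maskP_pp j)] at h1
    simpa [pp] using h1
  · intro i _ hij
    rw [Pi.smul_apply, ← red_vec]
    simp only [red, row_spec hV i _ (maskP_pp j)]
    rw [if_neg, map_zero, smul_zero]
    intro h
    exact hij (pp_inj _ _ h).symm
  · simp

theorem residue_span (hV : Valid D) :
    Submodule.span (ZMod 2) (residueSet (code D : Set (Fin 64 → ZMod 4))) =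
      Submodule.span (ZMod 2) (Set.range (fun i : Fin 31 => bv (D.row i).1)) := by
  apply le_antisymm
  · rw [Submodule.span_le]
    intro y hy
    obtain ⟨m, t, rfl⟩ := (mem_residue hV y).1 hy
    have h1 : (D.cw m t).1 = enc (D.G.map Prod.fst) m := by
      rw [← comb_fst]
      exact Nat.xor_zero _
    rw [h1]
    apply enc_mem (D.G.map Prod.fst) (fun a => bv a ∈ Submodule.span (ZMod 2)
      (Set.range (fun i : Fin 31 => bv (D.row i).1)))
    · rw [bv_zero]; exact zero_mem _
    · intro a b ha hb
      rw [bv_xor]; exact add_mem ha hb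
    · intro g hg
      obtain ⟨x, hx, rfl⟩ := List.mem_map.1 hg
      obtain ⟨n, hn, rfl⟩ := List.mem_iff_getElem.1 hx
      apply Submodule.subset_span
      have h2 : n < 31 := by
        have := lens hV
        have h3 := hn
        simp only [Data.G, List.length_append] at h3
        omega
      refine ⟨⟨n, h2⟩, ?_⟩
      simp only [Data.row]
      rw [List.getD_eq_getElem _ _ hn]
  · rw [Submodule.span_le]
    rintro _ ⟨i, rfl⟩
    apply Submodule.subset_span
    exact ⟨_, G_mem (row_mem hV i), (red_vec _).symm⟩

theorem residue_finrank (hV : Valid D) : Module.finrank (ZMod 2)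
    (Submodule.span (ZMod 2) (residueSet (code D : Set (Fin 64 → ZMod 4)))) = 31 := by
  rw [residue_span hV, finrank_span_eq_card (row_indep hV)]
  simp

/-! ### Counting residue words of weight eight -/

theorem chkInc_spec (p : ℕ) (l : List ℕ) (h : chkInc p l = true) :
    (∀ x ∈ l, p < x) ∧ l.Nodup := by
  induction l generalizing p with
  | nil => simp
  | cons x xs ih =>
    simp only [chkInc, Bool.and_eq_true] at h
    have h1 : p < x := Nat.le_of_ble_eq_true h.1
    obtain ⟨h2, h3⟩ := ih x h.2
    constructor
    · intro y hy
      rcases List.mem_cons.1 hy with rfl | hy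
      · exact h1
      · exact h1.trans (h2 y hy)
    · rw [List.nodup_cons]
      exact ⟨fun hx => lt_irrefl _ (h2 x hx), h3⟩

theorem lt_of_land {a M : ℕ} (h : a &&& M = a) (hM : M < 2 ^ 64) : a < 2 ^ 64 := by
  rw [← h]
  exact lt_of_le_of_lt Nat.and_le_right hM

theorem V_lt (hV : Valid D) : ∀ x ∈ D.V1 ++ D.V2, x < 2 ^ 64 := by
  intro x hx
  rcases List.mem_append.1 hx with h | h
  · obtain ⟨w, -, rfl⟩ := List.mem_map.1 h
    exact lt_of_land (encL_mask hV _) (by norm_num [ML])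
  · obtain ⟨w, -, rfl⟩ := List.mem_map.1 h
    exact lt_of_land (encR_mask hV _) (by norm_num [MR])

/-- Number of residue words of weight eight. -/
noncomputable def eightCount (C : Set (Fin 64 → ZMod 4)) : ℕ :=
  Set.ncard {y | y ∈ residueSet C ∧ hWt y = 8}

theorem cw_left (hV : Valid D) (m : ℕ) (hm : m < 2 ^ 12) :
    (D.cw (m <<< 19) 0).1 = enc D.LL m := by
  rw [split_msg hV]
  have h1 : m <<< 19 >>> 19 % 2 ^ 12 = m := by
    rw [Nat.shiftLeft_shiftRight, Nat.mod_eq_of_lt hm]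
  have h2 : m <<< 19 % 2 ^ 19 = 0 := by
    rw [Nat.shiftLeft_eq, Nat.mul_mod_left]
  rw [h1, h2, enc_zero, Nat.xor_zero]

theorem cw_right (hV : Valid D) (m : ℕ) (hm : m < 2 ^ 19) :
    (D.cw m 0).1 = enc D.RR m := by
  rw [split_msg hV]
  have h1 : m >>> 19 % 2 ^ 12 = 0 := by
    rw [Nat.shiftRight_eq_div_pow, Nat.div_eq_of_lt hm, Nat.zero_mod]
  rw [h1, Nat.mod_eq_of_lt hm, enc_zero, Nat.zero_xor]

theorem eight_set (hV : Valid D) :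
    {y | y ∈ residueSet (code D : Set (Fin 64 → ZMod 4)) ∧ hWt y = 8} =
      bv '' ((D.V1 ++ D.V2).toFinset : Set ℕ) := by
  ext y
  constructor
  · rintro ⟨hy, h8⟩
    obtain ⟨m, t, rfl⟩ := (mem_residue hV y).1 hy
    rw [hWt_bv] at h8
    refine ⟨_, ?_, rfl⟩
    have hs := split_msg hV m t
    have hm : (m >>> 19) % 2 ^ 12 < 2 ^ 12 := Nat.mod_lt _ (by norm_num)
    have hn : m % 2 ^ 19 < 2 ^ 19 := Nat.mod_lt _ (by norm_num)
    generalize (m >>> 19) % 2 ^ 12 = a at hs hm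
    generalize m % 2 ^ 19 = b at hs hn
    have hS : S (D.cw m t).1 = S (enc D.LL a) + S (enc D.RR b) := by
      rw [hs]; exact S_xor_disj _ _ (disj_LR (encL_mask hV _) (encR_mask hV _))
    rw [List.coe_toFinset, Set.mem_ofPred_eq, List.mem_append]
    rcases eightL hV a hm with h1 | ⟨v, hv, rfl, h1⟩ | h1
    · rcases eightR hV b hn with h2 | ⟨w, hw, rfl, h2⟩ | h2
      · rw [h1, h2, enc_zero, enc_zero, S_zero] at hS
        omega
      · right
        rw [hs, h1, enc_zero, Nat.zero_xor]
        exact List.mem_map.2 ⟨w, hw, rfl⟩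
      · omega
    · rcases eightR hV b hn with h2 | ⟨w, hw, rfl, h2⟩ | h2
      · left
        rw [hs, h2, enc_zero, Nat.xor_zero]
        exact List.mem_map.2 ⟨v, hv, rfl⟩
      · omega
      · omega
    · omega
  · rintro ⟨a, ha, rfl⟩
    rw [List.coe_toFinset, Set.mem_ofPred_eq, List.mem_append] at ha
    rcases ha with h | h
    · obtain ⟨w, hw, rfl⟩ := List.mem_map.1 h
      refine ⟨(mem_residue hV _).2 ?_, ?_⟩
      · have h1 := enc_mod D.LL w.1
        rw [lenLL hV] at h1
        exact ⟨(w.1 % 2 ^ 12) <<< 19, 0, by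
          rw [cw_left hV _ (Nat.mod_lt _ (by norm_num)), h1]⟩
      · rw [hWt_bv]; exact (chkCerts_spec _ hV.certL _ (certs_mem _ _ w hw)).1
    · obtain ⟨w, hw, rfl⟩ := List.mem_map.1 h
      refine ⟨(mem_residue hV _).2 ?_, ?_⟩
      · have h1 := enc_mod D.RR w.1
        rw [lenRR hV] at h1
        exact ⟨w.1 % 2 ^ 19, 0, by
          rw [cw_right hV _ (Nat.mod_lt _ (by norm_num)), h1]⟩
      · rw [hWt_bv]; exact (chkCerts_spec _ hV.certR _ (certs_mem _ _ w hw)).1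

theorem eight_count (hV : Valid D) :
    eightCount (code D : Set (Fin 64 → ZMod 4)) = D.W1.length + D.W2.length := by
  rw [eightCount, eight_set hV, Set.ncard_image_of_injOn, Set.ncard_coe_finset,
    List.toFinset_card_of_nodup (chkInc_spec _ _ hV.inc).2]
  · simp [Data.V1, Data.V2]
  · intro a ha b hb h
    rw [List.coe_toFinset] at ha hb
    exact bv_inj (V_lt hV a ha) (V_lt hV b hb) h

end

theorem residue_equiv {C E : Set (Fin 64 → ZMod 4)} (h : MonomiallyEquiv C E) :
    eightCount E = eightCount C := by
  obtain ⟨σ, ε, hε, rfl⟩ := h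
  have key : {y | y ∈ residueSet ((fun x => fun i => ε i * x (σ i)) '' C) ∧ hWt y = 8} =
      (fun y : Fin 64 → ZMod 2 => y ∘ σ) '' {y | y ∈ residueSet C ∧ hWt y = 8} := by
    have hw : ∀ y : Fin 64 → ZMod 2, hWt (y ∘ σ) = hWt y := by
      intro y
      rw [hWt, hWt, Finset.card_filter, Finset.card_filter]
      exact Equiv.sum_comp σ (fun i => if y i ≠ 0 then 1 else 0)
    have hr : ∀ c : Fin 64 → ZMod 4, red (fun i => ε i * c (σ i)) = red c ∘ σ := by
      intro c
      funext i
      have : ∀ a b : ZMod 4, a = 1 ∨ a = 3 →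
          ZMod.castHom (by norm_num : (2 : ℕ) ∣ 4) (ZMod 2) (a * b) =
          ZMod.castHom (by norm_num : (2 : ℕ) ∣ 4) (ZMod 2) b := by decide
      exact this _ _ (hε i)
    ext y
    constructor
    · rintro ⟨⟨_, ⟨c, hc, rfl⟩, rfl⟩, h8⟩
      refine ⟨red c, ⟨⟨c, hc, rfl⟩, ?_⟩, (hr c).symm⟩
      rw [← hw, ← hr c]; exact h8
    · rintro ⟨_, ⟨⟨c, hc, rfl⟩, h8⟩, rfl⟩
      refine ⟨⟨_, ⟨c, hc, rfl⟩, (hr c).symm⟩, ?_⟩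
      exact (hw _).trans h8
  rw [eightCount, key, Set.ncard_image_of_injective]
  · rfl
  · intro a b h
    exact σ.surjective.injective_comp_right h


/-! ### The three codes -/

def octads : List (ℕ × List ℕ) := [
    (1, [236, 310, 572, 1130, 2162]), (2, [184, 364, 613, 1085, 2161]),
    (3, [92, 444, 692, 1156, 2092]), (4, [243, 362, 569, 1136, 2091]),
    (5, [90, 426, 568, 1154, 2224]), (6, [89, 305, 681, 1153, 2233]),
    (7, [248, 304, 608, 1144, 2088]), (8, [87, 178, 771, 1317, 2356]),
    (9, [228, 368, 626, 1078, 2086]), (10, [176, 373, 628, 1121, 2085]),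
    (11, [84, 420, 676, 1076, 2196]), (13, [82, 400, 674, 1200, 2082]),
    (14, [81, 417, 657, 1201, 2081]), (16, [170, 295, 619, 1124, 2157]),
    (17, [78, 294, 654, 1196, 2212]), (18, [77, 168, 813, 1292, 2345]),
    (20, [75, 393, 675, 1067, 2209]), (22, [225, 289, 616, 1065, 2152]),
    (23, [72, 288, 672, 1192, 2184]), (24, [162, 353, 549, 1127, 2150]),
    (25, [70, 388, 548, 1190, 2214]), (26, [69, 160, 804, 1313, 2309]),
    (28, [67, 419, 545, 1185, 2179]), (29, [226, 354, 544, 1058, 2144]),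
    (31, [64, 416, 640, 1056, 2208]), (32, [154, 345, 583, 1108, 2063]),
    (34, [152, 277, 581, 1097, 2140]), (35, [212, 276, 600, 1096, 2060]),
    (36, [201, 275, 602, 1104, 2059]), (37, [200, 274, 578, 1050, 2136]),
    (39, [208, 344, 576, 1048, 2056]), (40, [146, 326, 533, 1091, 2133]),
    (41, [214, 336, 532, 1090, 2054]), (42, [144, 324, 593, 1109, 2053]),
    (44, [193, 322, 529, 1043, 2130]), (45, [192, 338, 528, 1106, 2050]),
    (46, [209, 320, 592, 1041, 2049]), (48, [138, 335, 525, 1092, 2115]),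
    (49, [198, 328, 524, 1038, 2114]), (50, [136, 261, 588, 1101, 2113]),
    (51, [204, 260, 584, 1036, 2112]), (52, [203, 259, 521, 1088, 2122]),
    (53, [194, 258, 520, 1098, 2120]), (56, [130, 321, 582, 1031, 2117]),
    (58, [128, 325, 577, 1029, 2116]), (64, [31, 419, 654, 1067, 2214]),
    (65, [182, 312, 550, 1066, 2108]), (67, [28, 416, 548, 1196, 2184]),
    (68, [169, 315, 547, 1072, 2106]), (69, [26, 168, 810, 1314, 2304]),
    (70, [25, 393, 545, 1192, 2208]), (72, [23, 294, 675, 1190, 2179]),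
    (74, [181, 292, 561, 1057, 2100]), (75, [20, 388, 672, 1056, 2212]),
    (76, [161, 290, 562, 1075, 2097]), (77, [18, 160, 800, 1282, 2338]),
    (78, [17, 288, 640, 1185, 2209]), (80, [175, 297, 558, 1060, 2083]),
    (81, [14, 420, 640, 1190, 2082]), (82, [13, 388, 676, 1185, 2081]),
    (83, [164, 300, 552, 1068, 2080]), (84, [11, 417, 674, 1056, 2179]),
    (87, [8, 160, 768, 1312, 2336]), (89, [6, 288, 674, 1154, 2208]),
    (90, [5, 417, 545, 1153, 2209]), (92, [3, 416, 672, 1153, 2081]),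
    (96, [141, 270, 539, 1044, 2067]), (97, [140, 280, 518, 1054, 2066]),
    (98, [149, 268, 540, 1033, 2065]), (99, [156, 284, 516, 1032, 2064]),
    (100, [155, 266, 515, 1040, 2073]), (102, [145, 264, 513, 1049, 2072]),
    (104, [133, 273, 534, 1027, 2070]), (105, [132, 278, 530, 1026, 2068]),
    (112, [135, 265, 523, 1028, 2062]), (116, [131, 267, 522, 1024, 2057]),
    (121, [134, 256, 514, 1030, 2052]), (126, [129, 257, 512, 1025, 2048]),
    (128, [58, 335, 593, 1031, 2140]), (129, [126, 284, 558, 1030, 2100]),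
    (130, [56, 345, 588, 1029, 2133]), (131, [116, 300, 540, 1028, 2108]),
    (132, [105, 315, 539, 1027, 2097]), (133, [104, 280, 562, 1026, 2106]),
    (134, [121, 297, 561, 1025, 2073]), (135, [112, 312, 552, 1024, 2072]),
    (136, [50, 277, 582, 1109, 2115]), (138, [48, 325, 533, 1108, 2113]),
    (140, [97, 273, 547, 1075, 2067]), (141, [96, 290, 530, 1072, 2066]),
    (144, [42, 326, 577, 1101, 2063]), (145, [102, 268, 550, 1068, 2062]),
    (146, [40, 324, 525, 1097, 2117]), (149, [98, 264, 522, 1066, 2080]),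
    (152, [34, 261, 583, 1091, 2116]), (154, [32, 321, 581, 1092, 2053]),
    (155, [100, 292, 516, 1060, 2052]), (156, [99, 257, 515, 1057, 2083]),
    (160, [26, 77, 772, 1291, 2311]), (161, [76, 270, 534, 1054, 2068]),
    (162, [24, 321, 525, 1101, 2116]), (164, [83, 267, 523, 1049, 2065]),
    (168, [18, 69, 775, 1286, 2305]), (169, [68, 278, 518, 1044, 2070]),
    (170, [16, 261, 577, 1092, 2117]), (175, [80, 256, 512, 1040, 2064]),
    (176, [10, 325, 582, 1091, 2053]), (178, [8, 69, 769, 1285, 2308]),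
    (181, [74, 266, 514, 1032, 2048]), (182, [65, 265, 513, 1033, 2057]),
    (184, [2, 324, 581, 1029, 2113]), (192, [45, 278, 529, 1054, 2059]),
    (193, [44, 270, 528, 1050, 2070]), (194, [53, 276, 524, 1049, 2057]),
    (198, [49, 265, 520, 1048, 2065]), (200, [37, 275, 518, 1043, 2068]),
    (201, [36, 274, 534, 1044, 2050]), (203, [52, 260, 532, 1040, 2048]),
    (204, [51, 259, 514, 1041, 2064]), (208, [39, 267, 513, 1038, 2060]),
    (209, [46, 266, 512, 1036, 2054]), (212, [35, 258, 523, 1033, 2056]),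
    (214, [41, 256, 521, 1032, 2049]), (225, [22, 258, 522, 1038, 2062]),
    (226, [29, 257, 521, 1036, 2052]), (228, [9, 273, 530, 1043, 2050]),
    (229, [8, 18, 770, 1280, 2306]), (236, [1, 274, 528, 1026, 2066]),
    (243, [4, 264, 520, 1024, 2056]), (248, [7, 259, 515, 1025, 2049]),
    (256, [121, 175, 523, 1054, 2108]), (257, [126, 156, 522, 1068, 2106]),
    (258, [53, 212, 521, 1101, 2136]), (259, [52, 204, 520, 1104, 2140]),
    (260, [51, 203, 600, 1050, 2113]), (261, [50, 152, 602, 1098, 2112]),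
    (264, [102, 149, 515, 1075, 2100]), (265, [112, 182, 514, 1060, 2070]),
    (266, [100, 181, 513, 1044, 2097]), (267, [116, 164, 512, 1072, 2068]),
    (268, [98, 145, 562, 1057, 2067]), (270, [96, 161, 561, 1040, 2065]),
    (273, [104, 140, 558, 1066, 2062]), (274, [37, 201, 581, 1036, 2120]),
    (275, [36, 200, 588, 1088, 2060]), (276, [35, 194, 584, 1097, 2059]),
    (277, [34, 136, 578, 1096, 2122]), (278, [105, 169, 552, 1032, 2057]),
    (280, [97, 133, 550, 1030, 2083]), (284, [99, 129, 547, 1026, 2080]),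
    (288, [23, 78, 644, 1163, 2185]), (289, [22, 194, 588, 1036, 2122]),
    (290, [76, 141, 540, 1049, 2073]), (292, [74, 155, 539, 1033, 2072]),
    (294, [17, 72, 649, 1160, 2177]), (295, [16, 136, 584, 1088, 2120]),
    (297, [80, 134, 534, 1028, 2066]), (300, [83, 131, 530, 1025, 2064]),
    (304, [7, 203, 578, 1098, 2059]), (305, [6, 72, 650, 1152, 2186]),
    (310, [1, 200, 520, 1096, 2112]), (312, [65, 135, 518, 1027, 2052]),
    (315, [68, 132, 516, 1024, 2048]), (320, [46, 155, 540, 1043, 2053]),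
    (321, [56, 154, 534, 1038, 2052]), (322, [44, 141, 533, 1041, 2072]),
    (324, [42, 146, 539, 1049, 2049]), (325, [58, 138, 530, 1048, 2048]),
    (326, [40, 144, 529, 1033, 2073]), (328, [49, 135, 532, 1031, 2066]),
    (335, [48, 128, 528, 1024, 2064]), (336, [41, 134, 524, 1027, 2063]),
    (338, [45, 132, 525, 1025, 2056]), (344, [39, 131, 516, 1029, 2050]),
    (345, [32, 130, 518, 1028, 2054]), (353, [24, 130, 524, 1030, 2062]),
    (354, [29, 129, 525, 1029, 2057]), (360, [6, 17, 641, 1155, 2178]),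
    (362, [4, 145, 529, 1040, 2049]), (364, [2, 144, 513, 1041, 2065]),
    (368, [9, 133, 514, 1031, 2054]), (373, [10, 128, 512, 1026, 2050]),
    (384, [29, 99, 548, 1067, 2062]), (387, [44, 76, 532, 1048, 2064]),
    (388, [25, 75, 544, 1066, 2083]), (390, [41, 80, 529, 1049, 2056]),
    (392, [39, 83, 534, 1043, 2054]), (393, [20, 70, 550, 1058, 2080]),
    (397, [16, 34, 576, 1090, 2114]), (398, [49, 65, 528, 1041, 2048]),
    (400, [13, 70, 547, 1057, 2086]), (401, [46, 74, 518, 1038, 2050]),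
    (402, [45, 68, 524, 1033, 2049]), (404, [9, 97, 515, 1058, 2082]),
    (409, [4, 98, 544, 1026, 2082]), (416, [31, 67, 516, 1038, 2057]),
    (417, [14, 84, 530, 1040, 2054]), (419, [28, 64, 524, 1032, 2052]),
    (420, [11, 81, 512, 1043, 2066]), (426, [5, 81, 529, 1025, 2065]),
    (444, [3, 64, 513, 1024, 2049]), (448, [22, 35, 525, 1032, 2063]),
    (450, [13, 20, 549, 1060, 2085]), (451, [24, 32, 516, 1036, 2060]),
    (453, [10, 48, 514, 1040, 2066]), (456, [7, 51, 530, 1024, 2065]),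
    (468, [2, 40, 521, 1025, 2057]), (474, [1, 36, 512, 1028, 2052]),
    (480, [3, 28, 521, 1029, 2060]), (496, [5, 11, 515, 1026, 2048]),
    (512, [126, 175, 267, 1075, 2070]), (513, [102, 182, 266, 1054, 2106]),
    (514, [121, 181, 265, 1068, 2068]), (515, [100, 156, 264, 1072, 2108]),
    (516, [99, 155, 315, 1066, 2066]), (518, [97, 169, 312, 1049, 2064]),
    (520, [53, 198, 259, 1106, 2133]), (521, [52, 214, 258, 1092, 2130]),
    (522, [116, 149, 257, 1060, 2097]), (523, [112, 164, 256, 1044, 2100]),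
    (524, [49, 194, 336, 1043, 2115]), (525, [48, 146, 338, 1088, 2114]),
    (528, [45, 193, 335, 1098, 2054]), (529, [44, 192, 326, 1038, 2122]),
    (530, [105, 141, 300, 1057, 2052]), (532, [41, 203, 328, 1091, 2050]),
    (533, [40, 138, 322, 1090, 2120]), (534, [104, 161, 297, 1033, 2048]),
    (539, [96, 132, 292, 1028, 2080]), (540, [98, 131, 290, 1027, 2083]),
    (544, [29, 203, 335, 1038, 2120]), (545, [28, 70, 398, 1160, 2178]),
    (547, [68, 140, 284, 1040, 2072]), (548, [25, 67, 384, 1163, 2186]),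
    (549, [24, 138, 328, 1098, 2122]), (550, [65, 145, 280, 1032, 2073]),
    (552, [83, 135, 278, 1030, 2067]), (558, [80, 129, 273, 1024, 2065]),
    (561, [74, 134, 270, 1026, 2062]), (562, [76, 133, 268, 1025, 2057]),
    (568, [5, 67, 387, 1155, 2177]), (569, [4, 194, 322, 1088, 2050]),
    (572, [1, 192, 258, 1090, 2114]), (576, [39, 145, 284, 1050, 2063]),
    (577, [58, 144, 278, 1036, 2062]), (578, [37, 140, 277, 1048, 2073]),
    (581, [34, 154, 274, 1032, 2072]), (582, [56, 136, 273, 1041, 2057]),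
    (583, [32, 152, 280, 1040, 2056]), (584, [51, 134, 276, 1029, 2067]),
    (588, [50, 130, 275, 1025, 2065]), (592, [46, 129, 268, 1031, 2059]),
    (593, [42, 128, 270, 1030, 2060]), (600, [35, 135, 260, 1026, 2053]),
    (602, [36, 133, 261, 1024, 2049]), (608, [7, 155, 274, 1049, 2056]),
    (610, [5, 25, 392, 1152, 2185]), (613, [2, 152, 264, 1048, 2064]),
    (616, [22, 131, 261, 1031, 2048]), (619, [16, 128, 260, 1028, 2052]),
    (626, [9, 132, 256, 1029, 2053]), (628, [10, 130, 257, 1027, 2049]),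
    (640, [31, 78, 292, 1065, 2083]), (641, [46, 80, 278, 1050, 2060]),
    (644, [51, 74, 275, 1048, 2057]), (647, [24, 40, 320, 1096, 2112]),
    (649, [22, 98, 294, 1056, 2052]), (650, [37, 68, 276, 1041, 2065]),
    (652, [35, 83, 274, 1040, 2049]), (654, [17, 64, 289, 1057, 2080]),
    (656, [39, 65, 270, 1036, 2059]), (657, [14, 64, 290, 1060, 2086]),
    (659, [36, 76, 260, 1032, 2056]), (662, [9, 96, 257, 1056, 2081]),
    (664, [7, 99, 289, 1027, 2081]), (672, [23, 75, 260, 1033, 2062]),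
    (674, [13, 84, 273, 1044, 2049]), (675, [20, 72, 268, 1036, 2048]),
    (676, [11, 82, 256, 1041, 2067]), (681, [6, 82, 274, 1024, 2064]),
    (692, [3, 72, 265, 1025, 2056]), (704, [14, 17, 295, 1058, 2085]),
    (705, [16, 42, 268, 1038, 2054]), (706, [29, 41, 261, 1033, 2053]),
    (708, [10, 50, 259, 1043, 2067]), (714, [4, 49, 273, 1025, 2064]),
    (720, [1, 44, 266, 1030, 2062]), (733, [2, 32, 256, 1024, 2048]),
    (744, [3, 20, 257, 1028, 2053]), (752, [6, 11, 259, 1027, 2050]),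
    (768, [11, 87, 164, 1078, 2097]), (769, [10, 116, 178, 1044, 2086]),
    (770, [9, 112, 149, 1076, 2085]), (771, [8, 84, 176, 1060, 2100]),
    (772, [58, 83, 154, 1041, 2073]), (775, [56, 80, 144, 1048, 2072]),
    (776, [3, 84, 181, 1072, 2085]), (777, [2, 100, 176, 1076, 2068]),
    (778, [1, 52, 208, 1108, 2116]), (784, [46, 76, 135, 1029, 2063]),
    (789, [42, 74, 130, 1024, 2056]), (792, [39, 68, 134, 1031, 2053]),
    (798, [32, 65, 128, 1025, 2049]), (800, [31, 77, 132, 1031, 2062]),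
    (804, [26, 75, 128, 1027, 2057]), (810, [20, 69, 133, 1029, 2052]),
    (813, [18, 64, 130, 1026, 2048]), (816, [14, 69, 131, 1030, 2049]),
    (818, [13, 64, 129, 1028, 2053]), (834, [29, 45, 133, 1028, 2060]),
    (836, [24, 41, 131, 1026, 2059]), (841, [22, 36, 132, 1030, 2054]),
    (844, [16, 35, 129, 1027, 2050]), (848, [7, 34, 138, 1033, 2057]),
    (851, [4, 40, 136, 1032, 2048]), (852, [3, 8, 161, 1057, 2080]),
    (864, [13, 18, 135, 1025, 2054]), (865, [14, 20, 134, 1024, 2050]),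
    (896, [23, 36, 77, 1038, 2063]), (898, [28, 45, 69, 1036, 2053]),
    (900, [26, 32, 67, 1033, 2059]), (901, [18, 42, 72, 1032, 2050]),
    (914, [5, 41, 72, 1024, 2057]), (920, [6, 35, 67, 1025, 2048]),
    (928, [4, 25, 74, 1027, 2059]), (936, [7, 17, 65, 1026, 2050]),
    (945, [2, 8, 68, 1028, 2052]), (961, [6, 26, 40, 1026, 2056]),
    (968, [5, 18, 34, 1027, 2049]), (998, [1, 8, 16, 1024, 2048]),
    (1024, [116, 135, 315, 558, 2073]), (1025, [126, 134, 300, 562, 2072]),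
    (1026, [105, 133, 284, 561, 2108]), (1027, [104, 132, 312, 540, 2100]),
    (1028, [112, 131, 297, 539, 2106]), (1029, [58, 130, 344, 584, 2130]),
    (1030, [121, 129, 280, 552, 2097]), (1031, [56, 128, 328, 592, 2136]),
    (1032, [99, 181, 278, 550, 2065]), (1033, [98, 182, 292, 534, 2064]),
    (1036, [51, 209, 274, 577, 2114]), (1038, [49, 208, 321, 529, 2112]),
    (1040, [100, 175, 270, 547, 2057]), (1041, [46, 204, 322, 582, 2056]),
    (1043, [44, 200, 320, 524, 2116]), (1044, [96, 169, 266, 523, 2083]),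
    (1048, [39, 198, 325, 578, 2049]), (1049, [102, 164, 290, 518, 2048]),
    (1050, [37, 193, 260, 576, 2117]), (1054, [97, 161, 256, 513, 2080]),
    (1056, [31, 75, 398, 649, 2188]), (1057, [74, 156, 268, 530, 2070]),
    (1058, [29, 204, 325, 524, 2117]), (1060, [80, 155, 265, 522, 2067]),
    (1065, [22, 198, 260, 582, 2116]), (1066, [65, 149, 273, 516, 2068]),
    (1067, [20, 64, 384, 644, 2180]), (1068, [83, 145, 257, 514, 2066]),
    (1072, [68, 141, 267, 515, 2062]), (1075, [76, 140, 264, 512, 2052]),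
    (1076, [11, 64, 387, 641, 2178]), (1078, [9, 193, 321, 577, 2049]),
    (1085, [2, 128, 320, 576, 2112]), (1088, [52, 155, 275, 525, 2062]),
    (1090, [41, 156, 273, 533, 2060]), (1091, [40, 152, 268, 532, 2068]),
    (1092, [48, 154, 267, 521, 2067]), (1096, [35, 149, 277, 530, 2054]),
    (1097, [34, 146, 276, 516, 2070]), (1098, [53, 145, 261, 528, 2052]),
    (1101, [50, 144, 258, 512, 2066]), (1104, [36, 141, 259, 522, 2063]),
    (1106, [45, 140, 257, 520, 2053]), (1108, [32, 138, 265, 515, 2059]),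
    (1109, [42, 136, 264, 514, 2050]), (1120, [11, 20, 390, 647, 2177]),
    (1121, [10, 146, 278, 534, 2054]), (1124, [16, 138, 259, 523, 2057]),
    (1127, [24, 136, 256, 520, 2048]), (1130, [1, 132, 276, 532, 2064]),
    (1136, [4, 131, 266, 521, 2059]), (1144, [7, 129, 258, 513, 2050]),
    (1152, [7, 121, 305, 539, 2091]), (1153, [6, 90, 304, 552, 2106]),
    (1154, [5, 89, 297, 569, 2097]), (1155, [4, 112, 280, 568, 2088]),
    (1156, [3, 89, 312, 561, 2088]), (1157, [2, 56, 336, 600, 2120]),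
    (1158, [1, 104, 304, 568, 2072]), (1160, [53, 83, 275, 532, 2070]),
    (1163, [52, 80, 276, 528, 2068]), (1170, [45, 76, 265, 521, 2060]),
    (1172, [41, 74, 267, 520, 2059]), (1177, [36, 68, 258, 514, 2054]),
    (1180, [35, 65, 259, 512, 2050]), (1185, [28, 78, 266, 520, 2062]),
    (1190, [25, 72, 264, 521, 2057]), (1192, [23, 70, 259, 513, 2052]),
    (1196, [17, 67, 258, 515, 2048]), (1200, [13, 67, 257, 518, 2054]),
    (1201, [14, 70, 256, 516, 2050]), (1216, [29, 46, 264, 523, 2063]),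
    (1221, [24, 42, 266, 522, 2056]), (1224, [22, 39, 256, 515, 2053]),
    (1230, [16, 32, 257, 513, 2049]), (1233, [10, 34, 260, 518, 2052]),
    (1234, [9, 37, 261, 516, 2048]), (1240, [3, 5, 289, 544, 2080]),
    (1248, [14, 23, 261, 514, 2049]), (1250, [13, 17, 260, 512, 2053]),
    (1280, [45, 83, 155, 533, 2063]), (1282, [28, 77, 169, 549, 2080]),
    (1285, [40, 74, 154, 528, 2066]), (1286, [24, 97, 168, 545, 2057]),
    (1288, [22, 37, 192, 583, 2115]), (1291, [48, 68, 144, 532, 2052]),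
    (1292, [18, 67, 162, 547, 2083]), (1293, [32, 80, 146, 530, 2050]),
    (1296, [14, 67, 161, 550, 2085]), (1297, [42, 76, 138, 516, 2054]),
    (1298, [41, 65, 141, 525, 2053]), (1300, [10, 99, 162, 513, 2081]),
    (1306, [4, 96, 129, 545, 2081]), (1312, [13, 87, 145, 534, 2050]),
    (1313, [26, 70, 138, 518, 2062]), (1314, [25, 69, 140, 525, 2048]),
    (1317, [8, 82, 146, 514, 2064]), (1320, [5, 82, 131, 528, 2067]),
    (1336, [3, 69, 132, 512, 2053]), (1344, [29, 39, 136, 518, 2059]),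
    (1345, [14, 18, 164, 544, 2086]), (1347, [16, 36, 140, 524, 2056]),
    (1350, [9, 49, 145, 512, 2064]), (1352, [7, 50, 128, 529, 2067]),
    (1361, [2, 44, 132, 520, 2060]), (1372, [1, 34, 130, 514, 2048]),
    (1380, [3, 25, 129, 520, 2056]), (1394, [5, 8, 128, 513, 2049]),
    (1408, [31, 46, 72, 525, 2059]), (1409, [26, 42, 78, 524, 2060]),
    (1416, [23, 35, 64, 518, 2053]), (1418, [17, 36, 69, 516, 2049]),
    (1424, [11, 39, 69, 514, 2052]), (1431, [8, 32, 64, 512, 2048]),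
    (1442, [9, 20, 68, 513, 2053]), (1444, [10, 18, 65, 515, 2049]),
    (1456, [1, 6, 74, 522, 2056]), (1472, [8, 23, 37, 515, 2054]),
    (1476, [11, 17, 34, 513, 2050]), (1513, [2, 4, 16, 512, 2048]),
    (1537, [50, 76, 154, 276, 2062]), (1538, [29, 44, 201, 324, 2113]),
    (1540, [42, 83, 152, 273, 2059]), (1541, [26, 72, 170, 290, 2080]),
    (1544, [23, 69, 161, 295, 2083]), (1546, [36, 80, 145, 277, 2053]),
    (1548, [34, 65, 144, 275, 2067]), (1551, [16, 96, 160, 288, 2048]),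
    (1552, [35, 74, 140, 261, 2063]), (1554, [13, 69, 164, 292, 2085]),
    (1555, [32, 68, 136, 268, 2060]), (1557, [10, 98, 160, 256, 2082]),
    (1560, [7, 97, 131, 288, 2082]), (1568, [14, 87, 149, 278, 2053]),
    (1569, [18, 78, 136, 270, 2052]), (1570, [17, 77, 141, 261, 2057]),
    (1574, [8, 81, 144, 257, 2065]), (1576, [6, 81, 129, 275, 2066]),
    (1584, [3, 77, 133, 264, 2060]), (1600, [13, 23, 162, 289, 2086]),
    (1601, [22, 46, 138, 270, 2050]), (1602, [24, 45, 141, 260, 2049]),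
    (1604, [9, 51, 146, 258, 2065]), (1609, [4, 48, 130, 274, 2066]),
    (1622, [1, 40, 128, 264, 2056]), (1624, [2, 37, 133, 257, 2052]),
    (1644, [3, 17, 128, 256, 2049]), (1649, [6, 8, 130, 258, 2048]),
    (1664, [28, 41, 75, 270, 2063]), (1666, [25, 45, 77, 268, 2056]),
    (1672, [20, 39, 67, 261, 2050]), (1673, [18, 32, 70, 260, 2054]),
    (1680, [11, 37, 70, 258, 2053]), (1684, [8, 34, 67, 259, 2049]),
    (1696, [9, 22, 69, 259, 2054]), (1701, [10, 16, 64, 258, 2050]),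
    (1722, [1, 4, 64, 256, 2048]), (1731, [8, 20, 36, 256, 2052]),
    (1732, [11, 18, 35, 257, 2048]), (1760, [2, 5, 24, 265, 2057]),
    (1792, [31, 39, 70, 141, 2060]), (1793, [20, 46, 78, 140, 2054]),
    (1796, [17, 35, 75, 138, 2056]), (1798, [25, 41, 64, 136, 2049]),
    (1808, [5, 40, 75, 130, 2059]), (1817, [6, 34, 64, 128, 2050]),
    (1827, [4, 24, 72, 128, 2056]), (1832, [7, 16, 67, 130, 2049]),
    (1844, [2, 9, 65, 129, 2048]), (1856, [6, 25, 42, 131, 2057]),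
    (1866, [5, 17, 32, 129, 2048]), (1888, [1, 10, 22, 134, 2052]),
    (1921, [14, 22, 34, 68, 2048]), (1922, [13, 16, 37, 65, 2052]), (1932, [1, 2, 48, 80, 2064]),
    (2000, [3, 4, 9, 32, 2049]), (2048, [126, 181, 315, 534, 1049]),
    (2049, [46, 214, 324, 602, 1048]), (2050, [45, 201, 344, 532, 1109]),
    (2052, [121, 155, 312, 530, 1075]), (2053, [42, 154, 320, 600, 1106]),
    (2054, [41, 209, 345, 528, 1096]), (2056, [39, 212, 338, 583, 1041]),
    (2057, [116, 182, 278, 562, 1040]), (2059, [36, 192, 276, 592, 1108]),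
    (2060, [35, 208, 275, 593, 1090]), (2062, [112, 145, 273, 561, 1072]),
    (2063, [32, 144, 336, 576, 1104]), (2064, [99, 175, 300, 518, 1033]),
    (2065, [98, 164, 270, 558, 1032]), (2066, [97, 141, 297, 516, 1068]),
    (2067, [96, 140, 268, 552, 1060]), (2068, [105, 161, 267, 514, 1066]),
    (2070, [104, 169, 265, 512, 1057]), (2072, [102, 135, 292, 547, 1025]),
    (2073, [100, 134, 290, 550, 1024]), (2080, [83, 149, 284, 539, 1054]),
    (2081, [14, 82, 390, 662, 1170]), (2082, [13, 81, 404, 641, 1172]),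
    (2083, [80, 156, 280, 540, 1044]), (2085, [10, 144, 338, 592, 1090]),
    (2086, [9, 192, 336, 593, 1041]), (2088, [7, 209, 275, 576, 1106]),
    (2091, [4, 208, 320, 528, 1104]), (2092, [3, 81, 401, 656, 1152]),
    (2097, [76, 132, 266, 522, 1030]), (2100, [74, 129, 264, 523, 1027]),
    (2106, [68, 133, 257, 513, 1028]), (2108, [65, 131, 256, 515, 1026]),
    (2112, [51, 156, 261, 539, 1038]), (2113, [50, 138, 260, 540, 1054]),
    (2114, [49, 149, 280, 525, 1036]), (2115, [48, 136, 284, 524, 1044]),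
    (2116, [58, 152, 257, 523, 1043]), (2117, [56, 146, 256, 522, 1050]),
    (2120, [53, 131, 274, 533, 1030]), (2122, [52, 129, 277, 529, 1028]),
    (2130, [44, 133, 264, 521, 1029]), (2133, [40, 130, 266, 520, 1026]),
    (2136, [37, 132, 258, 515, 1031]), (2140, [34, 128, 259, 513, 1027]),
    (2144, [29, 134, 267, 520, 1031]), (2150, [24, 128, 265, 521, 1025]),
    (2152, [22, 135, 259, 512, 1029]), (2157, [16, 130, 258, 514, 1024]),
    (2160, [3, 13, 384, 644, 1157]), (2161, [2, 136, 268, 516, 1036]),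
    (2162, [1, 140, 260, 524, 1032]), (2177, [52, 74, 274, 524, 1054]),
    (2178, [29, 100, 268, 545, 1065]), (2179, [28, 72, 292, 544, 1068]),
    (2180, [49, 83, 266, 521, 1050]), (2184, [23, 67, 289, 550, 1060]),
    (2185, [22, 102, 288, 516, 1058]), (2186, [53, 65, 260, 529, 1044]),
    (2188, [51, 80, 258, 513, 1043]), (2192, [37, 76, 259, 523, 1038]),
    (2195, [44, 68, 256, 520, 1036]), (2196, [11, 67, 290, 547, 1058]),
    (2197, [10, 32, 322, 578, 1088]), (2206, [1, 96, 288, 544, 1024]),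
    (2208, [31, 70, 265, 515, 1036]), (2209, [20, 78, 264, 514, 1038]),
    (2212, [17, 75, 259, 522, 1032]), (2214, [25, 64, 257, 520, 1033]),
    (2224, [5, 75, 267, 521, 1027]), (2233, [6, 64, 258, 512, 1026]),
    (2240, [11, 23, 295, 549, 1057]), (2242, [9, 36, 277, 533, 1040]),
    (2244, [24, 34, 267, 515, 1033]), (2247, [16, 40, 264, 512, 1032]),
    (2249, [2, 48, 276, 532, 1028]), (2256, [7, 41, 265, 522, 1026]),
    (2264, [4, 35, 257, 514, 1027]), (2272, [6, 25, 266, 523, 1025]),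
    (2282, [5, 17, 256, 513, 1024]), (2304, [31, 69, 169, 558, 1058]),
    (2305, [58, 68, 146, 540, 1038]), (2306, [29, 105, 140, 549, 1056]),
    (2308, [56, 65, 138, 539, 1043]), (2309, [26, 64, 162, 552, 1066]),
    (2311, [24, 104, 160, 544, 1032]), (2314, [49, 80, 132, 533, 1029]),
    (2316, [48, 83, 130, 529, 1027]), (2320, [44, 74, 131, 525, 1031]),
    (2323, [40, 76, 128, 524, 1028]), (2328, [7, 35, 193, 577, 1091]),
    (2330, [5, 64, 161, 544, 1057]), (2333, [2, 96, 160, 512, 1056]),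
    (2336, [28, 75, 135, 525, 1026]), (2338, [25, 77, 133, 524, 1024]),
    (2344, [20, 67, 129, 518, 1031]), (2345, [18, 70, 128, 516, 1030]),
    (2352, [11, 70, 134, 513, 1029]), (2356, [8, 67, 130, 515, 1025]),
    (2368, [5, 26, 170, 547, 1065]), (2369, [4, 42, 152, 530, 1050]),
    (2372, [1, 50, 154, 522, 1048]), (2377, [22, 34, 134, 518, 1026]),
    (2378, [16, 37, 133, 516, 1025]), (2384, [10, 39, 135, 515, 1030]),
    (2390, [9, 32, 129, 513, 1024]), (2403, [8, 20, 132, 512, 1028]),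
    (2404, [11, 18, 131, 514, 1027]), (2432, [14, 39, 87, 533, 1044]),
    (2433, [18, 40, 78, 518, 1036]), (2434, [17, 37, 77, 525, 1033]),
    (2438, [8, 48, 81, 513, 1041]), (2440, [6, 51, 81, 528, 1027]),
    (2448, [3, 45, 77, 520, 1028]), (2469, [2, 24, 72, 520, 1024]),
    (2472, [1, 22, 68, 514, 1030]), (2482, [4, 9, 65, 512, 1025]),
    (2508, [3, 17, 32, 512, 1025]), (2513, [6, 8, 34, 514, 1024]),
    (2528, [7, 10, 16, 513, 1027]), (2560, [22, 104, 141, 295, 1067]),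
    (2562, [20, 77, 161, 300, 1065]), (2563, [56, 76, 152, 284, 1036]),
    (2564, [18, 75, 170, 297, 1057]), (2565, [58, 74, 136, 280, 1050]),
    (2566, [16, 105, 168, 289, 1033]), (2568, [51, 83, 133, 277, 1031]),
    (2573, [50, 80, 128, 274, 1026]), (2576, [6, 75, 169, 289, 1066]),
    (2578, [4, 41, 200, 321, 1097]), (2580, [2, 97, 168, 265, 1065]),
    (2585, [34, 68, 130, 260, 1030]), (2586, [37, 65, 129, 261, 1029]),
    (2592, [31, 72, 131, 270, 1029]), (2593, [26, 78, 130, 268, 1028]),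
    (2600, [23, 64, 134, 261, 1027]), (2602, [17, 69, 132, 260, 1025]),
    (2608, [11, 69, 135, 257, 1031]), (2615, [8, 64, 128, 256, 1024]),
    (2624, [29, 40, 135, 270, 1027]), (2627, [24, 44, 132, 268, 1024]),
    (2632, [7, 32, 146, 273, 1043]), (2633, [6, 18, 162, 290, 1058]),
    (2638, [1, 48, 144, 256, 1040]), (2641, [10, 36, 134, 258, 1028]),
    (2644, [9, 35, 131, 259, 1025]), (2656, [8, 23, 133, 259, 1030]),
    (2660, [11, 17, 129, 258, 1026]), (2688, [13, 35, 87, 277, 1043]),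
    (2689, [26, 34, 70, 270, 1038]), (2690, [25, 44, 69, 261, 1032]),
    (2693, [8, 50, 82, 258, 1040]), (2696, [5, 49, 82, 275, 1026]),
    (2712, [3, 36, 69, 256, 1029]), (2722, [1, 28, 76, 264, 1028]),
    (2732, [2, 16, 65, 257, 1025]), (2736, [7, 9, 67, 258, 1024]),
    (2756, [3, 25, 41, 264, 1024]), (2770, [5, 8, 32, 257, 1025]),
    (2785, [4, 10, 18, 256, 1026]), (2817, [28, 44, 78, 134, 1030]),
    (2822, [25, 40, 72, 129, 1025]), (2824, [23, 37, 70, 135, 1028]),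
    (2828, [17, 34, 67, 131, 1024]), (2832, [13, 39, 67, 133, 1027]),
    (2833, [14, 32, 70, 132, 1026]), (2849, [6, 16, 74, 138, 1032]),
    (2850, [5, 24, 65, 136, 1033]), (2852, [3, 9, 80, 145, 1040]),
    (2880, [14, 23, 35, 130, 1031]), (2882, [13, 17, 36, 128, 1029]),
    (2936, [1, 2, 4, 128, 1024]), (2944, [7, 24, 42, 75, 1025]), (2955, [4, 16, 32, 64, 1024]),
    (2964, [1, 10, 34, 64, 1026]), (3008, [2, 9, 20, 37, 1029]), (3072, [25, 78, 175, 290, 549]),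
    (3073, [24, 102, 170, 270, 548]), (3074, [53, 76, 156, 277, 525]),
    (3079, [48, 80, 152, 264, 520]), (3080, [17, 70, 164, 295, 547]),
    (3081, [16, 100, 162, 294, 518]), (3082, [52, 68, 149, 261, 533]),
    (3084, [50, 83, 146, 259, 515]), (3088, [9, 39, 194, 326, 581]),
    (3089, [8, 70, 162, 292, 550]), (3093, [34, 74, 138, 258, 522]),
    (3094, [40, 65, 136, 257, 521]), (3096, [1, 98, 134, 294, 548]),
    (3104, [23, 77, 140, 258, 523]), (3106, [28, 69, 141, 256, 521]),
    (3108, [26, 67, 136, 267, 513]), (3109, [18, 72, 138, 266, 512]),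
    (3122, [5, 72, 129, 265, 520]), (3128, [6, 67, 131, 259, 514]),
    (3137, [22, 44, 140, 266, 514]), (3138, [29, 37, 141, 265, 513]),
    (3140, [10, 35, 145, 274, 529]), (3142, [8, 17, 161, 289, 544]),
    (3148, [2, 49, 129, 273, 528]), (3152, [7, 42, 130, 267, 523]),
    (3163, [4, 32, 128, 256, 512]), (3169, [6, 26, 128, 264, 522]),
    (3176, [5, 18, 130, 257, 515]), (3200, [31, 44, 77, 267, 522]),
    (3204, [26, 40, 75, 265, 523]), (3210, [20, 37, 69, 257, 512]),
    (3213, [18, 34, 64, 256, 514]), (3216, [14, 35, 69, 260, 515]),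
    (3218, [13, 36, 64, 261, 513]), (3232, [11, 22, 65, 261, 518]),
    (3235, [8, 16, 68, 260, 516]), (3240, [3, 4, 80, 273, 529]), (3264, [13, 18, 39, 259, 516]),
    (3265, [14, 20, 32, 258, 518]), (3316, [1, 2, 8, 256, 512]), (3328, [23, 34, 75, 141, 524]),
    (3330, [13, 32, 84, 149, 529]), (3331, [20, 44, 72, 136, 516]),
    (3332, [11, 49, 82, 144, 515]), (3337, [6, 50, 82, 130, 530]), (3348, [3, 41, 72, 128, 521]),
    (3360, [2, 29, 76, 133, 521]), (3374, [1, 16, 64, 128, 512]), (3377, [4, 10, 64, 130, 514]),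
    (3400, [3, 20, 36, 133, 513]), (3408, [6, 11, 35, 129, 512]), (3424, [7, 9, 17, 131, 515]),
    (3457, [10, 22, 36, 70, 512]), (3460, [9, 16, 35, 67, 514]), (3480, [2, 5, 32, 65, 513]),
    (3522, [1, 4, 24, 40, 520]), (3584, [31, 37, 67, 138, 268]), (3585, [14, 36, 84, 146, 274]),
    (3587, [28, 40, 64, 140, 260]), (3588, [11, 51, 81, 145, 259]),
    (3594, [5, 48, 81, 128, 273]), (3612, [3, 32, 64, 129, 257]), (3620, [1, 24, 74, 130, 266]),
    (3625, [2, 20, 68, 132, 256]), (3632, [7, 10, 65, 128, 259]), (3648, [3, 28, 45, 132, 265]),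
    (3664, [5, 11, 34, 131, 256]), (3682, [4, 9, 16, 129, 257]), (3712, [10, 23, 39, 68, 257]),
    (3718, [9, 17, 32, 65, 256]), (3729, [2, 4, 40, 72, 264]), (3784, [1, 6, 16, 34, 258]),
    (3840, [7, 26, 41, 74, 129]), (3848, [4, 18, 35, 65, 131]), (3858, [1, 8, 36, 68, 132]),
    (3909, [2, 8, 16, 32, 128]), (4000, [3, 5, 8, 17, 64])]

def leftRows1 : List (ℕ × ℕ) := [
    (8389596, 8913382542274), (4197774, 10664991000547), (2099953, 10481498587950),
    (1050098, 21277284762308), (527419, 33207126854001), (262383, 4104998880678),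
    (133994, 25046688992140), (69197, 13395701007039), (35159, 26384185429327),
    (18345, 29931476091230), (12084, 1916260057613), (5783, 19116849105356)]

def rightRows1 : List (ℕ × ℕ) := [
    (9223401794384691200, 1845678313078), (4611719695718940672, 27043714567055),
    (2305850682223099904, 4534797600787), (1152932856020860928, 8301869797267),
    (576471804596453376, 12005037574665), (288237254743162880, 19522874509140),
    (144135006531354624, 27166607673216), (72089990355484672, 16272926441561),
    (36053570440658944, 7266547795743), (18046308421992448, 488518978392),
    (9040470973874176, 25260850152375), (4510614902800384, 824432396382),
    (2272884563116032, 6134136046735), (1128285475962880, 15862757067018),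
    (597760747241472, 14212331998104), (293449865625600, 23243205379774),
    (175592070709248, 9331638536259), (93289223028736, 17543565672623),
    (45441425080320, 14810456524572)]

def eights1 : List (ℕ × List ℕ) := [

    (1, [65538, 262148, 24584, 434192, 229408, 352320, 8320, 106752, 320000, 1024, 387072, 151552]),
    (13, [360450, 131088, 458784, 229440, 393344, 327936, 131584, 361472, 329728, 299008, 401408, 507904]),
    (20, [393217, 491522, 131080, 458784, 229440, 131200, 344320, 131584, 148480, 83968, 430080, 8192]),
    (80, [475137, 65538, 327684, 90120, 458784, 8320, 270592, 25088, 66560, 26624, 217088, 294912]),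
    (81, [65538, 393220, 139272, 32, 8320, 8448, 467456, 132096, 272384, 4096, 16384, 229376]),
    (96, [409601, 131074, 294916, 114696, 360464, 98432, 196864, 279040, 132096, 313344, 217088, 8192]),
    (133, [131074, 409608, 131088, 458784, 278592, 196864, 279040, 132096, 215040, 217088, 8192, 491520]),
    (136, [475137, 65538, 131076, 131088, 458784, 278592, 205056, 483840, 66560, 26624, 217088, 294912]),
    (160, [401409, 499714, 40964, 139272, 360464, 229440, 164096, 131584, 361472, 428032, 438272, 507904]),
    (180, [196609, 65538, 458760, 64, 327936, 131584, 132096, 67584, 4096, 335872, 16384, 229376]),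
    (216, [409601, 2, 278532, 393248, 409856, 131584, 1024, 149504, 151552, 139264, 294912, 65536]),
    (229, [131074, 131080, 393232, 256, 262656, 132096, 264192, 4096, 8192, 16384, 32768, 196608]),
    (278, [196609, 131080, 458784, 458816, 458880, 197120, 66560, 198656, 462848, 466944, 278528, 294912]),
    (326, [278529, 16392, 131088, 262176, 131200, 147968, 132096, 149504, 20480, 139264, 294912, 196608]),
    (515, [393220, 139272, 73744, 458784, 458816, 8320, 262400, 66560, 2048, 4096, 212992, 294912]),
    (536, [262273, 65538, 262148, 360480, 360512, 33024, 361472, 34816, 4096, 303104, 114688, 393216]),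
    (1024, [1, 147458, 131076, 90120, 360464, 458784, 229440, 483456, 254208, 270848, 272384, 217088]),
    (1026, [197121, 262148, 459272, 229392, 229408, 229440, 459392, 459008, 198656, 135168, 466944, 147456]),
    (1040, [67585, 329730, 231428, 98312, 163872, 393280, 163968, 33024, 492032, 4096, 237568, 212992]),
    (2313, [131074, 131076, 131088, 262176, 278592, 262272, 279040, 132096, 20480, 8192, 294912, 196608]),
    (2433, [65538, 131076, 262152, 131088, 458784, 458816, 131584, 66560, 4096, 401408, 212992, 294912]),
    (2444, [1, 262146, 262160, 65568, 262208, 262656, 263168, 331776, 8192, 16384, 98304, 393216]),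
    (2560, [499713, 499714, 73732, 139272, 131088, 335904, 131136, 106624, 295168, 1024, 471040, 245760]),
    (4096, [122881, 139266, 204804, 409608, 360464, 458784, 286784, 106624, 303360, 246272, 361472, 321536]),
    (4192, [393217, 98306, 262148, 131080, 360464, 131200, 229632, 492032, 66560, 493568, 237568, 49152]),
    (4229, [327682, 131080, 65552, 458784, 458816, 459008, 197120, 66560, 198656, 466944, 278528, 294912]),
    (4499, [262148, 262152, 32, 64, 262656, 1024, 264192, 8192, 278528, 294912, 65536, 393216]),
    (5188, [196609, 65538, 131080, 131088, 458784, 458880, 131328, 131584, 264192, 8192, 344064, 294912]),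
    (6162, [1, 131076, 262152, 458784, 458816, 131200, 65792, 131584, 66560, 401408, 212992, 294912]),
    (8192, [82433, 327682, 114692, 344584, 114704, 229408, 229440, 33408, 180480, 361472, 444416, 512000]),
    (8267, [262148, 262160, 262176, 262272, 262400, 279040, 263168, 280576, 20480, 294912, 327680, 393216]),
    (8320, [1, 475138, 131076, 131080, 360464, 147488, 360512, 49408, 475648, 279552, 83968, 20480]),
    (8448, [98305, 360450, 395268, 296968, 131088, 458784, 229440, 198784, 131584, 361472, 299008, 507904]),
    (8461, [131074, 131088, 262176, 262208, 131200, 131584, 132096, 133120, 4096, 16384, 294912, 196608]),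
    (8712, [458753, 395266, 327684, 327696, 264224, 2112, 264320, 196864, 396288, 200704, 16384, 32768]),
    (9218, [212993, 81924, 475144, 344080, 458784, 458816, 131200, 147712, 131584, 411648, 479232, 294912]),
    (10244, [278529, 131074, 131592, 131088, 262176, 278592, 17024, 279296, 132096, 20480, 294912, 196608]),
    (10273, [327682, 262148, 32776, 360464, 360512, 32896, 295168, 262656, 361472, 266240, 114688, 393216]),
    (10324, [131073, 2, 131080, 393248, 393344, 131328, 131584, 1024, 397312, 278528, 294912, 65536]),
    (10369, [131074, 327684, 8, 131088, 458784, 262208, 327936, 131584, 132096, 200704, 16384, 491520]),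
    (10380, [262145, 2, 131088, 393248, 393280, 262400, 131584, 1024, 4096, 147456, 294912, 65536]),
    (10562, [1, 131076, 131080, 131088, 262176, 262272, 512, 132096, 266240, 278528, 294912, 196608]),
    (12838, [1, 8, 16, 64, 128, 65792, 1024, 67584, 16384, 98304, 131072, 262144]),
    (15376, [393217, 262146, 262148, 131080, 131104, 131136, 131200, 131328, 131584, 16384, 294912, 327680]),
    (16384, [266241, 210946, 131076, 403464, 79888, 458784, 337984, 276608, 6400, 395776, 66560, 294912]),
    (16424, [270337, 139266, 335876, 131088, 262208, 8320, 459008, 512, 132096, 198656, 208896, 491520]),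
    (16520, [1, 327682, 131076, 65552, 458784, 458816, 8448, 270848, 66560, 272384, 266240, 294912]),
    (17544, [1, 262146, 262148, 360464, 65568, 360512, 360704, 262656, 264192, 331776, 8192, 393216]),
    (17920, [491521, 65538, 360452, 131080, 360464, 229408, 491584, 229504, 196864, 460800, 233472, 204800]),
    (19716, [1, 262146, 262152, 16, 65568, 64, 262272, 262656, 331776, 8192, 360448, 393216]),
    (19728, [262145, 65538, 262148, 8, 327712, 327744, 128, 512, 4096, 8192, 294912, 131072]),
    (20480, [296961, 360450, 395268, 296968, 460816, 458784, 229440, 393344, 2304, 131584, 361472, 401408]),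
    (20493, [65538, 65552, 196640, 196672, 131200, 131328, 131584, 66560, 133120, 139264, 32768, 262144]),
    (25608, [1, 196610, 131076, 131088, 393248, 131136, 393344, 196864, 197120, 329728, 266240, 491520]),
    (28928, [393217, 65538, 262148, 131080, 65552, 458784, 458816, 131200, 131584, 66560, 133120, 294912]),
    (32818, [393217, 262148, 131080, 458816, 131200, 131328, 393728, 66560, 395264, 135168, 139264, 81920]),
    (33024, [73729, 204802, 204804, 475144, 344080, 458784, 352320, 24704, 131584, 345088, 272384, 339968]),
    (33060, [262145, 65538, 131080, 327696, 458816, 128, 262656, 66560, 264192, 4096, 8192, 212992]),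
    (33217, [65538, 262148, 262152, 327696, 65568, 262656, 66560, 264192, 4096, 8192, 344064, 393216]),
    (33292, [1, 278530, 409616, 262176, 409664, 262272, 409856, 132096, 149504, 20480, 417792, 196608]),
    (33794, [409601, 475140, 131080, 131088, 458784, 278592, 147584, 475392, 131584, 83968, 217088, 8192]),
    (34880, [1, 65538, 131076, 262152, 196880, 458784, 131200, 131584, 66560, 4096, 401408, 212992]),
    (35904, [1, 327682, 131076, 65544, 131088, 458784, 458880, 262400, 197120, 266240, 466944, 475136]),
    (36865, [139266, 262148, 73736, 262160, 73760, 262208, 73856, 139520, 270848, 132096, 272384, 16384]),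
    (36934, [262145, 8, 16, 327712, 128, 327936, 512, 1024, 67584, 8192, 16384, 131072]),
    (36946, [1, 262148, 262152, 65568, 262272, 256, 262656, 66560, 264192, 8192, 344064, 393216]),
    (37120, [278529, 393218, 65540, 16392, 131088, 458784, 16448, 131200, 147968, 132096, 83968, 139264]),
    (41568, [262145, 65538, 262148, 8, 16, 128, 327936, 1024, 67584, 4096, 16384, 131072]),
    (42242, [1, 131076, 8, 131088, 393248, 131136, 393344, 131584, 264192, 266240, 409600, 65536]),
    (49418, [1, 131076, 131088, 131104, 131136, 131200, 197120, 1024, 67584, 4096, 204800, 262144]),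
    (65538, [1, 180228, 409608, 155664, 450592, 155712, 409728, 303360, 270848, 287744, 190464, 315392]),
    (65612, [1, 163842, 393232, 262176, 262272, 33024, 295424, 132096, 296960, 4096, 40960, 16384]),
    (65705, [32770, 262148, 262160, 262208, 33024, 295424, 1024, 296960, 4096, 40960, 16384, 131072]),
    (66560, [270849, 270338, 172036, 139784, 131088, 434208, 131136, 139904, 295168, 165888, 307200, 16384]),
    (67620, [278529, 393218, 16392, 131088, 16448, 131200, 131328, 147968, 132096, 20480, 139264, 294912]),
    (67728, [49153, 294914, 262148, 311304, 262176, 16448, 33024, 279040, 263168, 20480, 40960, 393216]),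
    (67938, [262145, 262148, 8, 16, 128, 512, 1024, 4096, 8192, 16384, 294912, 131072]),
    (69120, [1, 294914, 131076, 8, 131088, 393248, 131136, 393344, 295168, 266240, 434176, 409600]),
    (69634, [286721, 139268, 409608, 139280, 393248, 409664, 393344, 8448, 287232, 1024, 149504, 294912]),
    (71680, [262145, 147458, 425988, 131080, 409616, 49184, 278592, 128, 33024, 262656, 148480, 8192]),
    (73760, [278529, 149506, 409604, 131080, 131088, 264256, 16512, 264448, 512, 132096, 20480, 294912]),
    (82564, [262145, 2, 131080, 131088, 393248, 393280, 262400, 1024, 133120, 4096, 8192, 294912]),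
    (83058, [1, 4, 8, 128, 256, 512, 2048, 4096, 8192, 32768, 131072, 262144]),
    (83968, [266241, 139266, 397316, 143368, 397328, 8224, 270400, 8320, 4352, 270848, 140288, 32768]),
    (90120, [36865, 36866, 266244, 16, 4128, 64, 299136, 295168, 512, 1024, 34816, 131072]),
    (92680, [1, 2, 131076, 131088, 131104, 131136, 131200, 256, 1024, 4096, 32768, 262144]),
    (98880, [1, 139266, 131076, 131080, 131088, 262176, 262272, 8448, 132096, 272384, 266240, 278528]),
    (102568, [1, 262146, 262148, 262160, 262208, 262400, 262656, 263168, 264192, 8192, 16384, 393216]),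
    (104740, [1, 2, 8, 16, 64, 128, 512, 1024, 8192, 16384, 131072, 262144]),
    (109314, [1, 4, 8, 16, 32, 64, 128, 1024, 4096, 16384, 131072, 262144]),
    (115776, [393217, 2, 262148, 131080, 262160, 131104, 131200, 131328, 393728, 395264, 135168, 139264]),
    (119840, [1, 262146, 262148, 262152, 16, 64, 262272, 256, 262656, 264192, 8192, 393216]),
    (131076, [270337, 77826, 8200, 307216, 102432, 331840, 8320, 102656, 299520, 1024, 366592, 16384]),
    (131077, [8194, 24584, 262160, 73760, 278592, 8320, 327936, 16896, 1024, 83968, 356352, 360448]),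
    (131080, [122881, 327682, 303108, 303120, 73760, 278592, 8320, 327936, 377344, 361472, 288768, 356352]),
    (131088, [352257, 98306, 262148, 90120, 73760, 368704, 90240, 8448, 270848, 66560, 272384, 45056]),
    (131139, [262148, 73736, 262160, 73760, 73856, 270592, 270848, 263168, 272384, 339968, 16384, 98304]),
    (131200, [315393, 344066, 102404, 331784, 102416, 282656, 278592, 37120, 20992, 361472, 313344, 57344]),
    (131584, [278529, 378882, 360452, 114696, 360464, 313376, 34880, 313472, 33024, 347136, 20480, 40960]),
    (131630, [1, 16, 64, 262272, 256, 1024, 264192, 266240, 8192, 278528, 294912, 65536]),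
    (132096, [266241, 290818, 81924, 90120, 339984, 73760, 73792, 348288, 266496, 270848, 92160, 294912]),
    (135280, [1, 327682, 262148, 262152, 262272, 262400, 512, 66560, 2048, 270336, 81920, 294912]),
    (135304, [1, 262146, 65540, 360464, 65568, 360512, 33024, 262656, 263168, 67584, 8192, 16384]),
    (137476, [1, 262146, 65544, 327696, 65568, 327744, 65664, 262656, 263168, 8192, 16384, 32768]),
    (139266, [262145, 81924, 328712, 327696, 345120, 345152, 344192, 17664, 17920, 83968, 4096, 294912]),
    (139272, [266241, 327682, 262148, 262160, 282656, 4160, 282752, 86272, 70144, 263168, 71680, 98304]),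
    (140864, [327681, 65538, 262148, 65544, 16, 262176, 65664, 327936, 67584, 4096, 16384, 360448]),
    (143368, [1, 514, 66052, 16, 328224, 64, 262272, 65792, 1024, 329728, 278528, 360448]),
    (148480, [266241, 2, 65540, 331784, 65552, 335904, 331840, 336000, 8448, 266752, 71680, 294912]),
    (152576, [1, 262146, 327684, 98312, 360464, 65568, 360512, 98432, 295168, 262656, 329728, 8192]),
    (163874, [1, 262148, 262152, 344080, 344128, 262272, 344320, 82432, 66560, 83968, 20480, 352256]),
    (164896, [66049, 65538, 262148, 328200, 16, 64, 328320, 327936, 67584, 4096, 335872, 16384]),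
    (165012, [1, 65538, 8, 32, 64, 65792, 66048, 67584, 4096, 73728, 16384, 262144]),
    (168002, [270337, 262148, 8200, 262160, 8224, 8320, 8448, 270848, 1024, 272384, 16384, 65536]),
    (217088, [33281, 32770, 262148, 295432, 16, 32, 64, 295552, 295168, 1024, 34816, 303104]),
    (218114, [1, 262148, 262152, 262160, 262176, 262208, 262272, 262400, 512, 2048, 270336, 294912]),
    (229408, [1, 262146, 2052, 6152, 268304, 268352, 6272, 4352, 262656, 263168, 8192, 16384]),
    (229440, [278529, 2, 18436, 264200, 18448, 280608, 280704, 256, 279040, 1024, 20480, 8192]),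
    (262148, [1, 174082, 139272, 131088, 10272, 43072, 198784, 205056, 8704, 175104, 36864, 245760]),
    (262153, [100354, 131076, 131088, 198688, 34880, 198784, 196864, 197120, 101376, 233472, 8192, 49152]),
    (262273, [204802, 131076, 90120, 131088, 73760, 155712, 205056, 221696, 205824, 149504, 217088, 32768]),
    (262284, [16385, 2, 131088, 65568, 147520, 196864, 16896, 1024, 83968, 217088, 8192, 229376]),
    (263204, [40961, 139266, 8200, 139280, 163904, 8320, 164096, 131584, 133120, 135168, 16384, 65536]),
    (264448, [16385, 229378, 131076, 81928, 131088, 65568, 147520, 65664, 246272, 230400, 217088, 8192]),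
    (264708, [196609, 65538, 139272, 131088, 32, 64, 8320, 8448, 132096, 4096, 16384, 229376]),
    (264789, [2, 8, 32, 128, 256, 1024, 4096, 8192, 16384, 32768, 65536, 131072]),
    (264880, [1, 131074, 131076, 131080, 64, 256, 132096, 4096, 8192, 16384, 32768, 196608]),
    (266241, [139266, 73732, 139272, 229392, 73760, 229440, 139392, 33024, 131584, 132096, 67584, 16384]),
    (270848, [49153, 65538, 65796, 114952, 16, 98336, 114752, 98688, 1024, 83968, 20480, 131072]),
    (270849, [2, 165892, 131080, 165904, 163872, 34880, 163968, 131328, 1024, 167936, 49152, 65536]),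
    (272384, [245761, 2, 163844, 147464, 131088, 163872, 114752, 131200, 33024, 16896, 1024, 217088]),
    (278592, [196609, 33794, 65540, 131080, 99344, 131104, 131200, 229632, 230912, 165888, 233472, 237568]),
    (282656, [133121, 196610, 2052, 131080, 198672, 198720, 131200, 256, 68096, 1024, 8192, 229376]),
    (287745, [65538, 131076, 131080, 131088, 32, 64, 128, 196864, 197120, 198656, 4096, 229376]),
    (294912, [139777, 139266, 10244, 76296, 67600, 73760, 67648, 76416, 196864, 132096, 208896, 16384]),
    (295008, [66049, 65538, 4, 66056, 16, 82560, 65792, 1024, 83968, 20480, 73728, 131072]),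
    (328224, [49153, 163842, 131076, 180232, 131088, 16448, 32896, 33024, 132096, 51200, 20480, 40960]),
    (344584, [36865, 2, 32772, 16, 32800, 36928, 128, 33024, 1024, 6144, 8192, 131072]),
    (360464, [2049, 141314, 10244, 139272, 8224, 8256, 8320, 139520, 131584, 1024, 4096, 147456]),
    (361472, [133121, 133634, 2052, 131080, 131600, 131104, 131648, 131200, 256, 4096, 8192, 16384]),
    (393353, [32770, 98308, 98320, 98336, 98368, 33024, 512, 1024, 67584, 4096, 40960, 16384]),
    (394272, [6145, 69634, 2052, 8, 67600, 67648, 128, 4352, 68096, 8192, 16384, 98304]),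
    (394304, [49153, 65538, 65540, 114696, 16, 98336, 98432, 256, 115200, 83968, 20480, 8192]),
    (397316, [16385, 65538, 81928, 32784, 65568, 49216, 65664, 33024, 82432, 66560, 83968, 8192]),
    (458784, [33281, 32770, 34820, 2568, 34832, 34880, 2688, 33024, 1024, 4096, 40960, 16384])]

def sixteens1 : List (ℕ × ℕ) := [
    (2219, 512020), (8276, 135336), (10067, 458784), (20506, 199456), (28750, 362640),
    (34152, 6162), (35524, 218114), (42300, 200835), (43664, 1026), (54642, 459265),
    (61985, 395286), (62758, 68232), (70255, 434304), (71016, 59398), (73155, 148004),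
    (78395, 132096), (80528, 49418), (82549, 131080), (90657, 131076), (92810, 397316),
    (102400, 26500), (112467, 16424), (114714, 268100), (116509, 139266), (116913, 780),
    (122958, 268801), (135506, 10369), (147784, 264708), (151268, 36865), (155932, 66561),
    (158135, 266248), (181280, 10369), (183435, 69908), (199825, 70), (217895, 44048),
    (237830, 4289), (239105, 282676), (262479, 10880), (263752, 10369), (264676, 168465),
    (265955, 188436), (271900, 98433), (272816, 65), (284242, 8193), (291073, 166562),
    (295712, 81), (298124, 131665), (303988, 65538), (318614, 74497), (332576, 182469),
    (332839, 140048), (334988, 515), (343256, 32802), (364879, 140304), (374300, 2433),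
    (385281, 7332), (397341, 126210), (405577, 18066), (409607, 42024), (411392, 10244),
    (439585, 18562), (442984, 14610), (459378, 58369)]

def duals1 : List (ℕ × ℕ) := [
    (384303104, 3371440492), (793247744, 6287136696), (1658322944, 8130172716),
    (1738539008, 7942519788), (1549271040, 5971559228), (523239424, 2798331996),
    (1539309568, 3736337212), (2049441792, 1183388740), (1768947712, 2020778396),
    (1371013120, 2695078204), (750256128, 1005768996), (902823936, 7556528008),
    (102568, 6594598620), (116147, 71890824), (303614, 4491390068), (146409, 5426509472),
    (4499, 7821674784), (171571, 3812745924), (136125, 2553769344), (109314, 515379760),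
    (177855, 2050793924), (104740, 7507303108), (410911, 855439088), (83058, 6102780776),
    (235345, 6651831904), (253111, 6388430252), (97728, 7551615600), (380675, 4829075120),
    (264789, 3925529888), (521724, 1032310540), (208790, 387033024)]

def data1 : Data where
  L := leftRows1
  R := rightRows1
  H := [9763836395520, 18095250866176]
  W1 := octads
  W2 := eights1
  K := sixteens1
  F := duals1
  S := [1780853, 1604954]
  x6 := 583

def leftRows2 : List (ℕ × ℕ) := [
    (8389596, 16787752094658), (4197774, 1892084090851), (2099953, 14493266477870),
    (1050098, 32578199356100), (527419, 11305746434417), (262383, 19519015749030),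
    (133994, 14831260273548), (69197, 33923698524863), (35159, 10274971061583),
    (18345, 16178739151198), (12084, 34173360275981), (5783, 16110170671564)]

def rightRows2 : List (ℕ × ℕ) := [
    (9223401070028390400, 6113214860200), (4611686990717386752, 18499430779154),
    (2305851608711299072, 2881352632222), (1152933533971382272, 18020256710944),
    (576483360088522752, 15565582239391), (288257455366864896, 11607786653364),
    (144140441829244928, 25077911388820), (72070180657692672, 10533138858174),
    (36058177866825728, 15310333675464), (18030503110115328, 24225226163131),
    (9016608940883968, 12157274030913), (4537832227995648, 26195122979875),
    (2259100872212480, 1111423452882), (1130352999399424, 4656784738969),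
    (586466207989760, 26790831588881), (308828549677056, 13846722906850),
    (156057569591296, 2369010008986), (96713234710528, 9762729102922),
    (52177963843584, 16653735692412)]

def eights2 : List (ℕ × List ℕ) := [

    (8, [184321, 4098, 32772, 426000, 311328, 364608, 233600, 53504, 250368, 328704, 186368, 335872]),
    (18, [81921, 16388, 229384, 147488, 376896, 409728, 16640, 393728, 33792, 165888, 217088, 237568]),
    (32, [458753, 327682, 57348, 32776, 237584, 73792, 237696, 82176, 459264, 377856, 165888, 372736]),
    (55, [8, 65600, 98432, 33024, 98816, 1024, 34816, 69632, 40960, 81920, 131072, 262144]),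
    (144, [73729, 270338, 139268, 229384, 32, 401472, 8448, 393728, 205824, 34816, 274432, 311296]),
    (195, [327684, 262152, 196624, 262176, 262400, 393728, 263168, 460800, 266240, 270336, 278528, 294912]),
    (216, [196609, 327682, 65540, 196640, 131328, 197120, 394240, 133120, 462848, 401408, 475136, 32768]),
    (260, [73729, 466946, 262152, 466960, 16416, 417856, 327808, 418304, 9216, 485376, 282624, 294912]),
    (261, [81922, 98312, 16, 16416, 376896, 278656, 262656, 33792, 34816, 86016, 106496, 131072]),
    (279, [393224, 32, 131136, 262272, 393728, 394240, 264192, 135168, 401408, 147456, 425984, 196608]),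
    (288, [163857, 131090, 393236, 393224, 65600, 98432, 229888, 394240, 165888, 69632, 40960, 81920]),
    (312, [98305, 327682, 98308, 262208, 65664, 262656, 33792, 100352, 266240, 40960, 278528, 131072]),
    (513, [466946, 229380, 131080, 360464, 32, 393280, 98432, 8448, 173056, 75776, 438272, 409600]),
    (576, [393217, 425986, 245764, 475144, 376848, 81952, 98432, 246016, 476160, 165888, 20480, 40960]),
    (832, [458753, 327682, 212996, 327688, 16, 81952, 128, 17408, 460800, 397312, 401408, 360448]),
    (864, [458753, 327682, 327684, 131080, 196624, 196736, 132096, 2048, 331776, 139264, 344064, 163840]),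
    (1032, [73729, 65538, 147460, 139280, 16416, 393280, 401536, 16640, 393728, 75776, 77824, 98304]),
    (1094, [360449, 8, 327696, 98336, 360576, 295168, 360960, 34816, 69632, 303104, 344064, 131072]),
    (1137, [32770, 294916, 8, 32896, 295168, 33280, 34816, 266240, 303104, 16384, 327680, 131072]),
    (2049, [32802, 163876, 8, 294960, 65600, 98432, 295168, 360960, 1024, 462848, 40960, 475136]),
    (2061, [327682, 327696, 278560, 64, 327808, 278784, 512, 17408, 266240, 270336, 32768, 131072]),
    (2084, [163841, 32770, 229384, 16, 393280, 360576, 229632, 393728, 33792, 36864, 237568, 245760]),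
    (2102, [393217, 8, 131136, 131200, 262400, 393728, 1024, 266240, 8192, 278528, 32768, 196608]),
    (2337, [294914, 393220, 32776, 16, 131136, 163968, 393728, 33792, 299008, 40960, 311296, 196608]),
    (2625, [196610, 327684, 262152, 196624, 196640, 327808, 262400, 263168, 200704, 270336, 212992, 294912]),
    (2690, [327681, 327684, 262152, 65552, 16416, 16448, 262400, 263168, 20480, 270336, 294912, 131072]),
    (3088, [196609, 327682, 278532, 131080, 409632, 327744, 196736, 475392, 328192, 331776, 139264, 163840]),
    (4098, [328705, 98308, 8, 492560, 393248, 131136, 492672, 296192, 34304, 493568, 434176, 147456]),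
    (4160, [434177, 458754, 368644, 237576, 237584, 499744, 106624, 499968, 401920, 205824, 34816, 507904]),
    (6368, [1, 65538, 16388, 8, 65552, 16640, 512, 82944, 73728, 98304, 131072, 262144]),
    (8195, [98308, 32776, 491536, 229408, 327744, 131200, 229632, 328192, 33792, 34816, 266240, 475136]),
    (8200, [131073, 32770, 245764, 32784, 393248, 16448, 180352, 114944, 492032, 345088, 378880, 282624]),
    (8262, [65537, 8, 98320, 16416, 98432, 114944, 98816, 82944, 34816, 69632, 131072, 262144]),
    (8305, [65538, 16388, 8, 128, 16640, 512, 82944, 67584, 69632, 98304, 131072, 262144]),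
    (8384, [344065, 327682, 196612, 131080, 327696, 409632, 409856, 147968, 132096, 346112, 266240, 163840]),
    (8448, [82945, 327682, 459780, 476168, 410640, 328736, 131136, 410752, 83456, 133120, 266240, 229376]),
    (9216, [327745, 32770, 114692, 8, 360528, 278624, 360576, 114944, 360960, 34816, 69632, 131072]),
    (9221, [327682, 327688, 262160, 196640, 131136, 262272, 131328, 393728, 460800, 135168, 147456, 360448]),
    (9490, [393217, 262148, 262152, 131104, 131136, 262272, 393728, 395264, 135168, 147456, 294912, 65536]),
    (12298, [360449, 65540, 65552, 32, 294976, 98432, 295168, 512, 1024, 67584, 311296, 393216]),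
    (14481, [65538, 4, 8, 32, 64, 256, 512, 66560, 16384, 98304, 131072, 262144]),
    (16416, [1, 327682, 65540, 204808, 458768, 270400, 73856, 65792, 434688, 205824, 165888, 299008]),
    (16448, [401409, 262146, 394244, 8200, 8208, 263200, 73856, 263424, 401920, 198656, 266240, 229376]),
    (16640, [266241, 360450, 98308, 372744, 360464, 65568, 45120, 73856, 12800, 373760, 34816, 131072]),
    (17024, [98305, 65538, 66564, 8, 65552, 37920, 4160, 34048, 104448, 40960, 131072, 262144]),
    (17418, [327681, 98308, 98320, 32, 262208, 98432, 295168, 33280, 100352, 266240, 40960, 393216]),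
    (18434, [262145, 66564, 262152, 65552, 332832, 4160, 331904, 66816, 262656, 335872, 360448, 131072]),
    (20480, [32769, 32770, 66564, 131080, 131088, 197664, 491584, 491648, 197888, 492032, 34816, 106496]),
    (20513, [196610, 327684, 262152, 196624, 131136, 327808, 262400, 393728, 263168, 460800, 270336, 294912]),
    (20706, [262145, 262148, 262152, 16, 262400, 262656, 263168, 264192, 270336, 294912, 65536, 131072]),
    (21512, [131073, 327682, 262148, 327696, 393248, 131136, 327808, 393472, 131584, 133120, 204800, 360448]),
    (22784, [458753, 327682, 327684, 131080, 196624, 262176, 131136, 196736, 393728, 132096, 139264, 163840]),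
    (23136, [65537, 65538, 65540, 8, 65552, 65664, 256, 1024, 8192, 32768, 131072, 262144]),
    (24896, [393217, 196610, 131076, 8, 458768, 32, 65664, 393728, 197632, 264192, 266240, 229376]),
    (29696, [262145, 32770, 32772, 262152, 32784, 32, 327744, 98432, 295168, 98816, 34816, 393216]),
    (32770, [65793, 65796, 8200, 327952, 278816, 24896, 73856, 25088, 9216, 346112, 20480, 131072]),
    (32776, [20481, 28674, 77828, 8208, 32, 278592, 286848, 78080, 356864, 82944, 92160, 131072]),
    (33362, [262145, 262148, 262152, 32, 327808, 256, 328704, 264192, 266240, 335872, 16384, 393216]),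
    (33792, [131073, 139266, 90116, 262152, 139280, 344096, 196672, 204928, 221440, 336384, 272384, 462848]),
    (34056, [327681, 327682, 262148, 131088, 393248, 131136, 131200, 328192, 133120, 266240, 204800, 475136]),
    (34816, [335873, 327682, 466948, 65672, 144, 458912, 131136, 131328, 393728, 9216, 135168, 147456]),
    (35456, [257, 262146, 260, 8200, 262416, 288, 270656, 9216, 266240, 278528, 65536, 131072]),
    (38036, [65537, 65538, 8, 32, 64, 256, 512, 67584, 8192, 16384, 131072, 262144]),
    (38914, [1, 8196, 131080, 401424, 262176, 131136, 401536, 8448, 270848, 132096, 147456, 458752]),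
    (40960, [2049, 18434, 198660, 147464, 147472, 67616, 477248, 460928, 67840, 477696, 150528, 86016]),
    (41992, [1, 327682, 278532, 327696, 278560, 64, 327808, 278784, 512, 2048, 266240, 131072]),
    (44037, [65538, 8, 65552, 32, 64, 65664, 256, 512, 4096, 16384, 131072, 262144]),
    (45120, [393217, 262146, 327684, 8, 16, 458784, 65664, 459008, 393728, 197632, 198656, 475136]),
    (49410, [327681, 335876, 8, 73744, 262176, 64, 73856, 270848, 1024, 75776, 266240, 131072]),
    (53504, [393217, 327682, 262148, 8, 65552, 393248, 131136, 65664, 393728, 197632, 133120, 204800]),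
    (61440, [131073, 262146, 394244, 262152, 262160, 263200, 131136, 262272, 263424, 131584, 133120, 65536]),
    (65672, [303105, 32770, 8196, 270352, 262176, 16448, 8448, 287232, 304128, 34816, 61440, 131072]),
    (65793, [32770, 18436, 262152, 32784, 16416, 262208, 32896, 2560, 314368, 266240, 40960, 393216]),
    (66096, [32769, 294914, 278532, 262152, 64, 262272, 278784, 50176, 34816, 299008, 270336, 131072]),
    (66564, [303105, 294914, 172040, 139280, 303136, 131136, 139392, 270592, 270848, 165888, 397312, 409600]),
    (68096, [278785, 49154, 260, 8, 295184, 288, 262464, 32896, 33792, 266240, 319488, 131072]),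
    (70272, [425985, 32770, 131076, 32776, 262160, 32, 131136, 295168, 33792, 264192, 40960, 311296]),
    (71697, [262146, 262148, 262152, 393248, 393280, 128, 393472, 393728, 394240, 401408, 409600, 294912]),
    (73729, [425986, 295940, 1032, 164880, 394272, 131136, 164992, 296192, 427520, 165888, 266240, 278528]),
    (73856, [4097, 32770, 262148, 262152, 167952, 393248, 393280, 393472, 393728, 164864, 6144, 409600]),
    (74305, [294914, 32772, 262152, 294928, 32, 262272, 33024, 263168, 34816, 299008, 311296, 131072]),
    (74888, [262145, 262146, 16388, 16, 16416, 262208, 16640, 262656, 264192, 266240, 294912, 131072]),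
    (75776, [442369, 16386, 409604, 262152, 16400, 311328, 409664, 180352, 33024, 442880, 263168, 20480]),
    (98308, [262145, 270338, 131080, 139280, 24608, 8256, 128, 16640, 393728, 418816, 141312, 274432]),
    (98432, [2049, 286722, 280580, 16392, 288784, 280608, 2112, 280832, 2560, 287744, 266240, 131072]),
    (131072, [356353, 32770, 339972, 32776, 262160, 311328, 364608, 98432, 16640, 115200, 9216, 51200]),
    (131080, [368641, 286722, 98308, 294928, 311328, 376896, 385152, 303360, 369152, 9216, 305152, 20480]),
    (131091, [327684, 262152, 16416, 16448, 327808, 262400, 279040, 263168, 346112, 20480, 270336, 294912]),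
    (131108, [344065, 376834, 262152, 376848, 16448, 98432, 33024, 49664, 263168, 116736, 20480, 40960]),
    (131136, [73729, 368642, 66564, 41992, 369680, 98336, 99456, 8448, 337408, 34816, 372736, 344064]),
    (131280, [327681, 16386, 327684, 262152, 16416, 262400, 328192, 263168, 264192, 20480, 270336, 294912]),
    (131332, [360449, 327682, 32776, 98320, 311328, 16448, 98432, 279040, 33792, 346112, 20480, 40960]),
    (131684, [327681, 327682, 8, 65552, 65664, 262400, 1024, 67584, 266240, 8192, 278528, 32768]),
    (132102, [32769, 32776, 360464, 98336, 327744, 128, 98560, 328192, 34816, 266240, 106496, 344064]),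
    (133714, [65537, 65540, 8, 32, 65664, 256, 1024, 4096, 8192, 16384, 32768, 262144]),
    (133777, [262146, 262148, 262152, 262176, 262208, 262400, 263168, 266240, 270336, 278528, 294912, 65536]),
    (140293, [262146, 262152, 262160, 32, 327744, 327808, 256, 328192, 264192, 266240, 16384, 294912]),
    (140545, [65538, 65540, 8, 65552, 16416, 16448, 65664, 16896, 83968, 20480, 32768, 262144]),
    (143872, [2049, 327682, 262148, 262152, 329744, 262176, 262208, 329856, 262400, 328704, 278528, 360448]),
    (151557, [32770, 8, 32784, 32, 65600, 98432, 33024, 98816, 1024, 34816, 40960, 262144]),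
    (151602, [65537, 65540, 8, 65600, 65664, 256, 66048, 1024, 2048, 8192, 32768, 262144]),
    (153604, [327681, 327682, 8, 65552, 327712, 65600, 65664, 262400, 328192, 1024, 8192, 32768]),
    (163857, [262146, 260, 8200, 288, 270656, 8320, 270848, 9216, 2048, 266240, 278528, 65536]),
    (165888, [73729, 66050, 73732, 262152, 66064, 32, 576, 327808, 256, 9216, 266240, 16384]),
    (166148, [16385, 65538, 8, 65552, 16416, 16448, 65664, 16896, 82944, 20480, 90112, 262144]),
    (181760, [262145, 65538, 327684, 327688, 16, 32, 65600, 262272, 327936, 264192, 69632, 335872]),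
    (201344, [278529, 262146, 262148, 262152, 262160, 16416, 16448, 16640, 17408, 280576, 24576, 294912]),
    (237584, [1, 264194, 2052, 8, 32, 262208, 2176, 2304, 264704, 1024, 266240, 278528]),
    (262152, [65793, 180226, 260, 114960, 131360, 82240, 163968, 180736, 33792, 165888, 217088, 237568]),
    (262170, [32769, 98308, 98336, 16448, 128, 98560, 16896, 33792, 34816, 86016, 106496, 131072]),
    (262248, [131073, 196610, 147460, 196624, 131200, 16640, 131584, 214016, 198656, 200704, 204800, 229376]),
    (262434, [73729, 98308, 8, 106512, 64, 106624, 512, 33792, 75776, 45056, 16384, 131072]),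
    (266240, [49153, 65538, 197636, 82952, 147472, 181280, 16448, 98432, 114944, 229888, 165888, 122880]),
    (266528, [196609, 32770, 98308, 8, 98320, 131136, 98432, 229888, 197632, 165888, 237568, 147456]),
    (267779, [16388, 8, 16, 16416, 64, 128, 16640, 2048, 8192, 32768, 65536, 131072]),
    (268424, [131073, 196610, 131076, 196624, 32, 131136, 256, 131584, 197632, 204800, 16384, 229376]),
    (270361, [196610, 131076, 32, 131136, 131200, 256, 131584, 197632, 198656, 200704, 16384, 229376]),
    (278568, [12289, 4098, 77828, 8208, 65600, 73856, 78080, 12800, 74752, 67584, 98304, 131072]),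
    (281728, [131073, 2, 65540, 8, 16, 196640, 131136, 196864, 131584, 200704, 204800, 32768]),
    (296192, [196609, 212994, 131076, 131080, 147472, 32, 213056, 196736, 213504, 198656, 217088, 139264]),
    (297232, [65537, 65538, 16388, 8, 16416, 65600, 65664, 66048, 82944, 69632, 8192, 131072]),
    (311328, [4097, 12290, 77828, 8, 8208, 64, 8320, 78080, 78336, 66560, 75776, 131072]),
    (327682, [132097, 139268, 41992, 33808, 32, 172096, 163968, 8448, 164352, 34816, 45056, 16384]),
    (327826, [1, 32772, 8, 32, 16448, 33024, 49664, 1024, 34816, 20480, 40960, 131072]),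
    (327845, [16386, 8, 16400, 16448, 256, 16896, 1024, 2048, 20480, 8192, 32768, 131072]),
    (330248, [1, 32770, 131076, 163856, 32, 131136, 163968, 131328, 33792, 135168, 40960, 147456]),
    (360968, [2049, 133122, 133124, 133136, 131104, 131136, 133248, 131328, 132096, 135168, 139264, 147456]),
    (393236, [73729, 65538, 8, 16416, 73792, 65664, 16640, 74240, 82944, 75776, 77824, 98304]),
    (393728, [86017, 49154, 98308, 69640, 49168, 65568, 86080, 49280, 53504, 70656, 34816, 122880]),
    (394268, [65537, 65538, 32, 64, 128, 256, 512, 67584, 69632, 8192, 16384, 98304]),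
    (410368, [32769, 4098, 32772, 32776, 4112, 32, 4160, 32896, 33792, 34816, 40960, 65536]),
    (430216, [65537, 65538, 65540, 65552, 32, 64, 256, 512, 1024, 67584, 8192, 16384]),
    (434306, [1, 65540, 8, 65552, 32, 65600, 65792, 512, 1024, 67584, 69632, 81920])]

def sixteens2 : List (ℕ × ℕ) := [
    (1806, 237584), (3425, 327682), (6596, 451595), (24998, 426001), (27847, 491536),
    (30818, 263553), (44628, 212994), (45214, 345088), (49811, 331848), (53560, 272962),
    (65687, 15136), (67481, 57346), (68344, 409857), (70706, 32776), (91711, 262208),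
    (107692, 131136), (110601, 413232), (115204, 138640), (115978, 266404), (116843, 398864),
    (142230, 119809), (142488, 311328), (143954, 35204), (147551, 73856), (149329, 360450),
    (150064, 65921), (164556, 290850), (165314, 330248), (168295, 8200), (170760, 327826),
    (171014, 336417), (196000, 65554), (206432, 36870), (212900, 32776), (229979, 24608),
    (262856, 71697), (266153, 114692), (266595, 98308), (267885, 32770), (269068, 188561),
    (269314, 147688), (289025, 131684), (329776, 144001), (332276, 156673), (334997, 139528),
    (356434, 166945), (369002, 2049), (371461, 151714), (373441, 132110), (383240, 140897),
    (402225, 4098), (405072, 49410), (405658, 19457), (425988, 97162), (429413, 90122),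
    (431265, 74564), (468136, 49744), (471053, 19536), (491667, 832)]

def duals2 : List (ℕ × ℕ) := [
    (384303104, 3370279580), (793247744, 6286027576), (1658322944, 8128946180),
    (1738539008, 7942236916), (1549271040, 5971503572), (523239424, 2797605904),
    (1539309568, 3735033132), (2049441792, 1184233904), (1768947712, 2021530640),
    (1371013120, 2696273400), (750256128, 1004994324), (902823936, 7557836016),
    (163681, 2422834168), (330527, 4927451532), (319244, 4552347636), (74305, 6902808484),
    (106153, 77185044), (503112, 425172964), (154227, 4905234648), (20706, 4278591632),
    (64991, 5702699372), (492227, 4815787528), (10173, 6152904316), (274878, 4250898960),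
    (340878, 8324299480), (442079, 3836433876), (210834, 1760982020), (492500, 2162821964),
    (370458, 2594651412), (345556, 1330295064), (392570, 285675828)]

def data2 : Data where
  L := leftRows2
  R := rightRows2
  H := [16853351006208, 20401295982592]
  W1 := octads
  W2 := eights2
  K := sixteens2
  F := duals2
  S := [1228341, 1167978]
  x6 := 70802

def leftRows3 : List (ℕ × ℕ) := [
    (8389596, 1963957685186), (4197774, 9650036541411), (2099953, 29407104205614),
    (1050098, 19916216337092), (527419, 1884282685809), (262383, 13612395529638),
    (133994, 10034452892556), (69197, 22678316516031), (35159, 7664352365903),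
    (18345, 10965135393118), (12084, 6967108043277), (5783, 27129228036556)]

def rightRows3 : List (ℕ × ℕ) := [
    (9223374280337653760, 9797105617294), (4611687223752916992, 14100193086575),
    (2305875646099750912, 10833635573909), (1152930331586723840, 34100228391654),
    (576490860510707712, 21894115885609), (288237310829395968, 26834620123548),
    (144121504378912768, 33008534946776), (72064341347663872, 34959960049241),
    (36043329326022656, 22201810027330), (18035035961556992, 8317858481829),
    (9015052451446784, 184230611699), (4508253123772416, 7769176411861),
    (2256179992461312, 27677339681896), (1153733979275264, 4835176875876),
    (589243172782080, 34960715024715), (298027378016256, 24530454054793),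
    (172264041480192, 32724899335767), (82697011593216, 18167309011536),
    (69049635569664, 2530373271982)]

def eights3 : List (ℕ × List ℕ) := [

    (5, [458754, 393224, 147472, 344096, 147520, 135296, 459008, 213504, 5120, 268288, 90112, 32768]),
    (17, [65538, 196612, 163848, 200736, 98368, 229504, 4352, 102912, 119808, 219136, 90112, 262144]),
    (32, [35329, 165890, 117252, 18952, 51216, 215104, 182912, 49920, 164864, 135168, 90112, 262144]),
    (39, [294920, 98320, 262208, 262272, 295168, 328192, 33792, 264192, 36864, 40960, 376832, 131072]),
    (80, [98305, 163842, 98308, 376840, 409632, 475264, 82176, 49664, 246784, 346112, 249856, 352256]),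
    (138, [65537, 262148, 65552, 131104, 65600, 196864, 512, 164864, 395264, 135168, 172032, 507904]),
    (176, [327681, 16386, 376836, 294920, 360512, 49408, 82432, 33792, 264192, 348160, 270336, 131072]),
    (258, [167937, 167940, 327688, 397328, 426016, 393280, 491648, 512, 197632, 362496, 368640, 49152]),
    (289, [409602, 65540, 262152, 65552, 458816, 147584, 344576, 410624, 18432, 462848, 270336, 32768]),
    (338, [65537, 65540, 294920, 327712, 262272, 98816, 33792, 264192, 4096, 270336, 81920, 131072]),
    (512, [20481, 356354, 65540, 294920, 53264, 278560, 114752, 127104, 356608, 33792, 264192, 131072]),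
    (552, [65537, 393218, 65540, 65552, 204864, 401536, 270592, 140288, 272384, 462848, 16384, 32768]),
    (777, [278530, 65540, 65552, 32, 278592, 65664, 328704, 67584, 331776, 352256, 32768, 131072]),
    (784, [81921, 212994, 278532, 147464, 409632, 81984, 475264, 345088, 395264, 135168, 90112, 229376]),
    (1041, [331778, 397316, 327688, 131104, 393280, 196736, 397568, 512, 67584, 73728, 278528, 294912]),
    (1089, [2, 196612, 425992, 65552, 327712, 262272, 33024, 229888, 395264, 135168, 401408, 212992]),
    (1160, [458753, 262146, 196612, 491536, 32, 294976, 459008, 426496, 460800, 200704, 466944, 409600]),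
    (1282, [81921, 196612, 163848, 98320, 131104, 98368, 229504, 33280, 149504, 69632, 90112, 262144]),
    (1299, [196612, 65544, 65568, 131136, 128, 512, 133120, 135168, 139264, 212992, 229376, 262144]),
    (1539, [65540, 458760, 262160, 196640, 262208, 131200, 393472, 395264, 135168, 270336, 344064, 229376]),
    (2073, [135170, 397316, 32, 262208, 262272, 266496, 512, 394240, 270336, 409600, 425984, 327680]),
    (2176, [81921, 212994, 278532, 114696, 114704, 409632, 180288, 16640, 49664, 443392, 135168, 90112]),
    (2304, [180225, 311298, 294916, 425992, 98320, 131104, 360512, 262272, 295424, 164864, 167936, 352256]),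
    (2960, [1, 131074, 4, 32776, 131104, 163904, 164864, 135168, 8192, 16384, 65536, 262144]),
    (3074, [69633, 266244, 294920, 98320, 32, 360512, 299136, 327936, 295424, 270336, 81920, 131072]),
    (3080, [65537, 69634, 397316, 65552, 393248, 131136, 458880, 135424, 512, 73728, 16384, 32768]),
    (3616, [65537, 262146, 196612, 393224, 65552, 65600, 262272, 262400, 331776, 139264, 16384, 32768]),
    (4099, [65540, 294920, 16400, 278560, 114752, 262272, 33024, 49664, 33792, 264192, 352256, 131072]),
    (4132, [49409, 33026, 294920, 49424, 311360, 262272, 49664, 33792, 264192, 24576, 327680, 131072]),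
    (4416, [81921, 65538, 196612, 163848, 49168, 213024, 229504, 115200, 99328, 198656, 90112, 262144]),
    (4433, [65538, 65540, 65544, 16416, 128, 82432, 66560, 2048, 90112, 98304, 131072, 262144]),
    (4611, [65540, 294920, 360464, 32, 360512, 32896, 262400, 33792, 264192, 270336, 278528, 131072]),
    (5120, [65537, 409602, 65540, 294920, 491536, 409632, 491584, 311424, 393472, 229888, 395264, 270336]),
    (5186, [81921, 196612, 65544, 147472, 147488, 128, 196864, 213504, 133120, 90112, 229376, 262144]),
    (6177, [147458, 81924, 213000, 65552, 16448, 213120, 196864, 512, 82944, 90112, 163840, 262144]),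
    (8193, [66050, 295428, 294920, 98320, 377376, 311872, 262272, 99072, 33792, 264192, 348160, 131072]),
    (8230, [65537, 32776, 98320, 98368, 128, 49408, 82432, 33792, 2048, 86016, 131072, 262144]),
    (8342, [327681, 327688, 32, 262208, 327936, 328192, 66560, 264192, 69632, 278528, 98304, 131072]),
    (8369, [262146, 65540, 262152, 262208, 262400, 328192, 1024, 264192, 4096, 344064, 32768, 131072]),
    (10240, [81921, 196610, 65540, 294920, 278544, 376864, 278592, 98432, 196864, 344576, 328704, 462848]),
    (16913, [331778, 266244, 8, 32, 65600, 262272, 69888, 263168, 264192, 270336, 294912, 131072]),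
    (17057, [327682, 65540, 327688, 262160, 262208, 262400, 66560, 264192, 4096, 270336, 98304, 131072]),
    (17448, [65537, 196610, 262148, 65552, 65600, 262272, 196864, 512, 395264, 135168, 139264, 32768]),
    (17476, [458753, 65538, 327688, 131088, 327712, 262272, 131328, 512, 264192, 397312, 270336, 229376]),
    (17570, [262145, 262148, 131080, 262160, 262208, 393472, 512, 395264, 135168, 270336, 425984, 327680]),
    (17920, [65537, 69634, 135172, 8200, 65552, 131104, 204864, 139392, 209152, 10240, 32768, 262144]),
    (18464, [65537, 204802, 270340, 270344, 65552, 204864, 401536, 65792, 512, 140288, 143360, 32768]),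
    (18952, [65537, 69634, 4100, 65552, 32, 65600, 262272, 69888, 1024, 270336, 32768, 393216]),
    (20481, [401410, 270340, 303112, 262160, 139296, 434240, 401536, 295168, 512, 173056, 296960, 327680]),
    (20498, [327681, 4, 294920, 32, 360512, 32896, 327936, 295424, 33792, 264192, 270336, 131072]),
    (20642, [65537, 65540, 32776, 98320, 98368, 256, 98816, 33792, 2048, 8192, 131072, 262144]),
    (23568, [262145, 327682, 65540, 262152, 32, 327744, 65664, 327936, 262656, 270336, 32768, 131072]),
    (24651, [65540, 65552, 32, 65664, 65792, 512, 66560, 67584, 69632, 32768, 131072, 262144]),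
    (25104, [65537, 294914, 65540, 294920, 327712, 262208, 262272, 262400, 33792, 264192, 4096, 131072]),
    (25410, [262145, 262148, 262152, 262160, 32, 262272, 1024, 264192, 4096, 32768, 327680, 131072]),
    (28804, [65537, 65538, 32776, 98320, 32, 98368, 65792, 33280, 33792, 2048, 131072, 262144]),
    (32768, [151553, 282626, 151556, 394248, 414736, 409632, 328768, 459904, 266496, 17920, 395264, 352256]),
    (32785, [4098, 397316, 131080, 131104, 65600, 196736, 266496, 512, 66560, 198656, 270336, 81920]),
    (32834, [81921, 458756, 131080, 81936, 409632, 262272, 256, 213504, 394240, 395264, 69632, 155648]),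
    (32900, [65537, 131074, 8, 65552, 409632, 475200, 262400, 328192, 394240, 264192, 217088, 270336]),
    (33026, [65537, 65540, 132104, 199696, 131104, 66624, 68736, 134656, 200704, 73728, 16384, 262144]),
    (33792, [81921, 86018, 135172, 18440, 65552, 131104, 215104, 196736, 203008, 512, 90112, 262144]),
    (33824, [20481, 16898, 65540, 21000, 4624, 86080, 4224, 4352, 6144, 90112, 131072, 262144]),
    (34824, [262145, 266242, 397316, 65552, 393248, 65600, 458880, 266496, 512, 328704, 270336, 344064]),
    (35474, [65537, 65540, 65544, 32, 64, 65792, 66560, 69632, 73728, 16384, 131072, 262144]),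
    (37888, [458753, 139266, 458756, 401416, 204816, 32, 335936, 262272, 270592, 328192, 395264, 409600]),
    (40968, [81921, 65538, 196612, 278544, 16416, 278592, 262272, 65792, 344576, 328704, 264192, 331776]),
    (43524, [327681, 262146, 327688, 327696, 32, 262208, 65664, 327936, 66560, 69632, 278528, 131072]),
    (49664, [198657, 202754, 135172, 131080, 65552, 131104, 65600, 2176, 203008, 134144, 8192, 262144]),
    (65537, [286722, 155652, 425992, 49168, 401440, 16448, 188544, 319744, 41472, 58368, 419840, 61440]),
    (65540, [180225, 311298, 425992, 24592, 426016, 57408, 262272, 278784, 512, 394240, 10240, 397312]),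
    (65552, [20481, 286722, 24580, 294920, 278560, 53312, 57472, 266496, 49664, 33792, 264192, 131072]),
    (65640, [294913, 425986, 294916, 262160, 262272, 393472, 512, 33792, 395264, 135168, 139264, 49152]),
    (65696, [20481, 24578, 4100, 32776, 53264, 53312, 24832, 45568, 33792, 2048, 131072, 262144]),
    (66064, [20481, 32770, 20484, 294920, 278560, 4160, 262272, 256, 33792, 264192, 270336, 131072]),
    (66112, [167937, 163842, 167940, 40968, 135184, 163872, 139392, 8448, 173056, 10240, 49152, 262144]),
    (66208, [16385, 258, 16644, 262152, 16400, 320, 1024, 264192, 4096, 270336, 32768, 131072]),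
    (66370, [266241, 266244, 8, 266256, 32, 262272, 263168, 264192, 270336, 278528, 294912, 131072]),
    (67844, [294913, 163842, 425992, 262160, 32, 131136, 262272, 426496, 33792, 36864, 303104, 409600]),
    (69953, [262146, 4, 294920, 294928, 32, 32896, 295424, 33792, 264192, 270336, 278528, 131072]),
    (73862, [16385, 32776, 49168, 16416, 49216, 256, 49664, 33792, 2048, 4096, 131072, 262144]),
    (74008, [20481, 16386, 4100, 32, 16448, 4224, 512, 5120, 6144, 32768, 131072, 262144]),
    (74257, [278530, 262148, 262152, 32, 278592, 262272, 278784, 1024, 264192, 4096, 32768, 131072]),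
    (81921, [33026, 33284, 294920, 784, 295456, 320, 262272, 33792, 264192, 4096, 270336, 131072]),
    (82259, [4, 8, 32, 128, 512, 1024, 2048, 4096, 8192, 32768, 131072, 262144]),
    (83008, [164097, 33026, 32772, 163848, 131344, 163872, 128, 512, 133120, 135168, 139264, 262144]),
    (86018, [41217, 32772, 32776, 8464, 40992, 8512, 128, 8704, 33792, 2048, 131072, 262144]),
    (90112, [266241, 299522, 266244, 294920, 266256, 32, 262720, 262272, 267008, 33792, 264192, 131072]),
    (94244, [513, 2, 8, 528, 576, 128, 256, 1024, 2048, 32768, 131072, 262144]),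
    (98320, [16385, 394242, 1028, 394248, 409632, 16448, 132224, 393472, 17920, 395264, 135168, 24576]),
    (99072, [147457, 2, 262148, 131080, 147472, 409632, 147520, 262272, 394240, 395264, 135168, 155648]),
    (131072, [81921, 86018, 116740, 280584, 65552, 120864, 350272, 55424, 329984, 512, 89088, 90112]),
    (131104, [278529, 299010, 331780, 36872, 311312, 81984, 262272, 266496, 49664, 33792, 268288, 90112]),
    (131556, [65537, 2, 65544, 65552, 512, 66560, 67584, 69632, 73728, 16384, 32768, 262144]),
    (131856, [262145, 266242, 4, 327688, 4128, 266304, 69760, 5120, 264192, 270336, 344064, 32768]),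
    (132224, [65537, 282626, 65540, 65544, 262160, 331808, 86080, 82176, 344576, 264192, 352256, 360448]),
    (133248, [262145, 266242, 4, 360456, 299024, 4128, 299072, 266496, 365056, 37888, 270336, 344064]),
    (134152, [81921, 49154, 81924, 65552, 49184, 16448, 114816, 98560, 512, 102400, 90112, 262144]),
    (135168, [81921, 311298, 327684, 270344, 98320, 32, 335936, 57472, 24832, 123392, 287744, 59392]),
    (136233, [65538, 4, 65552, 65600, 128, 65792, 512, 2048, 8192, 81920, 32768, 262144]),
    (151553, [73730, 262148, 65544, 65552, 327712, 65600, 262272, 73984, 512, 328704, 272384, 32768]),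
    (163976, [262145, 327682, 65540, 263184, 32, 263232, 327936, 329216, 329728, 69632, 270336, 344064]),
    (164864, [81921, 86018, 4100, 20488, 65552, 32, 278592, 65664, 266496, 512, 268288, 90112]),
    (165896, [81921, 86018, 16388, 65552, 20512, 4160, 86144, 16640, 512, 5120, 90112, 262144]),
    (196612, [278529, 282626, 294920, 278544, 266272, 53312, 4224, 49408, 512, 300032, 34816, 270336]),
    (196680, [278529, 262146, 286724, 278544, 16416, 262272, 262400, 16896, 1024, 264192, 4096, 32768]),
    (237632, [20481, 4098, 20484, 4104, 16400, 16416, 128, 4352, 20992, 5120, 2048, 262144]),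
    (262144, [6145, 86018, 200708, 165896, 6160, 32, 114752, 65664, 119040, 49664, 33792, 155648]),
    (262272, [81921, 147458, 65540, 114696, 34832, 131104, 180288, 2304, 100864, 230400, 200704, 90112]),
    (263176, [81921, 147458, 16388, 65552, 213024, 180288, 147584, 98560, 512, 100352, 200704, 90112]),
    (264192, [81921, 49154, 164868, 114696, 65552, 197664, 180288, 132224, 196864, 512, 102400, 90112]),
    (264217, [81922, 65540, 32, 81984, 65664, 82176, 16896, 1024, 4096, 24576, 32768, 131072]),
    (264976, [81921, 16386, 65540, 81928, 32, 16448, 65664, 66560, 69632, 90112, 32768, 131072]),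
    (266273, [196610, 133124, 131080, 65552, 65600, 133248, 196864, 512, 3072, 139264, 212992, 32768]),
    (266276, [147457, 2050, 133128, 147472, 147520, 131200, 2304, 16896, 1024, 155648, 32768, 196608]),
    (266496, [65537, 155650, 90116, 8200, 65552, 131104, 204864, 139392, 90624, 132096, 10240, 32768]),
    (268288, [81921, 163842, 81924, 49160, 98320, 131104, 245824, 147584, 49408, 82432, 164864, 40960]),
    (270336, [81921, 102402, 196612, 65544, 114704, 147488, 217152, 229504, 196864, 49664, 5120, 100352]),
    (270597, [131074, 131080, 65552, 131104, 65600, 196736, 512, 66560, 198656, 135168, 81920, 229376]),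
    (272552, [65537, 2, 65540, 65552, 64, 256, 66048, 1024, 4096, 81920, 32768, 131072]),
    (275522, [65537, 65540, 65544, 65552, 32, 65664, 65792, 512, 67584, 16384, 32768, 131072]),
    (283657, [65538, 65540, 65552, 32, 65600, 65664, 65792, 512, 67584, 8192, 32768, 131072]),
    (284416, [65537, 2, 65540, 65544, 65552, 32, 64, 65664, 67584, 73728, 32768, 131072]),
    (294920, [81921, 86018, 196612, 65552, 200736, 131136, 135296, 151808, 512, 5120, 83968, 90112]),
    (295298, [81921, 65540, 81928, 16400, 32, 16448, 82432, 66560, 18432, 69632, 90112, 131072]),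
    (296064, [147457, 16386, 4, 131592, 131600, 131104, 131648, 16640, 149504, 135168, 155648, 196608]),
    (297984, [81921, 212994, 81924, 65544, 65552, 213024, 131136, 147584, 16640, 512, 135168, 90112]),
    (303380, [1, 65538, 8, 32, 65600, 65664, 512, 66560, 67584, 69632, 81920, 131072]),
    (338440, [16385, 16386, 4, 16400, 32, 16448, 128, 16640, 1024, 4096, 32768, 131072]),
    (352256, [6145, 2050, 4100, 133128, 6160, 32, 6208, 131200, 2304, 137728, 1024, 32768]),
    (360460, [24577, 16386, 24592, 32, 16448, 8320, 24832, 512, 9216, 10240, 12288, 131072]),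
    (393482, [65537, 65540, 98320, 32, 98368, 98432, 33280, 33792, 2048, 69632, 73728, 16384]),
    (394248, [81921, 16386, 83972, 65552, 18464, 65600, 84096, 16640, 512, 69632, 90112, 32768]),
    (395264, [81921, 86018, 69764, 86152, 65552, 65696, 86080, 65792, 512, 5120, 90112, 32768]),
    (397316, [16385, 114690, 114696, 49168, 65568, 81984, 128, 82176, 49664, 33792, 83968, 90112]),
    (409632, [69633, 65538, 2052, 6152, 65552, 65600, 2176, 65792, 512, 5120, 8192, 32768]),
    (425992, [65537, 69634, 65540, 65552, 69664, 6208, 4224, 2304, 512, 72704, 73728, 16384]),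
    (426528, [65537, 69634, 65540, 69640, 65552, 65600, 69760, 69888, 1024, 71680, 8192, 16384]),
    (429056, [65537, 69634, 4, 4104, 65552, 4128, 65600, 69760, 69888, 512, 73728, 16384])]

def sixteens3 : List (ℕ × ℕ) := [
    (234, 492545), (615, 389256), (653, 164864), (1440, 461393), (1837, 237632), (1991, 409632),
    (23299, 196612), (23529, 204816), (23598, 205057), (23748, 459306), (43088, 280097),
    (44528, 131075), (61748, 1089), (65564, 275522), (65782, 8193), (66193, 298242),
    (66902, 151553), (67377, 268290), (88466, 294920), (88863, 164864), (89138, 33089),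
    (109830, 609), (128098, 394116), (135621, 344082), (136008, 123940), (136098, 81921),
    (136293, 338440), (136706, 330049), (149579, 66064), (150060, 9473), (150785, 77826),
    (151436, 266273), (178968, 65569), (188657, 1542), (189052, 5506), (201875, 49664),
    (202270, 262272), (253959, 5024), (255786, 266368), (268888, 32900), (278875, 65540),
    (278961, 99842), (280182, 80129), (307720, 198915), (321803, 131728), (322625, 70196),
    (323110, 200705), (333859, 42628), (334025, 172802), (334404, 33809), (344864, 144402),
    (345101, 172290), (372889, 1282), (373268, 1089), (374073, 131078), (396378, 37380),
    (396464, 57857), (413812, 2051), (414227, 1412), (434496, 3085), (435210, 23361),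
    (461068, 8369), (461697, 29800), (461894, 53249), (462369, 45250), (479336, 3841),
    (500060, 20512)]

def duals3 : List (ℕ × ℕ) := [
    (384303104, 3370987120), (793247744, 6287066344), (1658322944, 8130239016),
    (1738539008, 7943809456), (1549271040, 5971050096), (523239424, 2798325124),
    (1539309568, 3735713752), (2049441792, 1184089840), (1768947712, 2020988976),
    (1371013120, 2694932176), (750256128, 1005071280), (902823936, 7557975692),
    (162655, 4513856500), (503753, 126149864), (82259, 4423472112), (272552, 1400034048),
    (272890, 2075285148), (220549, 2550087912), (281578, 7234791548), (163404, 2986851884),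
    (115949, 5548018380), (311031, 2994710016), (62778, 2453929108), (471261, 5933491728),
    (168696, 3747305856), (8163, 1032983536), (58475, 4953678192), (103503, 6394313200),
    (218490, 4639588024), (289627, 1632690016), (32680, 1768844564)]

def data3 : Data where
  L := leftRows3
  R := rightRows3
  H := [9690301857792, 23054495252480]
  W1 := octads
  W2 := eights3
  K := sixteens3
  F := duals3
  S := [463037, 329942]
  x6 := 777


/-! ### Kernel evaluation of the checks -/

section
set_option maxRecDepth 100000

theorem valid1 : Valid data1 where
  len := by decide +kernel
  orth := by decide +kernel
  wt := by decide +kernel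
  maskL := by decide +kernel
  maskT := by decide +kernel
  rows := by decide +kernel
  duals := by decide +kernel
  mid := by decide +kernel
  allOnes := by decide +kernel
  minL := by decide +kernel
  minT := by decide +kernel
  eightL := by decide +kernel
  eightR := by decide +kernel
  sixteenL := by decide +kernel
  sixteenR := by decide +kernel
  certL := by decide +kernel
  certR := by decide +kernel
  kern := by decide +kernel
  pairs := by decide +kernel
  six := by decide +kernel
  inc := by decide +kernel

theorem valid2 : Valid data2 where
  len := by decide +kernel
  orth := by decide +kernel
  wt := by decide +kernel
  maskL := by decide +kernel
  maskT := by decide +kernel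
  rows := by decide +kernel
  duals := by decide +kernel
  mid := by decide +kernel
  allOnes := by decide +kernel
  minL := by decide +kernel
  minT := by decide +kernel
  eightL := by decide +kernel
  eightR := by decide +kernel
  sixteenL := by decide +kernel
  sixteenR := by decide +kernel
  certL := by decide +kernel
  certR := by decide +kernel
  kern := by decide +kernel
  pairs := by decide +kernel
  six := by decide +kernel
  inc := by decide +kernel

theorem valid3 : Valid data3 where
  len := by decide +kernel
  orth := by decide +kernel
  wt := by decide +kernel
  maskL := by decide +kernel
  maskT := by decide +kernel
  rows := by decide +kernel
  duals := by decide +kernel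
  mid := by decide +kernel
  allOnes := by decide +kernel
  minL := by decide +kernel
  minT := by decide +kernel
  eightL := by decide +kernel
  eightR := by decide +kernel
  sixteenL := by decide +kernel
  sixteenR := by decide +kernel
  certL := by decide +kernel
  certR := by decide +kernel
  kern := by decide +kernel
  pairs := by decide +kernel
  six := by decide +kernel
  inc := by decide +kernel

theorem count1 : data1.W1.length + data1.W2.length = 904 := by decide +kernel
theorem count2 : data2.W1.length + data2.W2.length = 892 := by decide +kernel
theorem count3 : data3.W1.length + data3.W2.length = 898 := by decide +kernel

end

def theData : Fin 3 → Data := ![data1, data2, data3]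

theorem theValid : ∀ i, Valid (theData i) := by
  intro i
  fin_cases i
  · exact valid1
  · exact valid2
  · exact valid3

theorem ec1 : eightCount (code data1 : Set (Fin 64 → ZMod 4)) = 904 :=
  (eight_count valid1).trans count1

theorem ec2 : eightCount (code data2 : Set (Fin 64 → ZMod 4)) = 892 :=
  (eight_count valid2).trans count2

theorem ec3 : eightCount (code data3 : Set (Fin 64 → ZMod 4)) = 898 :=
  (eight_count valid3).trans count3

attribute [irreducible] data1 data2 data3

theorem theCount : ∀ i, eightCount (code (theData i) : Set (Fin 64 → ZMod 4)) =
    (![904, 892, 898] : Fin 3 → ℕ) i := by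
  intro i
  fin_cases i
  · exact ec1
  · exact ec2
  · exact ec3

end Z4Comp

theorem stmt11 : ∃ C : Fin 3 → Submodule (ZMod 4) (Fin 64 → ZMod 4),
    (∀ i, IsExtremalTypeIIZ4 64 (C i : Set (Fin 64 → ZMod 4))) ∧
    (∀ i, Module.finrank (ZMod 2)
      (Submodule.span (ZMod 2) (residueSet (C i : Set (Fin 64 → ZMod 4)))) = 31) ∧
    ∀ i j, i ≠ j →
      ¬ MonomiallyEquiv (C i : Set (Fin 64 → ZMod 4)) (C j : Set (Fin 64 → ZMod 4)) := by
  refine ⟨fun i => Z4Comp.code (Z4Comp.theData i), ?_, ?_, ?_⟩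
  · intro i
    exact Z4Comp.code_extremal (Z4Comp.theValid i)
  · intro i
    exact Z4Comp.residue_finrank (Z4Comp.theValid i)
  · intro i j hij h
    have h1 := Z4Comp.residue_equiv h
    rw [Z4Comp.theCount, Z4Comp.theCount] at h1
    have h2 : ∀ i j : Fin 3, (![904, 892, 898] : Fin 3 → ℕ) j =
        (![904, 892, 898] : Fin 3 → ℕ) i → i = j := by decide
    exact hij (h2 i j h1)
end

section
/- There exists a doubly even binary linear code of length 64 and dimension 31 whose minimum Hamming weight is exactly 12 (a binary [64,31,12] code all of whose weights are divisible by 4). -/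
open Finset

namespace Code64

/-- The `k`-th row of the reverse circulant block, as a 32-bit mask. -/
def row (k : ℕ) : ℕ := Nat.mod (Nat.shiftRight 3009281721544941 k) 4294967296

/-- Bit vector of a natural number. -/
def vec (m n : ℕ) : Fin m → ZMod 2 := fun i => if n.testBit i then 1 else 0

lemma vec_xor (m a b : ℕ) : vec m (a ^^^ b) = vec m a + vec m b := by
  funext i
  simp only [vec, Nat.testBit_xor, Pi.add_apply]
  cases a.testBit i <;> cases b.testBit i <;> decide

lemma vec_zero (m : ℕ) : vec m 0 = 0 := by
  funext i
  simp [vec]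

lemma mem_supp (m n : ℕ) (i : Fin m) :
    i ∈ Finset.univ.filter (fun i => vec m n i ≠ 0) ↔ n.testBit i = true := by
  simp [vec]

/-- `ge t n`: at least `t` bits of `n` are set. -/
def ge (t : ℕ) : ℕ → Bool :=
  Nat.rec (fun _ => true)
    (fun _ ih n => Nat.rec false (fun m _ => ih (Nat.land (Nat.succ m) m)) n) t

lemma ge_succ (t n : ℕ) (h : ge (t + 1) n = true) : 1 ≤ n ∧ ge t (n &&& (n - 1)) = true := by
  cases n with
  | zero => exact absurd h (by simp [ge])
  | succ m => exact ⟨by omega, h⟩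

lemma ge_spec (m t : ℕ) : ∀ n, n < 2 ^ m → ge t n = true → t ≤ hWt (vec m n) := by
  induction t with
  | zero => intros; omega
  | succ t ih =>
    intro n hn h
    obtain ⟨h1, h2⟩ := ge_succ t n h
    have hle : n &&& (n - 1) ≤ n - 1 := Nat.and_le_right
    have hlt : n &&& (n - 1) < n := by omega
    have := ih _ (lt_trans hlt hn) h2
    refine lt_of_le_of_lt this ?_
    unfold hWt
    apply Finset.card_lt_card
    rw [Finset.ssubset_iff_subset_ne]
    constructor
    · intro i
      rw [mem_supp, mem_supp, Nat.testBit_and, Bool.and_eq_true]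
      exact fun h => h.1
    · intro heq
      apply hlt.ne
      apply Nat.eq_of_testBit_eq
      intro i
      by_cases hi : i < m
      · have := Finset.ext_iff.mp heq ⟨i, hi⟩
        rw [mem_supp, mem_supp] at this
        exact Bool.eq_iff_iff.mpr this
      · have hp : 2 ^ m ≤ 2 ^ i := Nat.pow_le_pow_right (by norm_num) (by omega)
        rw [Nat.testBit_lt_two_pow (by omega), Nat.testBit_lt_two_pow (by omega)]

def leaf (t acc : ℕ) : Bool := Nat.ble 4 t || ge (5 + t) acc

/-- Search through all sums of at most `t` among the first `k` rows. -/
noncomputable def chk (k : ℕ) : ℕ → ℕ → Bool :=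
  Nat.rec leaf (fun k ih t a =>
    Nat.rec (leaf 0 a) (fun s _ => Bool.rec false
      (Nat.rec false (fun m _ => ih s (Nat.succ m)) (Nat.xor a (row k))) (ih (Nat.succ s) a)) t) k

lemma chk_succ (k t a : ℕ) (h : chk (k + 1) (t + 1) a = true) :
    chk k (t + 1) a = true ∧ chk k t (a ^^^ row k) = true := by
  have e : chk (k + 1) (t + 1) a = Bool.rec false
      (Nat.rec false (fun m _ => chk k t (Nat.succ m)) (a ^^^ row k)) (chk k (t + 1) a) := rfl
  rw [e] at h
  cases h1 : chk k (t + 1) a with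
  | false => simp [h1] at h
  | true =>
    rw [h1] at h
    refine ⟨rfl, ?_⟩
    cases h2 : a ^^^ row k with
    | zero => simp [h2] at h
    | succ m => rw [h2] at h; exact h

set_option maxRecDepth 100000 in
lemma chk_true : chk 32 4 0 = true := by decide +kernel

def wt (u : ℕ → ZMod 2) : ℕ → ℕ
  | 0 => 0
  | k + 1 => wt u k + if u k ≠ 0 then 1 else 0

def acc (u : ℕ → ZMod 2) : ℕ → ℕ
  | 0 => 0
  | k + 1 => if u k ≠ 0 then row k ^^^ acc u k else acc u k

lemma acc_zero (u : ℕ → ZMod 2) (k : ℕ) (h : wt u k = 0) : acc u k = 0 := by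
  induction k with
  | zero => rfl
  | succ k ih =>
    simp only [wt] at h
    by_cases hu : u k = 0
    · simp [acc, hu]; exact ih (by omega)
    · simp [hu] at h

lemma chk_spec (u : ℕ → ZMod 2) (k : ℕ) : ∀ t a, chk k t a = true → wt u k ≤ t →
    leaf (t - wt u k) (a ^^^ acc u k) = true := by
  induction k with
  | zero => intro t a h _; simpa [chk, wt, acc] using h
  | succ k ih =>
    intro t a h hw
    cases t with
    | zero =>
      have h0 : wt u (k+1) = 0 := by omega
      rw [acc_zero u _ h0, h0]
      simpa [chk] using h
    | succ t =>
      replace h := chk_succ k t a h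
      simp only [wt] at hw ⊢
      by_cases hu : u k = 0
      · simp [acc, hu] at hw ⊢
        exact ih _ _ h.1 hw
      · simp [acc, hu] at hw ⊢
        have := ih _ _ h.2 hw
        rwa [Nat.xor_assoc] at this

lemma row_lt (k : ℕ) : row k < 2 ^ 32 := Nat.mod_lt _ (by norm_num)

lemma acc_lt (u : ℕ → ZMod 2) (k : ℕ) : acc u k < 2 ^ 32 := by
  induction k with
  | zero => simp [acc]
  | succ k ih =>
    simp only [acc]
    split_ifs
    · exact Nat.xor_lt_two_pow (row_lt k) ih
    · exact ih

lemma zmod2 (a : ZMod 2) : a = 0 ∨ a = 1 := by revert a; decide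

lemma vec_acc (u : ℕ → ZMod 2) (k : ℕ) :
    vec 32 (acc u k) = ∑ i ∈ Finset.range k, u i • vec 32 (row i) := by
  induction k with
  | zero => simp [acc, vec_zero]
  | succ k ih =>
    rw [Finset.sum_range_succ, ← ih]
    rcases zmod2 (u k) with h | h
    · simp [acc, h]
    · simp [acc, h, vec_xor, add_comm]

lemma hWt_eq {n : ℕ} (x : Fin n → ZMod 2) : hWt x = ∑ i, if x i ≠ 0 then 1 else 0 := by
  unfold hWt; rw [Finset.card_filter]

lemma wt_eq (u : ℕ → ZMod 2) (k : ℕ) :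
    wt u k = ∑ i ∈ Finset.range k, if u i ≠ 0 then 1 else 0 := by
  induction k with
  | zero => rfl
  | succ k ih => rw [Finset.sum_range_succ, ← ih]; rfl

/-- The reverse circulant map. -/
def M (u : Fin 32 → ZMod 2) : Fin 32 → ZMod 2 := ∑ i : Fin 32, u i • vec 32 (row i)

lemma light (u : Fin 32 → ZMod 2) (h0 : u ≠ 0) (h4 : hWt u ≤ 4) : 9 ≤ hWt u + hWt (M u) := by
  let v : ℕ → ZMod 2 := fun i => if h : i < 32 then u ⟨i, h⟩ else 0
  have hv : ∀ i : Fin 32, v i = u i := fun i => by simp [v]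
  have hw : wt v 32 = hWt u := by
    rw [wt_eq, hWt_eq, ← Fin.sum_univ_eq_sum_range (fun i => if v i ≠ 0 then 1 else 0) 32]
    simp only [hv]
  have hM : vec 32 (acc v 32) = M u := by
    rw [vec_acc, ← Fin.sum_univ_eq_sum_range (fun i => v i • vec 32 (row i)) 32]
    simp only [hv, M]
  have := chk_spec v 32 4 0 chk_true (by omega)
  have hpos : 0 < hWt u := by
    obtain ⟨i, hi⟩ := Function.ne_iff.mp h0
    exact Finset.card_pos.mpr ⟨i, by simpa using hi⟩
  simp only [leaf, Bool.or_eq_true, Nat.ble_eq, Nat.zero_xor] at this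
  rcases this with h | h
  · omega
  · have := ge_spec 32 _ _ (acc_lt v 32) h
    rw [hM] at this
    omega

lemma Rm_sq : ∀ i k : Fin 32, ∑ j : Fin 32, vec 32 (row i) j * vec 32 (row j) k =
    if i = k then 1 else 0 := by
  decide +kernel

lemma M_apply (u : Fin 32 → ZMod 2) (j : Fin 32) : M u j = ∑ i, u i * vec 32 (row i) j := by
  simp [M, Finset.sum_apply]

lemma M_M (u : Fin 32 → ZMod 2) : M (M u) = u := by
  funext k
  rw [M_apply]
  simp only [M_apply, Finset.sum_mul]
  rw [Finset.sum_comm]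
  simp only [mul_assoc, ← Finset.mul_sum, Rm_sq]
  simp

lemma min9 (u : Fin 32 → ZMod 2) (h0 : u ≠ 0) : 9 ≤ hWt u + hWt (M u) := by
  by_contra hc
  by_cases h : hWt u ≤ 4
  · exact hc (light u h0 h)
  · have hM : M u ≠ 0 := by
      intro hz
      apply h0
      rw [← M_M u, hz]
      simp [M]
    have := light (M u) hM (by omega)
    rw [M_M] at this
    omega

/-- Generators. -/
def gen (i : Fin 32) : Fin 64 → ZMod 2 := vec 64 (2 ^ (i : ℕ) + 4294967296 * row i)

lemma gen_left : ∀ i j : Fin 32, gen i (Fin.castAdd 32 j) = if i = j then 1 else 0 := by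
  decide +kernel

lemma gen_right : ∀ i j : Fin 32, gen i (Fin.natAdd 32 j) = vec 32 (row i) j := by
  decide +kernel

lemma row_symm : ∀ i j : Fin 32, vec 32 (row i) j = vec 32 (row j) i := by
  decide +kernel

lemma gen_orth : ∀ i j : Fin 32, bInner (gen i) (gen j) = 0 := by
  intro i j
  unfold bInner
  rw [Fin.sum_univ_add (a := 32) (b := 32) (fun k : Fin (32 + 32) => gen i k * gen j k)]
  simp only [gen_left, gen_right]
  have h : ∑ k : Fin 32, vec 32 (row i) k * vec 32 (row j) k = if i = j then 1 else 0 := by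
    rw [← Rm_sq i j]
    exact Finset.sum_congr rfl fun k _ => by rw [row_symm j k]
  rw [h]
  by_cases hij : i = j
  · subst hij
    simp
    decide
  · simp [hij]

lemma gen_wt : ∀ i : Fin 32, hWt (gen i) = 12 := by
  unfold hWt
  decide +kernel

lemma hWt_add {n : ℕ} (x y : Fin n → ZMod 2) :
    hWt (x + y) + 2 * (∑ i, if x i ≠ 0 ∧ y i ≠ 0 then 1 else 0) = hWt x + hWt y := by
  simp only [hWt_eq, Finset.mul_sum, ← Finset.sum_add_distrib]
  apply Finset.sum_congr rfl
  intro i _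
  simp only [Pi.add_apply]
  rcases zmod2 (x i) with h | h <;> rcases zmod2 (y i) with h' | h' <;> simp [h, h']
  decide

lemma bInner_cast {n : ℕ} (x y : Fin n → ZMod 2) :
    ((∑ i, if x i ≠ 0 ∧ y i ≠ 0 then 1 else 0 : ℕ) : ZMod 2) = bInner x y := by
  unfold bInner
  push_cast
  apply Finset.sum_congr rfl
  intro i _
  generalize x i = a
  generalize y i = b
  revert a b
  decide

lemma four_dvd_add {n : ℕ} (x y : Fin n → ZMod 2) (hx : 4 ∣ hWt x) (hy : 4 ∣ hWt y)
    (h : bInner x y = 0) : 4 ∣ hWt (x + y) := by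
  have h1 := hWt_add x y
  rw [← bInner_cast, ZMod.natCast_eq_zero_iff] at h
  omega

lemma bInner_add {n : ℕ} (x y z : Fin n → ZMod 2) :
    bInner (x + y) z = bInner x z + bInner y z := by
  simp [bInner, add_mul, Finset.sum_add_distrib]

lemma sum_even (u : Fin 32 → ZMod 2) (s : Finset (Fin 32)) :
    4 ∣ hWt (∑ i ∈ s, u i • gen i) ∧ ∀ k, bInner (∑ i ∈ s, u i • gen i) (gen k) = 0 := by
  induction s using Finset.induction_on with
  | empty => simp [hWt, bInner]
  | insert a s ha ih =>
    rw [Finset.sum_insert ha]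
    rcases zmod2 (u a) with h | h
    · simpa [h] using ih
    · rw [h, one_smul, add_comm]
      refine ⟨four_dvd_add _ _ ih.1 (by rw [gen_wt]; norm_num) (ih.2 a), fun k => ?_⟩
      rw [bInner_add, ih.2, gen_orth, add_zero]

lemma E_left (u : Fin 32 → ZMod 2) (j : Fin 32) :
    (∑ i, u i • gen i) (Fin.castAdd 32 j) = u j := by
  simp [Finset.sum_apply, gen_left]

lemma E_right (u : Fin 32 → ZMod 2) (j : Fin 32) :
    (∑ i, u i • gen i) (Fin.natAdd 32 j) = M u j := by
  simp only [Finset.sum_apply, Pi.smul_apply, smul_eq_mul, gen_right, M_apply]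

lemma E_wt (u : Fin 32 → ZMod 2) : hWt (∑ i, u i • gen i) = hWt u + hWt (M u) := by
  rw [hWt_eq, hWt_eq, hWt_eq]
  rw [Fin.sum_univ_add (a := 32) (b := 32)
    (fun k : Fin (32 + 32) => if (∑ i, u i • gen i) k ≠ 0 then 1 else 0)]
  simp only [E_left, E_right]

lemma E_min (u : Fin 32 → ZMod 2) (h : u ≠ 0) : 12 ≤ hWt (∑ i, u i • gen i) := by
  have h1 := (sum_even u Finset.univ).1
  have h2 := min9 u h
  rw [← E_wt] at h2
  omega

/-- The linear map from 31 message bits. -/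
noncomputable def L : (Fin 31 → ZMod 2) →ₗ[ZMod 2] (Fin 64 → ZMod 2) :=
  Fintype.linearCombination (ZMod 2) (fun i : Fin 31 => gen i.castSucc)

lemma L_eq (v : Fin 31 → ZMod 2) :
    L v = ∑ i, (Fin.snoc v 0 : Fin 32 → ZMod 2) i • gen i := by
  rw [Fin.sum_univ_castSucc, Fin.snoc_last]
  simp [L, Fintype.linearCombination_apply]

lemma snoc_ne (v : Fin 31 → ZMod 2) (h : v ≠ 0) : (Fin.snoc v 0 : Fin 32 → ZMod 2) ≠ 0 := by
  obtain ⟨i, hi⟩ := Function.ne_iff.mp h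
  intro hz
  apply hi
  have := congrFun hz i.castSucc
  simpa using this

lemma L_inj : Function.Injective L := by
  rw [injective_iff_map_eq_zero]
  intro v hv
  by_contra h
  have := E_min _ (snoc_ne v h)
  rw [← L_eq, hv] at this
  simp [hWt] at this

end Code64

theorem stmt12 : ∃ D : Submodule (ZMod 2) (Fin 64 → ZMod 2),
    Module.finrank (ZMod 2) D = 31 ∧
    (∀ c ∈ D, 4 ∣ hWt c) ∧
    (∀ c ∈ D, c ≠ 0 → 12 ≤ hWt c) ∧
    (∃ c ∈ D, c ≠ 0 ∧ hWt c = 12) := by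
  refine ⟨LinearMap.range Code64.L, ?_, ?_, ?_, ?_⟩
  · rw [LinearMap.finrank_range_of_inj Code64.L_inj]
    simp
  · rintro _ ⟨v, rfl⟩
    rw [Code64.L_eq]
    exact (Code64.sum_even _ _).1
  · rintro _ ⟨v, rfl⟩ hne
    rw [Code64.L_eq]
    apply Code64.E_min
    apply Code64.snoc_ne
    rintro rfl
    simp at hne
  · refine ⟨Code64.gen 0, ⟨Pi.single 0 1, ?_⟩, ?_, Code64.gen_wt 0⟩
    · simp [Code64.L]
    · intro h
      have := Code64.gen_wt 0
      rw [h] at this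
      simp [hWt] at this
end
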